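/- arXiv:2107.02796 — 3 statements merged into one kernel-verified Lean document; each statement's English description precedes it below -/
import Mathlib

section
/- If G is a maximal outerplanar graph on n ≥ 4 vertices with t vertices of degree 2, then γ×2(G) ≤ min{⌊(n+t)/2⌋, n − t}. -/
open SimpleGraph

/-- `S` is a double dominating set of `G`: every vertex has at least two
vertices of its closed neighborhood in `S`. -/
def IsDoubleDomSet {V : Type*} [Fintype V] [DecidableEq V]
    (G : SimpleGraph V) [DecidableRel G.Adj] (S : Finset V) : Prop :=
  ∀ v : V, 2 ≤ (S ∩ insert v (G.neighborFinset v)).card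

/-- The double domination number `γ×2(G)`. -/
noncomputable def doubleDomNum {V : Type*} [Fintype V] [DecidableEq V]
    (G : SimpleGraph V) [DecidableRel G.Adj] : ℕ :=
  sInf {k | ∃ S : Finset V, IsDoubleDomSet G S ∧ S.card = k}

/-- `H` is a minor of `G`. -/
def HasMinor {V W : Type*} (G : SimpleGraph V) (H : SimpleGraph W) : Prop :=
  ∃ f : W → Set V,
    (∀ w, (f w).Nonempty) ∧
    (∀ w, (G.induce (f w)).Connected) ∧
    (Pairwise fun w₁ w₂ => Disjoint (f w₁) (f w₂)) ∧
    ∀ ⦃w₁ w₂⦄, H.Adj w₁ w₂ → ∃ a ∈ f w₁, ∃ b ∈ f w₂, G.Adj a b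

/-- A graph is outerplanar iff it has no `K₄` minor and no `K_{2,3}` minor. -/
def Outerplanar {V : Type*} (G : SimpleGraph V) : Prop :=
  ¬ HasMinor G (⊤ : SimpleGraph (Fin 4)) ∧
  ¬ HasMinor G (completeBipartiteGraph (Fin 2) (Fin 3))

/-- Maximal outerplanar: outerplanar, and adding any missing edge destroys
outerplanarity. -/
def MaximalOuterplanar {V : Type*} (G : SimpleGraph V) : Prop :=
  Outerplanar G ∧
  ∀ u v : V, u ≠ v → ¬ G.Adj u v →
    ¬ Outerplanar (G ⊔ SimpleGraph.fromEdgeSet {s(u, v)})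

/-- `T` is an internal triangle of `G`: a triangle none of whose edges lies
on any Hamiltonian cycle (for a maximal outerplanar graph on `≥ 4` vertices
the Hamiltonian cycle, i.e. the boundary of the outer face, is unique). -/
def IsInternalTriangle {V : Type*} [DecidableEq V] (G : SimpleGraph V) (T : Finset V) : Prop :=
  ∃ a b c : V, T = {a, b, c} ∧ a ≠ b ∧ a ≠ c ∧ b ≠ c ∧
    G.Adj a b ∧ G.Adj a c ∧ G.Adj b c ∧
    ∀ ⦃v : V⦄ (p : G.Walk v v), p.IsHamiltonianCycle →
      s(a, b) ∉ p.edges ∧ s(a, c) ∉ p.edges ∧ s(b, c) ∉ p.edges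

/-- `IsTwoTreeOn G s`: the induced subgraph of `G` on `s` is a 2-tree,
built from a triangle by repeatedly adding a vertex joined exactly to the
two endpoints of an existing edge. -/
inductive IsTwoTreeOn {V : Type*} [DecidableEq V] (G : SimpleGraph V) :
    Finset V → Prop
  | triangle {a b c : V} : a ≠ b → a ≠ c → b ≠ c →
      G.Adj a b → G.Adj a c → G.Adj b c → IsTwoTreeOn G {a, b, c}
  | grow {s : Finset V} {x y v : V} : IsTwoTreeOn G s → x ∈ s → y ∈ s →
      G.Adj x y → v ∉ s → (∀ u ∈ s, G.Adj v u ↔ u = x ∨ u = y) →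
      IsTwoTreeOn G (insert v s)

/-- `G` is a 2-tree (equivalently, a maximal `K₄`-minor-free graph). -/
def IsTwoTree {V : Type*} [Fintype V] [DecidableEq V] (G : SimpleGraph V) : Prop :=
  IsTwoTreeOn G Finset.univ


namespace DDom

/-- Non-crossing drawing of `G` on `s` along the order given by `f`. -/
def NC {V : Type*} (G : SimpleGraph V) (s : Finset V) (f : V → ℕ) : Prop :=
  (∀ a ∈ s, ∀ b ∈ s, f a = f b → a = b) ∧
  ∀ a ∈ s, ∀ b ∈ s, ∀ c ∈ s, ∀ d ∈ s, f a < f b → f b < f c → f c < f d →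
    G.Adj a c → G.Adj b d → False

/-- Connectedness phrased by cuts. -/
def CutConn {V : Type*} (G : SimpleGraph V) (S : Set V) : Prop :=
  ∀ X : Set V, (∃ a ∈ S, a ∈ X) → (∃ b ∈ S, b ∉ X) →
    ∃ u ∈ S, ∃ v ∈ S, u ∈ X ∧ v ∉ X ∧ G.Adj u v

theorem cutConn_of_connected {V : Type*} {G : SimpleGraph V} {S : Set V}
    (h : (G.induce S).Connected) : CutConn G S := by
  rintro X ⟨a, ha, haX⟩ ⟨b, hb, hbX⟩
  obtain ⟨p⟩ := h.preconnected ⟨a, ha⟩ ⟨b, hb⟩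
  obtain ⟨d, hd, h1, h2⟩ := p.exists_boundary_dart {x | x.1 ∈ X} haX hbX
  exact ⟨d.fst.1, d.fst.2, d.snd.1, d.snd.2, h1, h2, d.adj⟩

theorem CutConn.union {V : Type*} {G : SimpleGraph V} {S T : Set V}
    (hS : CutConn G S) (hT : CutConn G T) (h : ∃ a ∈ S, ∃ b ∈ T, G.Adj a b) :
    CutConn G (S ∪ T) := by
  obtain ⟨s, hs, t, ht, hst⟩ := h
  rintro X ⟨a, ha, haX⟩ ⟨b, hb, hbX⟩
  by_cases h1 : (∃ a ∈ S, a ∈ X) ∧ (∃ b ∈ S, b ∉ X)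
  · obtain ⟨u, hu, v, hv, h⟩ := hS X h1.1 h1.2
    exact ⟨u, Or.inl hu, v, Or.inl hv, h⟩
  by_cases h2 : (∃ a ∈ T, a ∈ X) ∧ (∃ b ∈ T, b ∉ X)
  · obtain ⟨u, hu, v, hv, h⟩ := hT X h2.1 h2.2
    exact ⟨u, Or.inr hu, v, Or.inr hv, h⟩
  by_cases hsX : s ∈ X
  · have hSX : ∀ x ∈ S, x ∈ X := by
      intro x hx; by_contra hc; exact h1 ⟨⟨s, hs, hsX⟩, x, hx, hc⟩
    have hbT : b ∈ T := by
      rcases hb with hb | hb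
      · exact absurd (hSX b hb) hbX
      · exact hb
    have htX : t ∉ X := fun hc => h2 ⟨⟨t, ht, hc⟩, b, hbT, hbX⟩
    exact ⟨s, Or.inl hs, t, Or.inr ht, hsX, htX, hst⟩
  · have hSX : ∀ x ∈ S, x ∉ X := by
      intro x hx hc; exact h1 ⟨⟨x, hx, hc⟩, s, hs, hsX⟩
    have haT : a ∈ T := by
      rcases ha with ha | ha
      · exact absurd haX (hSX a ha)
      · exact ha
    have htX : t ∈ X := by
      by_contra hc; exact h2 ⟨⟨a, haT, haX⟩, t, ht, hc⟩
    exact ⟨t, Or.inr ht, s, Or.inl hs, htX, hsX, hst.symm⟩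

theorem no_cross {V : Type*} [Fintype V] {G : SimpleGraph V} {f : V → ℕ}
    (hf : NC G Finset.univ f) {S T : Set V} (hS : CutConn G S) (hT : CutConn G T)
    (hd : Disjoint S T) {p p' q q' : V} (hp : p ∈ S) (hp' : p' ∈ S) (hq : q ∈ T) (hq' : q' ∈ T)
    (h1 : f p < f q) (h2 : f q < f p') (h3 : f p' < f q') : False := by
  obtain ⟨hinj, hc⟩ := hf
  have hne : ∀ x ∈ S, ∀ y ∈ T, f x ≠ f y := by
    intro x hx y hy h
    have := hinj x (Finset.mem_univ _) y (Finset.mem_univ _) h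
    subst this
    exact Set.disjoint_left.mp hd hx hy
  obtain ⟨u, hu, v, hv, huX, hvX, huv⟩ := hS {x | f q < f x ∧ f x < f q'}
    ⟨p', hp', h2, h3⟩ ⟨p, hp, by simp; omega⟩
  simp only [Set.mem_ofPred_eq] at huX hvX
  have a1 := hne v hv q hq
  have a2 := hne v hv q' hq'
  obtain ⟨u1, u2⟩ := huX
  by_cases hvq : f v < f q
  · obtain ⟨w, hw, z, hz, hwX, hzX, hwz⟩ := hT {x | f v < f x ∧ f x < f u}
      ⟨q, hq, hvq, u1⟩ ⟨q', hq', by simp; omega⟩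
    simp only [Set.mem_ofPred_eq] at hwX hzX
    have b1 := hne v hv z hz
    have b2 := hne u hu z hz
    by_cases hzv : f z < f v
    · exact hc z (Finset.mem_univ _) v (Finset.mem_univ _) w (Finset.mem_univ _) u
        (Finset.mem_univ _) hzv hwX.1 hwX.2 hwz.symm huv.symm
    · exact hc v (Finset.mem_univ _) w (Finset.mem_univ _) u (Finset.mem_univ _) z
        (Finset.mem_univ _) hwX.1 hwX.2 (by omega) huv.symm hwz
  · obtain ⟨w, hw, z, hz, hwX, hzX, hwz⟩ := hT {x | f u < f x ∧ f x < f v}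
      ⟨q', hq', u2, by omega⟩ ⟨q, hq, by simp; omega⟩
    simp only [Set.mem_ofPred_eq] at hwX hzX
    have b1 := hne v hv z hz
    have b2 := hne u hu z hz
    by_cases hzv : f z < f u
    · exact hc z (Finset.mem_univ _) u (Finset.mem_univ _) w (Finset.mem_univ _) v
        (Finset.mem_univ _) hzv hwX.1 hwX.2 hwz.symm huv
    · exact hc u (Finset.mem_univ _) w (Finset.mem_univ _) v (Finset.mem_univ _) z
        (Finset.mem_univ _) hwX.1 hwX.2 (by omega) huv hwz

theorem outerplanar_of_NC {V : Type*} [Fintype V] {G : SimpleGraph V} {f : V → ℕ}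
    (hf : NC G Finset.univ f) : Outerplanar G := by
  have hinj : ∀ a b, f a = f b → a = b :=
    fun a b h => hf.1 a (Finset.mem_univ _) b (Finset.mem_univ _) h
  constructor
  · rintro ⟨F, hne, hcon, hdis, hadj⟩
    choose r hr using hne
    have hrne : ∀ i j, i ≠ j → f (r i) ≠ f (r j) := by
      intro i j hij h
      have h' := hinj _ _ h
      exact Set.disjoint_left.mp (hdis hij) (hr i) (h' ▸ hr j)
    set σ := Tuple.sort (f ∘ r) with hσ
    have hm : Monotone ((f ∘ r) ∘ σ) := Tuple.monotone_sort _
    have hlt : ∀ i j : Fin 4, i < j → f (r (σ i)) < f (r (σ j)) := by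
      intro i j hij
      refine lt_of_le_of_ne (hm hij.le) (hrne _ _ ?_)
      exact fun h => hij.ne (σ.injective h)
    have hcc : ∀ i j : Fin 4, i ≠ j → CutConn G (F (σ i) ∪ F (σ j)) := by
      intro i j hij
      refine (cutConn_of_connected (hcon _)).union (cutConn_of_connected (hcon _)) ?_
      exact hadj (by simpa using hij)
    have hdd : ∀ i j : Fin 4, i ≠ j → Disjoint (F (σ i)) (F (σ j)) := by
      intro i j hij
      exact hdis (by simpa using hij)
    refine no_cross hf (hcc 0 2 (by decide)) (hcc 1 3 (by decide)) ?_
      (Or.inl (hr (σ 0))) (Or.inr (hr (σ 2))) (Or.inl (hr (σ 1))) (Or.inr (hr (σ 3)))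
      (hlt _ _ (by decide)) (hlt _ _ (by decide)) (hlt _ _ (by decide))
    simp only [Set.disjoint_union_left, Set.disjoint_union_right]
    exact ⟨⟨hdd _ _ (by decide), hdd _ _ (by decide)⟩, hdd _ _ (by decide), hdd _ _ (by decide)⟩
  · rintro ⟨F, hne, hcon, hdis, hadj⟩
    choose r hr using hne
    have hrne : ∀ i j, i ≠ j → f (r i) ≠ f (r j) := by
      intro i j hij h
      have h' := hinj _ _ h
      exact Set.disjoint_left.mp (hdis hij) (hr i) (h' ▸ hr j)
    have hcc : ∀ (i : Fin 2) (j : Fin 3), CutConn G (F (Sum.inl i) ∪ F (Sum.inr j)) := by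
      intro i j
      refine (cutConn_of_connected (hcon _)).union (cutConn_of_connected (hcon _)) ?_
      exact hadj (by simp)
    have hdd : ∀ (i i' : Fin 2) (j j' : Fin 3), i ≠ i' → j ≠ j' →
        Disjoint (F (Sum.inl i) ∪ F (Sum.inr j)) (F (Sum.inl i') ∪ F (Sum.inr j')) := by
      intro i i' j j' h1 h2
      simp only [Set.disjoint_union_left, Set.disjoint_union_right]
      exact ⟨⟨hdis (by simpa using h1), hdis (by simp)⟩, hdis (by simp), hdis (by simpa using h2)⟩
    have key : ∀ (i i' : Fin 2) (j j' : Fin 3), i ≠ i' → j ≠ j' →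
        ∀ p ∈ F (Sum.inl i) ∪ F (Sum.inr j), ∀ p' ∈ F (Sum.inl i) ∪ F (Sum.inr j),
        ∀ q ∈ F (Sum.inl i') ∪ F (Sum.inr j'), ∀ q' ∈ F (Sum.inl i') ∪ F (Sum.inr j'),
        ¬ (f p < f q ∧ f q < f p' ∧ f p' < f q') := by
      rintro i i' j j' h1 h2 p hp p' hp' q hq q' hq' ⟨a, b, c⟩
      exact no_cross hf (hcc i j) (hcc i' j') (hdd i i' j j' h1 h2) hp hp' hq hq' a b c
    have key2 : ∀ (i i' : Fin 2) (j j' : Fin 3), i ≠ i' → j ≠ j' →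
        f (r (Sum.inl i)) < f (r (Sum.inl i')) → f (r (Sum.inr j)) < f (r (Sum.inr j')) →
        ((f (r (Sum.inl i)) < f (r (Sum.inr j)) ∧ f (r (Sum.inr j)) < f (r (Sum.inl i'))) ↔
         (f (r (Sum.inl i)) < f (r (Sum.inr j')) ∧ f (r (Sum.inr j')) < f (r (Sum.inl i')))) →
        False := by
      intro i i' j j' h1 h2 h3 h4 h5
      have n1 := hrne (Sum.inl i) (Sum.inr j) (by simp)
      have n2 := hrne (Sum.inl i) (Sum.inr j') (by simp)
      have n3 := hrne (Sum.inl i') (Sum.inr j) (by simp)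
      have n4 := hrne (Sum.inl i') (Sum.inr j') (by simp)
      have l := fun i j => Set.mem_union_left (F (Sum.inr j)) (hr (Sum.inl i))
      have m := fun i j => Set.mem_union_right (F (Sum.inl i)) (hr (Sum.inr j))
      have k1 := key i i' j' j h1 h2.symm _ (l i j') _ (m i j') _ (m i' j) _ (l i' j)
      have k2 := key i i' j j' h1 h2 _ (m i j) _ (l i j) _ (m i' j') _ (l i' j')
      have k3 := key i i' j j' h1 h2 _ (l i j) _ (m i j) _ (l i' j') _ (m i' j')
      have k4 := key i' i j j' h1.symm h2 _ (m i' j) _ (l i' j) _ (l i j') _ (m i j')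
      omega
    have key3 : ∀ (i i' : Fin 2), i ≠ i' → f (r (Sum.inl i)) < f (r (Sum.inl i')) → False := by
      intro i i' hi hlt
      have key4 : ∀ j j' : Fin 3, j ≠ j' → 
        ((f (r (Sum.inl i)) < f (r (Sum.inr j)) ∧ f (r (Sum.inr j)) < f (r (Sum.inl i'))) ↔
         (f (r (Sum.inl i)) < f (r (Sum.inr j')) ∧ f (r (Sum.inr j')) < f (r (Sum.inl i')))) →
        False := by
        intro j j' hj h
        have := hrne (Sum.inr j) (Sum.inr j') (by simpa using hj)
        rcases lt_or_gt_of_ne this with h' | h'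
        · exact key2 i i' j j' hi hj hlt h' h
        · exact key2 i i' j' j hi hj.symm hlt h' h.symm
      have a := key4 0 1 (by decide)
      have b := key4 0 2 (by decide)
      have c := key4 1 2 (by decide)
      tauto
    rcases lt_or_gt_of_ne (hrne (Sum.inl 0) (Sum.inl 1) (by simp)) with h | h
    · exact key3 0 1 (by decide) h
    · exact key3 1 0 (by decide) h

theorem NC.rotate {V : Type*} {G : SimpleGraph V} {s : Finset V} {f : V → ℕ}
    (hf : NC G s f) (k : ℕ) : ∃ N, (∀ x ∈ s, f x < N) ∧
      NC G s (fun x => if f x < k then f x + N else f x) := by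
  obtain ⟨N, hN⟩ : ∃ N, ∀ x ∈ s, f x < N :=
    ⟨s.sup f + 1, fun x hx => Nat.lt_succ_of_le (Finset.le_sup (f := f) hx)⟩
  refine ⟨N, hN, ?_, ?_⟩
  · intro a ha b hb h
    have := hN a ha
    have := hN b hb
    refine hf.1 a ha b hb ?_
    simp only at h
    split_ifs at h <;> omega
  · intro a ha b hb c hc d hd h1 h2 h3 hac hbd
    have e1 := hN a ha
    have e2 := hN b hb
    have e3 := hN c hc
    have e4 := hN d hd
    have r1 : ¬ (f a < f b ∧ f b < f c ∧ f c < f d) :=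
      fun ⟨p, q, r⟩ => hf.2 a ha b hb c hc d hd p q r hac hbd
    have r2 : ¬ (f b < f c ∧ f c < f d ∧ f d < f a) :=
      fun ⟨p, q, r⟩ => hf.2 b hb c hc d hd a ha p q r hbd hac.symm
    have r3 : ¬ (f c < f d ∧ f d < f a ∧ f a < f b) :=
      fun ⟨p, q, r⟩ => hf.2 c hc d hd a ha b hb p q r hac.symm hbd.symm
    have r4 : ¬ (f d < f a ∧ f a < f b ∧ f b < f c) :=
      fun ⟨p, q, r⟩ => hf.2 d hd a ha b hb c hc p q r hbd.symm hac
    simp only at h1 h2 h3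
    split_ifs at h1 h2 h3 <;> omega

theorem NC.exists_min {V : Type*} {G : SimpleGraph V} {s : Finset V} {f : V → ℕ}
    (hf : NC G s f) {c : V} (hc : c ∈ s) : ∃ g, NC G s g ∧ ∀ x ∈ s, g c ≤ g x := by
  obtain ⟨N, hN, h⟩ := hf.rotate (f c)
  refine ⟨_, h, ?_⟩
  intro x hx
  have := hN x hx
  have := hN c hc
  split_ifs <;> omega

theorem NC.exists_max {V : Type*} {G : SimpleGraph V} {s : Finset V} {f : V → ℕ}
    (hf : NC G s f) {c : V} (hc : c ∈ s) : ∃ g, NC G s g ∧ ∀ x ∈ s, g x ≤ g c := by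
  obtain ⟨N, hN, h⟩ := hf.rotate (f c + 1)
  refine ⟨_, h, ?_⟩
  intro x hx
  have := hN x hx
  have := hN c hc
  split_ifs <;> omega

theorem NC.glue {V : Type*} [DecidableEq V] {G : SimpleGraph V} {A B : Finset V} {f g : V → ℕ}
    {c : V} (hf : NC G A f) (hg : NC G B g) (hcA : c ∈ A) (hcB : c ∈ B)
    (hAB : ∀ x ∈ A, x ∈ B → x = c)
    (hno : ∀ x ∈ A, ∀ y ∈ B, x ≠ c → y ≠ c → ¬ G.Adj x y) : ∃ h, NC G (A ∪ B) h := by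
  obtain ⟨f, hf, hfm⟩ := hf.exists_max hcA
  obtain ⟨g, hg, hgm⟩ := hg.exists_min hcB
  let h : V → ℕ := fun x => if x ∈ A then f x else f c + 1 + (g x - g c)
  have hA : ∀ x ∈ A, h x = f x := fun x hx => by simp [h, hx]
  have hBA : ∀ x ∈ B, x ≠ c → h x = f c + 1 + (g x - g c) := by
    intro x hx hxc
    have : x ∉ A := fun hxA => hxc (hAB x hxA hx)
    simp [h, this]
  have hAle : ∀ x ∈ A, h x ≤ f c := fun x hx => by rw [hA x hx]; exact hfm x hx
  have hBge : ∀ x ∈ B, f c ≤ h x := by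
    intro x hx
    by_cases hxc : x = c
    · subst hxc; rw [hA x hcA]
    · rw [hBA x hx hxc]; omega
  have hBlt : ∀ x ∈ B, ∀ y ∈ B, h x < h y → g x < g y := by
    intro x hx y hy hxy
    have gx := hgm x hx
    have gy := hgm y hy
    by_cases hyc : y = c
    · subst hyc
      rw [hA y hcA] at hxy
      have := hBge x hx
      omega
    · rw [hBA y hy hyc] at hxy
      by_cases hxc : x = c
      · subst hxc
        have : g x ≠ g y := fun e => hyc (hg.1 x hx y hy e).symm
        omega
      · rw [hBA x hx hxc] at hxy
        omega
  have hedge : ∀ x ∈ A ∪ B, ∀ y ∈ A ∪ B, G.Adj x y → (x ∈ A ∧ y ∈ A) ∨ (x ∈ B ∧ y ∈ B) := by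
    intro x hx y hy hxy
    have n1 := fun p q r s => hno x p y q r s hxy
    have n2 := fun p q r s => hno y p x q r s hxy.symm
    rw [Finset.mem_union] at hx hy
    by_cases e1 : x = c
    · subst e1; tauto
    · by_cases e2 : y = c
      · subst e2; tauto
      · tauto
  refine ⟨h, ?_, ?_⟩
  · intro a ha b hb hab
    rw [Finset.mem_union] at ha hb
    by_cases haA : a ∈ A
    · by_cases hbA : b ∈ A
      · rw [hA a haA, hA b hbA] at hab
        exact hf.1 a haA b hbA hab
      · have hbB : b ∈ B := by tauto
        have hbc : b ≠ c := fun e => hbA (e ▸ hcA)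
        have := hAle a haA
        rw [hab, hBA b hbB hbc] at this
        omega
    · have haB : a ∈ B := by tauto
      have hac : a ≠ c := fun e => haA (e ▸ hcA)
      by_cases hbA : b ∈ A
      · have := hAle b hbA
        rw [← hab, hBA a haB hac] at this
        omega
      · have hbB : b ∈ B := by tauto
        have hbc : b ≠ c := fun e => hbA (e ▸ hcA)
        rw [hBA a haB hac, hBA b hbB hbc] at hab
        have := hgm a haB
        have := hgm b hbB
        exact hg.1 a haB b hbB (by omega)
  · intro a ha b hb x hx d hd h1 h2 h3 hax hbd
    rcases hedge a ha x hx hax with ⟨p, q⟩ | ⟨p, q⟩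
    · rcases hedge b hb d hd hbd with ⟨p', q'⟩ | ⟨p', q'⟩
      · rw [hA a p, hA b p'] at h1
        rw [hA b p', hA x q] at h2
        rw [hA x q, hA d q'] at h3
        exact hf.2 a p b p' x q d q' h1 h2 h3 hax hbd
      · have := hAle x q
        have := hBge b p'
        omega
    · rcases hedge b hb d hd hbd with ⟨p', q'⟩ | ⟨p', q'⟩
      · have := hBge a p
        have := hAle b p'
        omega
      · exact hg.2 a p b p' x q d q' (hBlt _ p _ p' h1) (hBlt _ p' _ q h2) (hBlt _ q _ q' h3)
          hax hbd

theorem minor_K4 {V : Type*} {G : SimpleGraph V} (A B C D : Set V)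
    (hA : (G.induce A).Connected) (hB : (G.induce B).Connected)
    (hC : (G.induce C).Connected) (hD : (G.induce D).Connected)
    (dAB : Disjoint A B) (dAC : Disjoint A C) (dAD : Disjoint A D)
    (dBC : Disjoint B C) (dBD : Disjoint B D) (dCD : Disjoint C D)
    (eAB : ∃ a ∈ A, ∃ b ∈ B, G.Adj a b) (eAC : ∃ a ∈ A, ∃ b ∈ C, G.Adj a b)
    (eAD : ∃ a ∈ A, ∃ b ∈ D, G.Adj a b) (eBC : ∃ a ∈ B, ∃ b ∈ C, G.Adj a b)
    (eBD : ∃ a ∈ B, ∃ b ∈ D, G.Adj a b) (eCD : ∃ a ∈ C, ∃ b ∈ D, G.Adj a b) :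
    HasMinor G (⊤ : SimpleGraph (Fin 4)) := by
  have hcon : ∀ w, (G.induce ((![A, B, C, D] : Fin 4 → Set V) w)).Connected := by
    intro w; fin_cases w <;> assumption
  have sw : ∀ {S T : Set V}, (∃ a ∈ S, ∃ b ∈ T, G.Adj a b) → ∃ a ∈ T, ∃ b ∈ S, G.Adj a b := by
    rintro S T ⟨a, ha, b, hb, h⟩
    exact ⟨b, hb, a, ha, h.symm⟩
  refine ⟨![A, B, C, D], ?_, hcon, ?_, ?_⟩
  · intro w
    obtain ⟨x⟩ := (hcon w).nonempty
    exact ⟨x.1, x.2⟩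
  · intro i j hij
    fin_cases i <;> fin_cases j <;> first | exact absurd rfl hij | assumption | (symm; assumption)
  · intro i j hij
    fin_cases i <;> fin_cases j <;>
      first | exact absurd rfl hij | assumption | (apply sw; assumption)

theorem minor_K23 {V : Type*} {G : SimpleGraph V} (p q : V) (A B C : Set V) (hpq : p ≠ q)
    (hA : (G.induce A).Connected) (hB : (G.induce B).Connected) (hC : (G.induce C).Connected)
    (dAB : Disjoint A B) (dAC : Disjoint A C) (dBC : Disjoint B C)
    (pA : p ∉ A) (pB : p ∉ B) (pC : p ∉ C) (qA : q ∉ A) (qB : q ∉ B) (qC : q ∉ C)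
    (epA : ∃ a ∈ A, G.Adj a p) (epB : ∃ a ∈ B, G.Adj a p) (epC : ∃ a ∈ C, G.Adj a p)
    (eqA : ∃ a ∈ A, G.Adj a q) (eqB : ∃ a ∈ B, G.Adj a q) (eqC : ∃ a ∈ C, G.Adj a q) :
    HasMinor G (completeBipartiteGraph (Fin 2) (Fin 3)) := by
  let F : Fin 2 ⊕ Fin 3 → Set V := Sum.elim ![{p}, {q}] ![A, B, C]
  have hcon : ∀ w, (G.induce (F w)).Connected := by
    have hs : ∀ x : V, (G.induce ({x} : Set V)).Connected := by
      intro x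
      exact G.induce_connected_of_patches x rfl
        (fun {v} hv => ⟨{x}, le_rfl, rfl, hv, by
          have : v = x := hv
          subst this
          exact Reachable.refl _⟩)
    rintro (w | w) <;> fin_cases w
    · exact hs p
    · exact hs q
    · exact hA
    · exact hB
    · exact hC
  have e : ∀ (i : Fin 2) (j : Fin 3), ∃ a ∈ F (Sum.inl i), ∃ b ∈ F (Sum.inr j), G.Adj a b := by
    have aux : ∀ (x : V) (S : Set V), (∃ a ∈ S, G.Adj a x) →
        ∃ a ∈ ({x} : Set V), ∃ b ∈ S, G.Adj a b := by
      rintro x S ⟨a, ha, h⟩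
      exact ⟨x, rfl, a, ha, h.symm⟩
    intro i j
    fin_cases i <;> fin_cases j <;> (apply aux; assumption)
  have d1 : ∀ (i : Fin 2) (j : Fin 3), Disjoint (F (Sum.inl i)) (F (Sum.inr j)) := by
    intro i j
    fin_cases i <;> fin_cases j <;> (refine Set.disjoint_singleton_left.mpr ?_; assumption)
  refine ⟨F, ?_, hcon, ?_, ?_⟩
  · intro w
    obtain ⟨x⟩ := (hcon w).nonempty
    exact ⟨x.1, x.2⟩
  · rintro (i | i) (j | j) hij
    · have d2 : Disjoint ({p} : Set V) {q} := by simpa using hpq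
      fin_cases i <;> fin_cases j <;>
        first | exact absurd rfl hij | exact d2 | exact d2.symm
    · exact d1 i j
    · exact (d1 j i).symm
    · fin_cases i <;> fin_cases j <;>
        first | exact absurd rfl hij | assumption | (symm; assumption)
  · rintro (i | i) (j | j) hij
    · simp at hij
    · exact e i j
    · obtain ⟨a, ha, b, hb, h⟩ := e j i
      exact ⟨b, hb, a, ha, h.symm⟩
    · simp at hij

theorem conn_list {V : Type*} {G : SimpleGraph V} : ∀ (l : List V), l ≠ [] →
    l.IsChain G.Adj → (G.induce {x | x ∈ l}).Connected
  | [], h, _ => absurd rfl h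
  | [a], _, _ => by
      have := (Walk.nil : G.Walk a a).connected_induce_support
      simpa using this
  | a :: b :: l, _, h => by
      rw [List.isChain_cons_cons] at h
      have h1 := conn_list (b :: l) (by simp) h.2
      have h0 := (Walk.nil : G.Walk a a).connected_induce_support
      have h2 := connected_induce_union h0.preconnected h1.preconnected
        (v := a) (w := b) (by simp) (by simp) h.1
      have e : {x | x ∈ a :: b :: l} =
          {v | v ∈ (Walk.nil : G.Walk a a).support} ∪ {x | x ∈ b :: l} := by
        ext x; simp
      rw [e]
      exact h2

theorem chain_last {V : Type*} {G : SimpleGraph V} {l m : List V} {b : V} (hl : l ≠ [])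
    (h : (l ++ b :: m).IsChain G.Adj) : ∃ x ∈ l, G.Adj x b := by
  rw [List.isChain_append] at h
  exact ⟨l.getLast hl, List.getLast_mem hl, h.2.2 _ (List.getLast_mem_getLast? hl) b (by simp)⟩

theorem chain_first {V : Type*} {G : SimpleGraph V} {m : List V} {b : V} (hm : m ≠ [])
    (h : (b :: m).IsChain G.Adj) : ∃ x ∈ m, G.Adj x b := by
  cases m with
  | nil => exact absurd rfl hm
  | cons c m =>
    rw [List.isChain_cons_cons] at h
    exact ⟨c, by simp, h.1.symm⟩

/-- cyclic lists -/
def Cyc {V : Type*} (G : SimpleGraph V) (l : List V) : Prop :=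
  l.Nodup ∧ 2 ≤ l.length ∧ Cycle.Chain G.Adj (l : Cycle V)

theorem Cyc.rot {V : Type*} {G : SimpleGraph V} {l m : List V} (h : Cyc G (l ++ m)) :
    Cyc G (m ++ l) := by
  obtain ⟨h1, h2, h3⟩ := h
  refine ⟨?_, ?_, ?_⟩
  · exact (List.perm_append_comm.nodup_iff).mp h1
  · simp only [List.length_append] at *; omega
  · have : ((l ++ m : List V) : Cycle V) = (m ++ l : List V) := by
      rw [Cycle.coe_eq_coe]
      exact List.isRotated_append
    rwa [this] at h3

theorem K4_of_cyc {V : Type*} {G : SimpleGraph V} {a b c d : V} {l1 l2 l3 l4 : List V}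
    (h : Cyc G (a :: l1 ++ (b :: l2 ++ (c :: l3 ++ (d :: l4)))))
    (hac : G.Adj a c) (hbd : G.Adj b d) : HasMinor G (⊤ : SimpleGraph (Fin 4)) := by
  obtain ⟨h1, -, h3⟩ := h
  have hch : (a :: l1 ++ (b :: l2 ++ (c :: l3 ++ (d :: l4 ++ a :: [])))).IsChain G.Adj := by
    simpa using h3
  have c1 := hch.right_of_append
  have c2 := c1.right_of_append
  have c3 := c2.right_of_append
  have dj : ∀ {l m : List V}, l.Disjoint m → Disjoint {x | x ∈ l} {x | x ∈ m} := by
    intro l m hlm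
    rw [Set.disjoint_left]
    exact fun x hx hy => hlm hx hy
  have n1 := List.disjoint_of_nodup_append h1
  have h1' := h1.of_append_right
  have n2 := List.disjoint_of_nodup_append h1'
  have h1'' := h1'.of_append_right
  have n3 := List.disjoint_of_nodup_append h1''
  rw [List.disjoint_append_right, List.disjoint_append_right] at n1
  rw [List.disjoint_append_right] at n2
  have flip : ∀ {l : List V} {y : V} {m : List V}, (∃ x ∈ l, G.Adj x y) →
      ∃ x ∈ {x | x ∈ l}, ∃ z ∈ {x | x ∈ y :: m}, G.Adj x z := by
    rintro l y m ⟨x, hx, hxy⟩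
    exact ⟨x, hx, y, by simp, hxy⟩
  refine minor_K4 {x | x ∈ a :: l1} {x | x ∈ b :: l2} {x | x ∈ c :: l3} {x | x ∈ d :: l4}
    (conn_list _ (by simp) hch.left_of_append) (conn_list _ (by simp) c1.left_of_append)
    (conn_list _ (by simp) c2.left_of_append) (conn_list _ (by simp) c3.left_of_append)
    (dj n1.1) (dj n1.2.1) (dj n1.2.2) (dj n2.1) (dj n2.2) (dj n3)
    (flip (chain_last (by simp) hch)) ⟨a, by simp, c, by simp, hac⟩ ?_
    (flip (chain_last (by simp) c1)) ⟨b, by simp, d, by simp, hbd⟩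
    (flip (chain_last (by simp) c2))
  obtain ⟨x, hx, hxa⟩ := chain_last (by simp) c3
  exact ⟨a, by simp, x, hx, hxa.symm⟩

theorem split_idx {V : Type*} [DecidableEq V] {l : List V} {a b : V} (ha : a ∈ l) (hb : b ∈ l)
    (h : l.idxOf a < l.idxOf b) : ∃ l0 l1, l = l0 ++ a :: l1 ∧ b ∈ l1 ∧ a ∉ l0 ∧ b ∉ l0 := by
  obtain ⟨l0, l1, rfl, hn⟩ := List.eq_append_cons_of_mem ha
  have hb0 : b ∉ l0 := by
    intro hb0
    rw [List.idxOf_append_of_notMem hn, List.idxOf_append_of_mem hb0] at h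
    have := List.idxOf_lt_length_iff.mpr hb0
    omega
  refine ⟨l0, l1, rfl, ?_, hn, hb0⟩
  rcases List.mem_append.mp hb with hb | hb
  · exact absurd hb hb0
  · rcases List.mem_cons.mp hb with rfl | hb
    · omega
    · exact hb

theorem NC_of_cyc {V : Type*} [DecidableEq V] {G : SimpleGraph V} (hO : Outerplanar G)
    {l : List V} (h : Cyc G l) {s : Finset V} (hs : ∀ x ∈ s, x ∈ l) :
    NC G s (fun x => l.idxOf x) := by
  refine ⟨fun a ha b _ hab => (List.idxOf_inj (hs a ha)).mp hab, ?_⟩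
  intro a ha b hb c hc d hd h1 h2 h3 hac hbd
  simp only at h1 h2 h3
  obtain ⟨l0, l1, rfl, m1, n1, n1'⟩ := split_idx (hs a ha) (hs b hb) h1
  have hnd := h.1
  have hnd1 := hnd.of_append_right
  have key : ∀ x y : V, x ∈ l1 → (l0 ++ a :: l1).idxOf x < (l0 ++ a :: l1).idxOf y → 
      y ∈ l0 ++ a :: l1 → y ∈ l1 ∧ l1.idxOf x < l1.idxOf y := by
    intro x y hx hxy hy
    have hxa : x ≠ a := fun e => (List.nodup_cons.mp hnd1).1 (e ▸ hx)
    have hx0 : x ∉ l0 := fun e =>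
      List.disjoint_of_nodup_append hnd e (List.mem_cons_of_mem _ hx)
    rw [List.idxOf_append_of_notMem hx0, List.idxOf_cons_ne _ hxa.symm] at hxy
    have hy0 : y ∉ l0 := by
      intro hy0
      rw [List.idxOf_append_of_mem hy0] at hxy
      have := List.idxOf_lt_length_iff.mpr hy0
      omega
    rw [List.idxOf_append_of_notMem hy0] at hxy
    have hya : y ≠ a := by
      rintro rfl
      rw [List.idxOf_cons_self] at hxy
      omega
    rw [List.idxOf_cons_ne _ hya.symm] at hxy
    refine ⟨?_, by omega⟩
    simp only [List.mem_append, List.mem_cons] at hy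
    tauto
  obtain ⟨mc, k2⟩ := key b c m1 h2 (hs c hc)
  obtain ⟨md, k3⟩ := key c d mc h3 (hs d hd)
  obtain ⟨p1, p2, rfl, m2, n2, n2'⟩ := split_idx m1 mc k2
  have hd2 : d ∈ p2 ∧ p2.idxOf c < p2.idxOf d := by
    have hnd2 := (List.nodup_cons.mp hnd1).2
    have hnd3 := hnd2.of_append_right
    have hcb : c ≠ b := fun e => (List.nodup_cons.mp hnd3).1 (e ▸ m2)
    rw [List.idxOf_append_of_notMem n2', List.idxOf_cons_ne _ hcb.symm] at k3
    have hd0 : d ∉ p1 := by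
      intro hy0
      rw [List.idxOf_append_of_mem hy0] at k3
      have := List.idxOf_lt_length_iff.mpr hy0
      omega
    rw [List.idxOf_append_of_notMem hd0] at k3
    have hdb : d ≠ b := by
      rintro rfl
      rw [List.idxOf_cons_self] at k3
      omega
    rw [List.idxOf_cons_ne _ hdb.symm] at k3
    refine ⟨?_, by omega⟩
    simp only [List.mem_append, List.mem_cons] at md
    tauto
  obtain ⟨q1, q2, rfl, m3, -, -⟩ := split_idx m2 hd2.1 hd2.2
  obtain ⟨r1, r2, rfl⟩ := List.append_of_mem m3
  have := h.rot
  refine hO.1 (K4_of_cyc (a := a) (b := b) (c := c) (d := d) (l1 := p1) (l2 := q1) (l3 := r1)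
    (l4 := r2 ++ l0) ?_ hac hbd)
  simpa using this

theorem walk_chain {V : Type*} {G : SimpleGraph V} {a b y z : V} (p : G.Walk y z)
    (h1 : G.Adj a y) (h2 : G.Adj z b) : (a :: (p.support ++ [b])).IsChain G.Adj := by
  have := (Walk.cons h1 (p.concat h2)).isChain_adj_support
  simpa [Walk.support_concat] using this

open Classical in
theorem exists_NC {V : Type*} [Fintype V] {G : SimpleGraph V} (hO : Outerplanar G)
    (s : Finset V) : ∃ f, NC G s f := by
  induction s using Finset.strongInduction with
  | H s ih =>
  let f0 : V → ℕ := fun x => (Fintype.equivFin V x).1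
  have hf0 : ∀ a ∈ s, ∀ b ∈ s, f0 a = f0 b → a = b := by
    intro a _ b _ h
    exact (Fintype.equivFin V).injective (Fin.ext h)
  by_cases hedge : ∃ a ∈ s, ∃ b ∈ s, G.Adj a b
  swap
  · refine ⟨f0, hf0, ?_⟩
    intro a ha b hb c hc d hd _ _ _ hac _
    exact hedge ⟨a, ha, c, hc, hac⟩
  obtain ⟨a0, ha0, b0, hb0, hab0⟩ := hedge
  let Q : ℕ → Prop := fun n => ∃ l : List V, Cyc G l ∧ (∀ x ∈ l, x ∈ s) ∧ l.length = n
  have hQ2 : Q 2 := by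
    refine ⟨[a0, b0], ⟨?_, ?_, ?_⟩, ?_, rfl⟩
    · simpa using hab0.ne
    · simp
    · simp [hab0, hab0.symm]
    · simp [ha0, hb0]
  have hQb : ∀ n, Q n → n ≤ Fintype.card V := by
    rintro n ⟨l, hl, -, rfl⟩
    exact hl.1.length_le_card
  obtain ⟨l, hl, hls, hlen⟩ := Nat.findGreatest_spec (P := Q) (hQb 2 hQ2) hQ2
  have hmax : ∀ l' : List V, Cyc G l' → (∀ x ∈ l', x ∈ s) → l'.length ≤ l.length := by
    intro l' h1 h2
    rw [hlen]
    exact Nat.le_findGreatest (hQb _ ⟨l', h1, h2, rfl⟩) ⟨l', h1, h2, rfl⟩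
  clear hlen
  by_cases hall : ∀ x ∈ s, x ∈ l
  · exact ⟨_, NC_of_cyc hO hl hall⟩
  push Not at hall
  obtain ⟨x, hxs, hxl⟩ := hall
  let D : Finset V := s.filter fun y => ∃ p : G.Walk x y, ∀ z ∈ p.support, z ∈ s ∧ z ∉ l
  have hDs : ∀ y ∈ D, y ∈ s := fun y hy => (Finset.mem_filter.mp hy).1
  have hDw : ∀ y ∈ D, ∃ p : G.Walk x y, ∀ z ∈ p.support, z ∈ s ∧ z ∉ l :=
    fun y hy => (Finset.mem_filter.mp hy).2
  have hDl : ∀ y ∈ D, y ∉ l := by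
    intro y hy
    obtain ⟨p, hp⟩ := hDw y hy
    exact (hp y p.end_mem_support).2
  have hxD : x ∈ D := Finset.mem_filter.mpr ⟨hxs, Walk.nil, by simp [hxs, hxl]⟩
  have hDstep : ∀ y ∈ D, ∀ z ∈ s, z ∉ l → G.Adj y z → z ∈ D := by
    intro y hy z hz hzl hyz
    obtain ⟨p, hp⟩ := hDw y hy
    refine Finset.mem_filter.mpr ⟨hz, p.concat hyz, ?_⟩
    intro w hw
    rw [Walk.support_concat] at hw
    rcases List.mem_append.mp hw with hw | hw
    · exact hp w hw
    · rw [List.mem_singleton] at hw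
      subst hw; exact ⟨hz, hzl⟩
  have hDsup : ∀ y (p : G.Walk x y), (∀ z ∈ p.support, z ∈ s ∧ z ∉ l) →
      ∀ z ∈ p.support, z ∈ D := by
    intro y p hp z hz
    refine Finset.mem_filter.mpr ⟨(hp z hz).1, p.takeUntil z hz, ?_⟩
    intro w hw
    exact hp w (p.support_takeUntil_subset_support hz hw)
  have hDconn : (G.induce {y | y ∈ D}).Connected := by
    refine G.induce_connected_of_patches x hxD ?_
    intro v hv
    obtain ⟨p, hp⟩ := hDw v hv
    exact ⟨{z | z ∈ p.support}, fun z hz => hDsup v p hp z hz, p.start_mem_support,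
      p.end_mem_support, p.connected_induce_support _ _⟩
  have hpath : ∀ y ∈ D, ∀ z ∈ D, ∃ p : G.Walk y z, p.support.Nodup ∧ ∀ w ∈ p.support, w ∈ D := by
    intro y hy z hz
    obtain ⟨p, hp⟩ := hDw y hy
    obtain ⟨q, hq⟩ := hDw z hz
    refine ⟨(p.reverse.append q).bypass, (Walk.bypass_isPath _).support_nodup, ?_⟩
    intro w hw
    have := Walk.support_bypass_subset_support _ hw
    rw [Walk.mem_support_append_iff, Walk.support_reverse, List.mem_reverse] at this
    rcases this with h | h
    · exact hDsup _ p hp w h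
    · exact hDsup _ q hq w h
  by_cases hcut : ∃ c ∈ l, ∀ y ∈ D, ∀ z ∈ l, G.Adj y z → z = c
  · obtain ⟨c, hcl, hc⟩ := hcut
    have hcD : c ∉ D := fun h => hDl c h hcl
    obtain ⟨f, hf⟩ := ih (insert c D) (by
      refine (Finset.ssubset_iff_of_subset ?_).mpr ?_
      · intro y hy
        rcases Finset.mem_insert.mp hy with rfl | hy
        · exact hls y hcl
        · exact hDs y hy
      · have : ∃ y ∈ l, y ≠ c := by
          by_contra hcon
          push Not at hcon
          have h1 := hl.1
          have h2 := hl.2.1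
          match l, h1, h2, hcon with
          | u :: v :: l', h1, h2, hcon =>
            have e1 := hcon u (by simp)
            have e2 := hcon v (by simp)
            subst e1
            subst e2
            simp at h1
        obtain ⟨y, hyl, hyc⟩ := this
        refine ⟨y, hls y hyl, ?_⟩
        rw [Finset.mem_insert]
        rintro (h | h)
        · exact hyc h
        · exact hDl y h hyl)
    obtain ⟨g, hg⟩ := ih (s \ D) (by
      refine (Finset.ssubset_iff_of_subset Finset.sdiff_subset).mpr ⟨x, hxs, ?_⟩
      simp [hxD])
    obtain ⟨h, hh⟩ := NC.glue (c := c) hf hg (Finset.mem_insert_self _ _)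
      (Finset.mem_sdiff.mpr ⟨hls c hcl, hcD⟩) (by
        intro y hy hy'
        rcases Finset.mem_insert.mp hy with rfl | hy
        · rfl
        · exact absurd hy (Finset.mem_sdiff.mp hy').2) (by
        intro y hy z hz hyc hzc hadj
        have hyD : y ∈ D := by
          rcases Finset.mem_insert.mp hy with h | h
          · exact absurd h hyc
          · exact h
        rw [Finset.mem_sdiff] at hz
        by_cases hzl : z ∈ l
        · exact hzc (hc y hyD z hzl hadj)
        · exact hz.2 (hDstep y hyD z hz.1 hzl hadj))
    refine ⟨h, ?_⟩
    convert hh using 1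
    ext y
    simp only [Finset.mem_union, Finset.mem_insert, Finset.mem_sdiff]
    constructor
    · intro hy; by_cases hyD : y ∈ D <;> tauto
    · rintro ((rfl | hy) | hy)
      · exact hls y hcl
      · exact hDs y hy
      · exact hy.1
  exfalso
  push Not at hcut
  obtain ⟨c0, hc0⟩ : ∃ c, c ∈ l := by
    have := hl.2.1
    exact List.exists_mem_of_length_pos (by omega)
  obtain ⟨ya, hya, a, hal, hadja, -⟩ := hcut c0 hc0
  obtain ⟨yb, hyb, b, hbl, hadjb, hba⟩ := hcut a hal
  obtain ⟨l0, m, rfl⟩ := List.append_of_mem hal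
  have hrot := hl.rot
  have hmem : ∀ w, w ∈ l0 ++ a :: m ↔ w ∈ a :: m ++ l0 := by
    intro w; simp only [List.mem_append, List.mem_cons]; tauto
  have hlen : (l0 ++ a :: m).length = (a :: (m ++ l0)).length := by simp; omega
  rw [hlen] at hmax
  simp only [hmem] at hDl hls
  rw [hmem] at hbl
  clear hlen hmem hal hxl hl
  rw [List.cons_append] at hrot hDl hls hbl
  have hbl' : b ∈ m ++ l0 := by
    rcases List.mem_cons.mp hbl with h | h
    · exact absurd h hba
    · exact h
  obtain ⟨l1, l2, hl12⟩ := List.append_of_mem hbl'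
  rw [hl12] at hrot hDl hls hmax
  obtain ⟨hnd, -, hch⟩ := hrot
  rw [Cycle.chain_coe_cons] at hch
  have hch' : (a :: (l1 ++ b :: (l2 ++ [a]))).IsChain G.Adj := by simpa using hch
  by_cases hl1 : l1 = []
  · subst hl1
    obtain ⟨p, hpn, hpD⟩ := hpath ya hya yb hyb
    have hlt := hmax (b :: (l2 ++ a :: p.support)) ⟨by
      have hnd2 : (b :: (l2 ++ [a])).Nodup := by
        simp only [List.nil_append, List.nodup_cons, List.mem_cons, List.nodup_append,
          List.mem_append] at hnd ⊢
        grind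
      have : b :: (l2 ++ a :: p.support) = b :: (l2 ++ [a]) ++ p.support := by simp
      rw [this]
      refine hnd2.append hpn ?_
      intro w hw hw'
      exact hDl w (hpD w hw') (by simp at hw ⊢; tauto), by simp; omega, by
      rw [Cycle.chain_coe_cons]
      have h2 := walk_chain p hadja.symm hadjb
      have h1 : (b :: l2 ++ [a]).IsChain G.Adj := by
        simp only [List.nil_append] at hch'
        exact hch'.tail
      have := List.isChain_split.mpr ⟨h1, h2⟩
      simpa using this⟩ (by
      intro w hw
      simp only [List.mem_cons, List.mem_append] at hw
      have := hls w
      simp only [List.nil_append, List.mem_cons] at this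
      have h3 := fun h => hDs w (hpD w h)
      tauto)
    have hpos : p.support.length ≠ 0 := by simp
    simp only [List.nil_append, List.length_cons, List.length_append] at hlt
    omega
  by_cases hl2 : l2 = []
  · subst hl2
    obtain ⟨p, hpn, hpD⟩ := hpath yb hyb ya hya
    have hlt := hmax (a :: (l1 ++ b :: p.support)) ⟨by
      have : a :: (l1 ++ b :: p.support) = a :: (l1 ++ [b]) ++ p.support := by simp
      rw [this]
      refine hnd.append hpn ?_
      intro w hw hw'
      exact hDl w (hpD w hw') hw, by simp; omega, by
      rw [Cycle.chain_coe_cons]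
      have h2 := walk_chain p hadjb.symm hadja
      have h1 : (a :: l1 ++ [b]).IsChain G.Adj := by
        have : (a :: l1 ++ [b] ++ [a]).IsChain G.Adj := by simpa using hch'
        exact this.left_of_append
      have := List.isChain_split.mpr ⟨h1, h2⟩
      simpa using this⟩ (by
      intro w hw
      simp only [List.mem_cons, List.mem_append] at hw
      have := hls w
      simp only [List.mem_cons, List.mem_append] at this
      have h3 := fun h => hDs w (hpD w h)
      tauto)
    have hpos : p.support.length ≠ 0 := by simp
    simp only [List.length_cons, List.length_append, List.length_nil] at hlt
    omega
  have d1 : (l1 ++ b :: (l2 ++ [a])).IsChain G.Adj := hch'.tail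
  have d2 := d1.right_of_append
  have d3 : (l2 ++ [a]).IsChain G.Adj := d2.tail
  have hnd' := List.nodup_cons.mp hnd
  have hdis := List.disjoint_of_nodup_append hnd'.2
  have hnd'' := List.nodup_cons.mp hnd'.2.of_append_right
  have ha1 := hnd'.1
  simp only [List.mem_append, List.mem_cons, not_or] at ha1
  refine hO.2 (minor_K23 a b {w | w ∈ l1} {w | w ∈ l2} {w | w ∈ D} (Ne.symm hba)
    (conn_list _ hl1 d1.left_of_append) (conn_list _ hl2 d3.left_of_append) hDconn
    ?_ ?_ ?_ ha1.1 ha1.2.2 (fun h => hDl a h (by simp)) (fun h => hdis h (by simp)) hnd''.1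
    (fun h => hDl b h (by simp)) ?_ (chain_last hl2 d3) ⟨ya, hya, hadja⟩
    (chain_last hl1 d1) ?_ ⟨yb, hyb, hadjb⟩)
  · exact Set.disjoint_left.mpr fun w h h' => hdis h (List.mem_cons_of_mem _ h')
  · exact Set.disjoint_left.mpr fun w h h' => hDl w h' (by
      have : w ∈ l1 := h
      simp [this])
  · exact Set.disjoint_left.mpr fun w h h' => hDl w h' (by
      have : w ∈ l2 := h
      simp [this])
  · have : (a :: l1 ++ b :: (l2 ++ [a])).IsChain G.Adj := hch'
    exact chain_first hl1 this.left_of_append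
  · have : (b :: l2 ++ [a]).IsChain G.Adj := d2
    exact chain_first hl2 this.left_of_append

theorem max_cross {V : Type*} [Fintype V] {G : SimpleGraph V} (h : MaximalOuterplanar G)
    {f : V → ℕ} (hf : NC G Finset.univ f) {u v : V} (huv : f u < f v) (hn : ¬ G.Adj u v) :
    ∃ x y, G.Adj x y ∧ f u < f x ∧ f x < f v ∧ (f y < f u ∨ f v < f y) := by
  by_contra hcon
  push Not at hcon
  refine h.2 u v (fun e => by subst e; omega) hn (outerplanar_of_NC (f := f) ⟨hf.1, ?_⟩)
  intro a ha b hb c hc d hd h1 h2 h3 hac hbd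
  rw [SimpleGraph.sup_adj, SimpleGraph.fromEdgeSet_adj, Set.mem_singleton_iff, Sym2.eq_iff]
    at hac hbd
  rcases hac with hac | ⟨⟨rfl, rfl⟩ | ⟨rfl, rfl⟩, -⟩
  · rcases hbd with hbd | ⟨⟨rfl, rfl⟩ | ⟨rfl, rfl⟩, -⟩
    · exact hf.2 a ha b hb c hc d hd h1 h2 h3 hac hbd
    · have := hcon c a hac.symm h2 h3
      omega
    · omega
  · rcases hbd with hbd | ⟨⟨rfl, rfl⟩ | ⟨rfl, rfl⟩, -⟩
    · have := hcon b d hbd h1 h2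
      omega
    · omega
    · omega
  · omega

/-- Over an edge with nonempty interior there is a triangle. -/
theorem exists_apex {V : Type*} [Fintype V] {G : SimpleGraph V} (h : MaximalOuterplanar G)
    {f : V → ℕ} (hf : NC G Finset.univ f) {a b : V} (hab : f a < f b) (hadj : G.Adj a b)
    (hin : ∃ x, f a < f x ∧ f x < f b) :
    ∃ c, f a < f c ∧ f c < f b ∧ G.Adj a c ∧ G.Adj c b := by
  classical
  have hcr : ∀ p q r s, f p < f q → f q < f r → f r < f s → G.Adj p r → G.Adj q s → False :=
    fun p q r s => hf.2 p (Finset.mem_univ _) q (Finset.mem_univ _) r (Finset.mem_univ _) s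
      (Finset.mem_univ _)
  have hinj : ∀ p q, f p = f q → p = q :=
    fun p q => hf.1 p (Finset.mem_univ _) q (Finset.mem_univ _)
  have hne : (Finset.univ.filter fun x => f a < f x ∧ f x < f b).Nonempty := by
    obtain ⟨x, hx⟩ := hin
    exact ⟨x, by simpa using hx⟩
  obtain ⟨m, hm, hmin⟩ := Finset.exists_min_image _ f hne
  simp only [Finset.mem_filter, Finset.mem_univ, true_and] at hm hmin
  have ham : G.Adj a m := by
    by_contra hn
    obtain ⟨x, y, -, h1, h2, -⟩ := max_cross h hf hm.1 hn
    have := hmin x ⟨h1, by omega⟩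
    omega
  obtain ⟨c, hc, hmax⟩ := Finset.exists_max_image
    (Finset.univ.filter fun x => f a < f x ∧ f x < f b ∧ G.Adj a x) f
    ⟨m, by simpa using ⟨hm.1, hm.2, ham⟩⟩
  simp only [Finset.mem_filter, Finset.mem_univ, true_and] at hc hmax
  refine ⟨c, hc.1, hc.2.1, hc.2.2, ?_⟩
  by_contra hn
  obtain ⟨d, e, hde, h1, h2, h3⟩ := max_cross h hf hc.2.1 hn
  rcases h3 with h3 | h3
  · rcases lt_trichotomy (f e) (f a) with h4 | h4 | h4
    · exact hcr e a d b h4 (by omega) h2 hde.symm hadj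
    · have := hinj _ _ h4
      subst this
      have := hmax d ⟨by omega, h2, hde.symm⟩
      omega
    · exact hcr a e c d h4 h3 h1 hc.2.2 hde.symm
  · exact hcr a d b e (by omega) h2 h3 hadj hde

theorem fill {V : Type*} [Fintype V] [DecidableEq V] {G : SimpleGraph V}
    (h : MaximalOuterplanar G) {f : V → ℕ} (hf : NC G Finset.univ f) :
    ∀ (n : ℕ) (a b : V) (s : Finset V), f b - f a ≤ n → f a < f b → G.Adj a b →
      IsTwoTreeOn G s → a ∈ s → b ∈ s → (∀ x ∈ s, f x ≤ f a ∨ f b ≤ f x) →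
      IsTwoTreeOn G (s ∪ Finset.univ.filter fun x => f a < f x ∧ f x < f b) := by
  have hcr : ∀ p q r s, f p < f q → f q < f r → f r < f s → G.Adj p r → G.Adj q s → False :=
    fun p q r s => hf.2 p (Finset.mem_univ _) q (Finset.mem_univ _) r (Finset.mem_univ _) s
      (Finset.mem_univ _)
  have hinj : ∀ p q, f p = f q → p = q :=
    fun p q => hf.1 p (Finset.mem_univ _) q (Finset.mem_univ _)
  intro n
  induction n with
  | zero => intro a b s h1 h2; omega
  | succ n ih =>
    intro a b s hn hab hadj hs ha hb hout
    by_cases hin : ∃ x, f a < f x ∧ f x < f b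
    · obtain ⟨c, hac, hcb, adjac, adjcb⟩ := exists_apex h hf hab hadj hin
      have hcs : c ∉ s := fun hc => by
        have := hout c hc; omega
      have s1 : IsTwoTreeOn G (insert c s) := by
        refine IsTwoTreeOn.grow hs ha hb hadj hcs ?_
        intro u hu
        constructor
        · intro hcu
          by_contra hne
          push Not at hne
          have n1 : f u ≠ f a := fun e => hne.1 (hinj _ _ e)
          have n2 : f u ≠ f b := fun e => hne.2 (hinj _ _ e)
          rcases hout u hu with h1 | h1
          · exact hcr u a c b (by omega) hac hcb hcu.symm hadj
          · exact hcr a c b u hac hcb (by omega) hadj hcu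
        · rintro (rfl | rfl)
          · exact adjac.symm
          · exact adjcb
      have s2 := ih a c _ (by omega) hac adjac s1 (by simp [ha]) (by simp) (by
        intro x hx
        rcases Finset.mem_insert.mp hx with rfl | hx
        · omega
        · have := hout x hx; omega)
      have s3 := ih c b _ (by omega) hcb adjcb s2 (by simp) (by simp [hb]) (by
        intro x hx
        simp only [Finset.mem_union, Finset.mem_insert, Finset.mem_filter, Finset.mem_univ,
          true_and] at hx
        rcases hx with (rfl | hx) | hx
        · omega
        · have := hout x hx; omega
        · omega)
      convert s3 using 1
      ext x
      simp only [Finset.mem_union, Finset.mem_insert, Finset.mem_filter, Finset.mem_univ,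
          true_and]
      constructor
      · rintro (hx | hx)
        · tauto
        · rcases lt_trichotomy (f x) (f c) with h1 | h1 | h1
          · exact Or.inl (Or.inr ⟨hx.1, h1⟩)
          · exact Or.inl (Or.inl (Or.inl (hinj _ _ h1)))
          · exact Or.inr ⟨h1, hx.2⟩
      · rintro (((rfl | hx) | hx) | hx)
        · exact Or.inr ⟨hac, hcb⟩
        · exact Or.inl hx
        · exact Or.inr ⟨hx.1, by omega⟩
        · exact Or.inr ⟨by omega, hx.2⟩
    · convert hs using 1
      ext x
      simp only [Finset.mem_union, Finset.mem_filter, Finset.mem_univ, true_and]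
      push Not at hin
      have := hin x
      constructor
      · rintro (hx | hx)
        · exact hx
        · omega
      · exact Or.inl

theorem isTwoTree {V : Type*} [Fintype V] [DecidableEq V] {G : SimpleGraph V}
    (h : MaximalOuterplanar G) (hn : 3 ≤ Fintype.card V) : IsTwoTreeOn G Finset.univ := by
  obtain ⟨f, hf⟩ := exists_NC h.1 Finset.univ
  have hinj : ∀ p q, f p = f q → p = q :=
    fun p q => hf.1 p (Finset.mem_univ _) q (Finset.mem_univ _)
  have hne : (Finset.univ : Finset V).Nonempty := by
    rw [← Finset.card_pos, Finset.card_univ]; omega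
  obtain ⟨a, -, ha⟩ := Finset.exists_min_image _ f hne
  obtain ⟨b, -, hb⟩ := Finset.exists_max_image _ f hne
  simp only [Finset.mem_univ, true_implies] at ha hb
  obtain ⟨x, hx⟩ : ∃ x, x ∉ ({a, b} : Finset V) := by
    by_contra hcon
    push Not at hcon
    have h1 : (Finset.univ : Finset V) ⊆ {a, b} := fun x _ => hcon x
    have := Finset.card_le_card h1
    have := Finset.card_le_two (a := a) (b := b)
    rw [Finset.card_univ] at *
    omega
  simp only [Finset.mem_insert, Finset.mem_singleton, not_or] at hx
  have hxa : f a < f x := lt_of_le_of_ne (ha x) fun e => hx.1 (hinj _ _ e.symm)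
  have hxb : f x < f b := lt_of_le_of_ne (hb x) fun e => hx.2 (hinj _ _ e)
  have hab : G.Adj a b := by
    by_contra hn
    obtain ⟨u, v, -, -, -, h1⟩ := max_cross h hf (by omega) hn
    have := ha v
    have := hb v
    omega
  obtain ⟨c, hac, hcb, adjac, adjcb⟩ := exists_apex h hf (by omega) hab ⟨x, hxa, hxb⟩
  have s0 : IsTwoTreeOn G {a, b, c} :=
    IsTwoTreeOn.triangle hab.ne adjac.ne adjcb.ne.symm hab adjac adjcb.symm
  have s1 := fill h hf _ a c _ le_rfl hac adjac s0 (by simp) (by simp) (by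
    intro y hy
    simp only [Finset.mem_insert, Finset.mem_singleton] at hy
    rcases hy with rfl | rfl | rfl <;> omega)
  have s2 := fill h hf _ c b _ le_rfl hcb adjcb s1 (by simp) (by simp) (by
    intro y hy
    simp only [Finset.mem_union, Finset.mem_filter, Finset.mem_univ, true_and,
      Finset.mem_insert, Finset.mem_singleton] at hy
    rcases hy with (rfl | rfl | rfl) | hy <;> omega)
  convert s2 using 1
  ext y
  simp only [Finset.mem_union, Finset.mem_filter, Finset.mem_univ, true_and,
      Finset.mem_insert, Finset.mem_singleton, true_iff]
  have h1 := ha y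
  have h2 := hb y
  have e1 := hinj y a
  have e2 := hinj y b
  have e3 := hinj y c
  by_cases c1 : f y = f a
  · tauto
  by_cases c2 : f y = f b
  · tauto
  by_cases c3 : f y = f c
  · tauto
  omega

/-- `u` has three neighbours in `s`. -/
def Three {V : Type*} (G : SimpleGraph V) (s : Finset V) (u : V) : Prop :=
  ∃ x ∈ s, ∃ y ∈ s, ∃ z ∈ s, x ≠ y ∧ x ≠ z ∧ y ≠ z ∧ G.Adj u x ∧ G.Adj u y ∧ G.Adj u z

theorem exists_fourth : ∀ i j k : Fin 4, ∃ m : Fin 4, m ≠ i ∧ m ≠ j ∧ m ≠ k := by decide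

theorem all_four : ∀ i j k m : Fin 4, i ≠ j → i ≠ k → j ≠ k → m ≠ i → m ≠ j → m ≠ k →
    ∀ n, n = i ∨ n = j ∨ n = k ∨ n = m := by decide

theorem coloring {V : Type*} [DecidableEq V] {G : SimpleGraph V} {s : Finset V}
    (h : IsTwoTreeOn G s) : ∃ col : V → Fin 4,
      (∀ u ∈ s, ∀ v ∈ s, G.Adj u v → col u ≠ col v) ∧
      (∀ u ∈ s, ∃ v ∈ s, G.Adj u v) ∧
      (∀ u ∈ s, ∀ v ∈ s, G.Adj u v → ∃ w ∈ s, G.Adj u w ∧ G.Adj v w) ∧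
      (∀ u ∈ s, Three G s u → ∀ k, ∃ w ∈ s, (w = u ∨ G.Adj u w) ∧ col w = k) ∧
      ((∃ a b c, s = {a, b, c}) ∨ ∀ u ∈ s, ∀ v ∈ s, G.Adj u v → Three G s u ∨ Three G s v) := by
  induction h with
  | @triangle a b c hab hac hbc ab ac bc =>
    refine ⟨fun x => if x = a then 0 else if x = b then 1 else 2, ?_, ?_, ?_, ?_,
      Or.inl ⟨a, b, c, rfl⟩⟩
    · intro u hu v hv huv
      simp only [Finset.mem_insert, Finset.mem_singleton] at hu hv
      have := huv.ne
      grind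
    · intro u hu
      simp only [Finset.mem_insert, Finset.mem_singleton] at hu
      rcases hu with rfl | rfl | rfl
      · exact ⟨b, by simp, ab⟩
      · exact ⟨c, by simp, bc⟩
      · exact ⟨a, by simp, ac.symm⟩
    · intro u hu v hv huv
      simp only [Finset.mem_insert, Finset.mem_singleton] at hu hv
      rcases hu with rfl | rfl | rfl <;> rcases hv with rfl | rfl | rfl
      · exact absurd huv G.irrefl
      · exact ⟨c, by simp, ac, bc⟩
      · exact ⟨b, by simp, ab, bc.symm⟩
      · exact ⟨c, by simp, bc, ac⟩
      · exact absurd huv G.irrefl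
      · exact ⟨a, by simp, ab.symm, ac.symm⟩
      · exact ⟨b, by simp, bc.symm, ab⟩
      · exact ⟨a, by simp, ac.symm, ab.symm⟩
      · exact absurd huv G.irrefl
    · rintro u hu ⟨x, hx, y, hy, z, hz, h1, h2, h3, h4, h5, h6⟩
      simp only [Finset.mem_insert, Finset.mem_singleton] at hu hx hy hz
      have := h4.ne
      have := h5.ne
      have := h6.ne
      exfalso
      grind
  | @grow s x y v hs hx hy hxy hv hnb ih =>
    obtain ⟨col, c1, c2, c3, c4, c5⟩ := ih
    obtain ⟨z, hz, hxz, hyz⟩ := c3 x hx y hy hxy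
    obtain ⟨m, m1, m2, m3⟩ := exists_fourth (col x) (col y) (col z)
    have hvx : G.Adj v x := (hnb x hx).mpr (Or.inl rfl)
    have hvy : G.Adj v y := (hnb y hy).mpr (Or.inr rfl)
    have hzv : ¬ G.Adj v z := by
      rw [hnb z hz]
      rintro (rfl | rfl)
      · exact hxz.ne rfl
      · exact hyz.ne rfl
    have hne : ∀ u ∈ s, u ≠ v := fun u hu e => hv (e ▸ hu)
    have hcol : ∀ u ∈ s, Function.update col v m u = col u :=
      fun u hu => Function.update_of_ne (hne u hu) _ _
    have hcv : Function.update col v m v = m := Function.update_self _ _ _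
    have mono : ∀ u, Three G s u → Three G (insert v s) u := by
      rintro u ⟨x, hx, y, hy, z, hz, h⟩
      exact ⟨x, Finset.mem_insert_of_mem hx, y, Finset.mem_insert_of_mem hy, z,
        Finset.mem_insert_of_mem hz, h⟩
    have tx : Three G (insert v s) x := ⟨y, by simp [hy], z, by simp [hz], v, by simp,
      hyz.ne, hne y hy, hne z hz, hxy, hxz, hvx.symm⟩
    have ty : Three G (insert v s) y := ⟨x, by simp [hx], z, by simp [hz], v, by simp,
      hxz.ne, hne x hx, hne z hz, hxy.symm, hyz, hvy.symm⟩
    have full := all_four (col x) (col y) (col z) m (c1 x hx y hy hxy) (c1 x hx z hz hxz)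
      (c1 y hy z hz hyz) m1 m2 m3
    refine ⟨Function.update col v m, ?_, ?_, ?_, ?_, Or.inr ?_⟩
    · have aux : ∀ w ∈ s, G.Adj v w → m ≠ col w := by
        intro w hw hvw
        rcases (hnb w hw).mp hvw with rfl | rfl <;> assumption
      intro u hu w hw huw
      rcases Finset.mem_insert.mp hu with rfl | hu' <;>
        rcases Finset.mem_insert.mp hw with rfl | hw'
      · exact absurd huw G.irrefl
      · rw [hcv, hcol w hw']; exact aux w hw' huw
      · rw [hcv, hcol u hu']; exact (aux u hu' huw.symm).symm
      · rw [hcol u hu', hcol w hw']; exact c1 u hu' w hw' huw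
    · intro u hu
      rcases Finset.mem_insert.mp hu with rfl | hu
      · exact ⟨x, by simp [hx], hvx⟩
      · obtain ⟨w, hw, h⟩ := c2 u hu
        exact ⟨w, by simp [hw], h⟩
    · have aux : ∀ w ∈ s, G.Adj v w → ∃ t ∈ insert v s, G.Adj v t ∧ G.Adj w t := by
        intro w hw hvw
        rcases (hnb w hw).mp hvw with rfl | rfl
        · exact ⟨y, by simp [hy], hvy, hxy⟩
        · exact ⟨x, by simp [hx], hvx, hxy.symm⟩
      intro u hu w hw huw
      rcases Finset.mem_insert.mp hu with rfl | hu' <;>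
        rcases Finset.mem_insert.mp hw with rfl | hw'
      · exact absurd huw G.irrefl
      · exact aux w hw' huw
      · obtain ⟨t, ht, h1, h2⟩ := aux u hu' huw.symm
        exact ⟨t, ht, h2, h1⟩
      · obtain ⟨t, ht, h⟩ := c3 u hu' w hw' huw
        exact ⟨t, by simp [ht], h⟩
    · intro u hu h3 k
      rcases Finset.mem_insert.mp hu with rfl | hu
      · exfalso
        obtain ⟨p, hp, q, hq, r, hr, n1, n2, n3, a1, a2, a3⟩ := h3
        have aux : ∀ w ∈ insert u s, G.Adj u w → w = x ∨ w = y := by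
          intro w hw huw
          rcases Finset.mem_insert.mp hw with rfl | hw
          · exact absurd huw G.irrefl
          · exact (hnb w hw).mp huw
        have := aux p hp a1
        have := aux q hq a2
        have := aux r hr a3
        grind
      · by_cases hux : u = x
        · subst hux
          rcases full k with e | e | e | e
          · exact ⟨u, by simp [hx], Or.inl rfl, by rw [hcol u hx, e]⟩
          · exact ⟨y, by simp [hy], Or.inr hxy, by rw [hcol y hy, e]⟩
          · exact ⟨z, by simp [hz], Or.inr hxz, by rw [hcol z hz, e]⟩
          · exact ⟨v, by simp, Or.inr hvx.symm, by rw [hcv, e]⟩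
        by_cases huy : u = y
        · subst huy
          rcases full k with e | e | e | e
          · exact ⟨x, by simp [hx], Or.inr hxy.symm, by rw [hcol x hx, e]⟩
          · exact ⟨u, by simp [hy], Or.inl rfl, by rw [hcol u hy, e]⟩
          · exact ⟨z, by simp [hz], Or.inr hyz, by rw [hcol z hz, e]⟩
          · exact ⟨v, by simp, Or.inr hvy.symm, by rw [hcv, e]⟩
        have huv : ¬ G.Adj u v := fun e => by
          rcases (hnb u hu).mp e.symm with h | h
          · exact hux h
          · exact huy h
        have h3' : Three G s u := by
          obtain ⟨p, hp, q, hq, r, hr, n1, n2, n3, a1, a2, a3⟩ := h3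
          have aux : ∀ w ∈ insert v s, G.Adj u w → w ∈ s := by
            intro w hw huw
            rcases Finset.mem_insert.mp hw with rfl | hw
            · exact absurd huw huv
            · exact hw
          exact ⟨p, aux p hp a1, q, aux q hq a2, r, aux r hr a3, n1, n2, n3, a1, a2, a3⟩
        obtain ⟨w, hw, h1, h2⟩ := c4 u hu h3' k
        exact ⟨w, by simp [hw], h1, by rw [hcol w hw, h2]⟩
    · have aux : ∀ w ∈ s, G.Adj v w → Three G (insert v s) w := by
        intro w hw hvw
        rcases (hnb w hw).mp hvw with rfl | rfl <;> assumption
      intro u hu w hw huw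
      rcases Finset.mem_insert.mp hu with rfl | hu' <;>
        rcases Finset.mem_insert.mp hw with rfl | hw'
      · exact absurd huw G.irrefl
      · exact Or.inr (aux w hw' huw)
      · exact Or.inl (aux u hu' huw.symm)
      · rcases c5 with ⟨a, b, c, rfl⟩ | c5
        · have hcov : ∀ t ∈ ({a, b, c} : Finset V), t = x ∨ t = y ∨ t = z := by
            intro t ht
            have n1 := hxy.ne
            have n2 := hxz.ne
            have n3 := hyz.ne
            simp only [Finset.mem_insert, Finset.mem_singleton] at ht hx hy hz
            clear * - ht hx hy hz n1 n2 n3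
            grind
          rcases hcov u hu' with rfl | rfl | rfl
          · exact Or.inl tx
          · exact Or.inl ty
          · rcases hcov w hw' with rfl | rfl | rfl
            · exact Or.inr tx
            · exact Or.inr ty
            · exact absurd huw G.irrefl
        · exact (c5 u hu' w hw' huw).imp (mono u) (mono w)


theorem three_iff {V : Type*} [Fintype V] [DecidableEq V] (G : SimpleGraph V)
    [DecidableRel G.Adj] (u : V) : Three G Finset.univ u ↔ 2 < G.degree u := by
  rw [← SimpleGraph.card_neighborFinset_eq_degree, Finset.two_lt_card]
  unfold Three
  simp only [mem_neighborFinset, Finset.mem_univ, true_and]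
  constructor
  · rintro ⟨x, y, z, h1, h2, h3, h4, h5, h6⟩
    exact ⟨x, h4, y, h5, z, h6, h1, h2, h3⟩
  · rintro ⟨x, h4, y, h5, z, h6, h1, h2, h3⟩
    exact ⟨x, y, z, h1, h2, h3, h4, h5, h6⟩

theorem structure_facts {V : Type*} [Fintype V] [DecidableEq V]
    (G : SimpleGraph V) [DecidableRel G.Adj] (h : MaximalOuterplanar G)
    (hn : 4 ≤ Fintype.card V) : ∃ col : V → Fin 4,
      (∀ u, ∃ v w, G.Adj u v ∧ G.Adj u w ∧ G.Adj v w) ∧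
      (∀ u v, G.Adj u v → col u ≠ col v) ∧
      (∀ u, G.degree u ≠ 2 → ∀ k, ∃ w, (w = u ∨ G.Adj u w) ∧ col w = k) ∧
      (∀ u v, G.Adj u v → G.degree u ≠ 2 ∨ G.degree v ≠ 2) := by
  obtain ⟨col, c1, c2, c3, c4, c5⟩ := coloring (isTwoTree h (by omega))
  simp only [Finset.mem_univ, true_and, true_implies] at c1 c2 c3 c4 c5
  have hT : ∀ u, ∃ v w, G.Adj u v ∧ G.Adj u w ∧ G.Adj v w := by
    intro u
    obtain ⟨v, hv⟩ := c2 u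
    obtain ⟨w, h1, h2⟩ := c3 u v hv
    exact ⟨v, w, hv, h1, h2⟩
  refine ⟨col, hT, c1, ?_, ?_⟩
  · intro u hu
    apply c4 u
    rw [three_iff]
    obtain ⟨v, w, h1, h2, h3⟩ := hT u
    have : 1 < G.degree u := by
      rw [← SimpleGraph.card_neighborFinset_eq_degree, Finset.one_lt_card]
      exact ⟨v, by simpa using h1, w, by simpa using h2, h3.ne⟩
    omega
  · rcases c5 with ⟨a, b, c, e⟩ | c5
    · have := Finset.card_le_three (a := a) (b := b) (c := c)
      rw [← e, Finset.card_univ] at this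
      omega
    · intro u v huv
      have := c5 u v huv
      rw [three_iff, three_iff] at this
      omega

theorem two_le_of {V : Type*} [Fintype V] [DecidableEq V]
    (G : SimpleGraph V) [DecidableRel G.Adj] {S : Finset V} {u a b : V} (hab : a ≠ b)
    (ha : a ∈ S) (hb : b ∈ S) (ha' : a = u ∨ G.Adj u a) (hb' : b = u ∨ G.Adj u b) :
    2 ≤ (S ∩ insert u (G.neighborFinset u)).card := by
  refine Finset.one_lt_card.mpr ⟨a, ?_, b, ?_, hab⟩ <;>
    simp only [Finset.mem_inter, Finset.mem_insert, mem_neighborFinset] <;> tauto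

theorem bound_sub {V : Type*} [Fintype V] [DecidableEq V]
    (G : SimpleGraph V) [DecidableRel G.Adj] (h : MaximalOuterplanar G)
    (hn : 4 ≤ Fintype.card V) : ∃ S : Finset V, IsDoubleDomSet G S ∧
      S.card + (Finset.univ.filter fun v => G.degree v = 2).card = Fintype.card V := by
  obtain ⟨col, hT, -, -, h2⟩ := structure_facts G h hn
  refine ⟨Finset.univ.filter fun v => ¬ G.degree v = 2, ?_, ?_⟩
  · intro u
    obtain ⟨v, w, huv, huw, hvw⟩ := hT u
    have a1 := h2 u v huv
    have a2 := h2 u w huw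
    have a3 := h2 v w hvw
    by_cases hu : G.degree u = 2
    · exact two_le_of G hvw.ne (by simp; tauto) (by simp; tauto) (Or.inr huv) (Or.inr huw)
    · rcases a3 with a3 | a3
      · exact two_le_of G huv.ne (by simpa using hu) (by simpa using a3) (Or.inl rfl) (Or.inr huv)
      · exact two_le_of G huw.ne (by simpa using hu) (by simpa using a3) (Or.inl rfl) (Or.inr huw)
  · rw [add_comm, Finset.card_filter_add_card_filter_not, Finset.card_univ]

/-- vertices that are not doubly dominated by the colours satisfying `p`. -/
def Bad {V : Type*} [Fintype V] [DecidableEq V]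
    (G : SimpleGraph V) [DecidableRel G.Adj] (S : Finset V) : Finset V :=
  Finset.univ.filter fun u => ¬ 2 ≤ (S ∩ insert u (G.neighborFinset u)).card

theorem repair {V : Type*} [Fintype V] [DecidableEq V]
    (G : SimpleGraph V) [DecidableRel G.Adj] (S : Finset V)
    (hS : ∀ u, 1 ≤ (S ∩ insert u (G.neighborFinset u)).card)
    (hT : ∀ u, ∃ v w, G.Adj u v ∧ G.Adj u w ∧ G.Adj v w) :
    ∃ S' : Finset V, IsDoubleDomSet G S' ∧ S'.card ≤ S.card + (Bad G S).card := by
  have hex : ∀ u, ∃ e, 2 ≤ (S ∩ insert u (G.neighborFinset u)).card ∨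
      (e ∉ S ∧ (e = u ∨ G.Adj u e)) := by
    intro u
    by_cases hu : 2 ≤ (S ∩ insert u (G.neighborFinset u)).card
    · exact ⟨u, Or.inl hu⟩
    · obtain ⟨v, w, huv, huw, hvw⟩ := hT u
      by_cases h1 : u ∈ S
      · by_cases h2 : v ∈ S
        · exact absurd (two_le_of G huv.ne h1 h2 (Or.inl rfl) (Or.inr huv)) hu
        · exact ⟨v, Or.inr ⟨h2, Or.inr huv⟩⟩
      · exact ⟨u, Or.inr ⟨h1, Or.inl rfl⟩⟩
  choose e he using hex
  refine ⟨S ∪ (Bad G S).image e, ?_, ?_⟩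
  · intro u
    by_cases hu : 2 ≤ (S ∩ insert u (G.neighborFinset u)).card
    · refine le_trans hu (Finset.card_le_card ?_)
      exact Finset.inter_subset_inter_right Finset.subset_union_left
    · obtain ⟨h1, h2⟩ := (he u).resolve_left hu
      obtain ⟨x, hx⟩ := Finset.card_pos.mp (hS u)
      simp only [Finset.mem_inter, Finset.mem_insert, mem_neighborFinset] at hx
      refine two_le_of G (a := x) (b := e u) (fun h => h1 (h ▸ hx.1))
        (Finset.mem_union_left _ hx.1) (Finset.mem_union_right _ (Finset.mem_image_of_mem _ ?_))
        hx.2 h2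
      simpa [Bad] using hu
  · refine le_trans (Finset.card_union_le _ _) ?_
    have := Finset.card_image_le (s := Bad G S) (f := e)
    omega

theorem bound_half {V : Type*} [Fintype V] [DecidableEq V]
    (G : SimpleGraph V) [DecidableRel G.Adj] (h : MaximalOuterplanar G)
    (hn : 4 ≤ Fintype.card V) : ∃ S : Finset V, IsDoubleDomSet G S ∧
      2 * S.card ≤ Fintype.card V + (Finset.univ.filter fun v => G.degree v = 2).card := by
  obtain ⟨col, hT, hcol, h4, -⟩ := structure_facts G h hn
  let S : Finset V := Finset.univ.filter fun v => col v < 2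
  let T : Finset V := Finset.univ.filter fun v => ¬ col v < 2
  have hST : S.card + T.card = Fintype.card V := by
    rw [Finset.card_filter_add_card_filter_not, Finset.card_univ]
  have mS : ∀ v, v ∈ S ↔ col v < 2 := by simp [S]
  have mT : ∀ v, v ∈ T ↔ ¬ col v < 2 := by simp [T]
  have hdegS : ∀ u, G.degree u ≠ 2 → 2 ≤ (S ∩ insert u (G.neighborFinset u)).card := by
    intro u hu
    obtain ⟨a, ha, ha'⟩ := h4 u hu 0
    obtain ⟨b, hb, hb'⟩ := h4 u hu 1
    exact two_le_of G (fun e => by subst e; rw [ha'] at hb'; exact absurd hb' (by decide))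
      ((mS a).mpr (by rw [ha']; decide)) ((mS b).mpr (by rw [hb']; decide)) ha hb
  have hdegT : ∀ u, G.degree u ≠ 2 → 2 ≤ (T ∩ insert u (G.neighborFinset u)).card := by
    intro u hu
    obtain ⟨a, ha, ha'⟩ := h4 u hu 2
    obtain ⟨b, hb, hb'⟩ := h4 u hu 3
    exact two_le_of G (fun e => by subst e; rw [ha'] at hb'; exact absurd hb' (by decide))
      ((mT a).mpr (by rw [ha']; decide)) ((mT b).mpr (by rw [hb']; decide)) ha hb
  have tri : ∀ i j k : Fin 4, i ≠ j → i ≠ k → j ≠ k →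
      (i < 2 ∨ j < 2 ∨ k < 2) ∧ (¬ i < 2 ∨ ¬ j < 2 ∨ ¬ k < 2) := by decide
  have pos : ∀ (R : Finset V) (u x : V), x ∈ R → (x = u ∨ G.Adj u x) →
      1 ≤ (R ∩ insert u (G.neighborFinset u)).card := by
    intro R u x hx hx'
    refine Finset.card_pos.mpr ⟨x, ?_⟩
    simp only [Finset.mem_inter, Finset.mem_insert, mem_neighborFinset]
    exact ⟨hx, hx'⟩
  have h1S : ∀ u, 1 ≤ (S ∩ insert u (G.neighborFinset u)).card := by
    intro u
    obtain ⟨v, w, huv, huw, hvw⟩ := hT u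
    rcases (tri _ _ _ (hcol u v huv) (hcol u w huw) (hcol v w hvw)).1 with h | h | h
    · exact pos S u u ((mS _).mpr h) (Or.inl rfl)
    · exact pos S u v ((mS _).mpr h) (Or.inr huv)
    · exact pos S u w ((mS _).mpr h) (Or.inr huw)
  have h1T : ∀ u, 1 ≤ (T ∩ insert u (G.neighborFinset u)).card := by
    intro u
    obtain ⟨v, w, huv, huw, hvw⟩ := hT u
    rcases (tri _ _ _ (hcol u v huv) (hcol u w huw) (hcol v w hvw)).2 with h | h | h
    · exact pos T u u ((mT _).mpr h) (Or.inl rfl)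
    · exact pos T u v ((mT _).mpr h) (Or.inr huv)
    · exact pos T u w ((mT _).mpr h) (Or.inr huw)
  have hbad : (Bad G S).card + (Bad G T).card ≤
      (Finset.univ.filter fun v => G.degree v = 2).card := by
    rw [← Finset.card_union_of_disjoint]
    · refine Finset.card_le_card ?_
      intro u hu
      simp only [Finset.mem_union, Bad, Finset.mem_filter, Finset.mem_univ, true_and] at hu ⊢
      by_contra hd
      exact hu.elim (fun k => k (hdegS u hd)) (fun k => k (hdegT u hd))
    · rw [Finset.disjoint_left]
      intro u hu hu'
      simp only [Bad, Finset.mem_filter, Finset.mem_univ, true_and] at hu hu'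
      obtain ⟨v, w, huv, huw, hvw⟩ := hT u
      have k1 := fun p q => hu (two_le_of G huv.ne p q (Or.inl rfl) (Or.inr huv))
      have k2 := fun p q => hu (two_le_of G huw.ne p q (Or.inl rfl) (Or.inr huw))
      have k3 := fun p q => hu (two_le_of G hvw.ne p q (Or.inr huv) (Or.inr huw))
      have l1 := fun p q => hu' (two_le_of G huv.ne p q (Or.inl rfl) (Or.inr huv))
      have l2 := fun p q => hu' (two_le_of G huw.ne p q (Or.inl rfl) (Or.inr huw))
      have l3 := fun p q => hu' (two_le_of G hvw.ne p q (Or.inr huv) (Or.inr huw))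
      rw [mS, mS] at k1 k2 k3
      rw [mT, mT] at l1 l2 l3
      tauto
  obtain ⟨S', hS', cS⟩ := repair G S h1S hT
  obtain ⟨T', hT', cT⟩ := repair G T h1T hT
  by_cases hle : S'.card ≤ T'.card
  · exact ⟨S', hS', by omega⟩
  · exact ⟨T', hT', by omega⟩

end DDom

/-- For a maximal outerplanar graph on `n ≥ 4` vertices with `t`
vertices of degree 2, `γ×2(G) ≤ min{⌊(n+t)/2⌋, n - t}`. -/
theorem doubleDomNum_le_min {V : Type*} [Fintype V] [DecidableEq V]
    (G : SimpleGraph V) [DecidableRel G.Adj] (h : MaximalOuterplanar G)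
    (hn : 4 ≤ Fintype.card V) :
    doubleDomNum G ≤
      min ((Fintype.card V + (Finset.univ.filter fun v => G.degree v = 2).card) / 2)
        (Fintype.card V - (Finset.univ.filter fun v => G.degree v = 2).card) := by
  refine le_min ?_ ?_
  · obtain ⟨S, hS, hc⟩ := DDom.bound_half G h hn
    refine le_trans (Nat.sInf_le ⟨S, hS, rfl⟩) ?_
    omega
  · obtain ⟨S, hS, hc⟩ := DDom.bound_sub G h hn
    refine le_trans (Nat.sInf_le ⟨S, hS, rfl⟩) ?_
    omega
end

section
/- If G is a striped maximal outerplanar graph on n ≥ 3 vertices (a maximal outerplanar graph with no internal triangles), then γ×2(G) ≤ ⌊n/2⌋ + 1. -/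
open SimpleGraph

/-! ### Connected sets via cuts -/

/-- Connectivity of a vertex set, phrased by cuts. -/
def CC {V : Type*} (G : SimpleGraph V) (s : Set V) : Prop :=
  ∀ T : Set V, (∃ x ∈ s, x ∈ T) → (∃ y ∈ s, y ∉ T) → ∃ x ∈ s, ∃ y ∈ s, x ∈ T ∧ y ∉ T ∧ G.Adj x y

theorem cc_iff {V : Type*} (G : SimpleGraph V) (s : Set V) :
    (G.induce s).Connected ↔ s.Nonempty ∧ CC G s := by
  constructor
  · intro h
    refine ⟨by obtain ⟨x⟩ := h.nonempty; exact ⟨x, x.2⟩, ?_⟩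
    rintro T ⟨x, hx, hxT⟩ ⟨y, hy, hyT⟩
    obtain ⟨p⟩ := h.preconnected ⟨x, hx⟩ ⟨y, hy⟩
    obtain ⟨d, -, h1, h2⟩ := p.exists_boundary_dart {u | (u : V) ∈ T} hxT hyT
    exact ⟨d.fst, d.fst.2, d.snd, d.snd.2, h1, h2, d.adj⟩
  · rintro ⟨⟨x0, hx0⟩, h⟩
    rw [connected_iff]
    refine ⟨?_, ⟨⟨x0, hx0⟩⟩⟩
    rintro ⟨x, hx⟩ ⟨y, hy⟩
    by_contra hc
    obtain ⟨a, ha, b, hb, ⟨ha1, hr⟩, hbT, hab⟩ := h {u | ∃ hu : u ∈ s, (G.induce s).Reachable ⟨x, hx⟩ ⟨u, hu⟩}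
      ⟨x, hx, hx, Reachable.refl _⟩ ⟨y, hy, fun ⟨_, h⟩ => hc h⟩
    refine hbT ⟨hb, hr.trans (Adj.reachable ?_)⟩
    simpa using hab

theorem cc_singleton {V : Type*} (G : SimpleGraph V) (x : V) : CC G {x} := by
  rintro T ⟨a, ha, haT⟩ ⟨b, hb, hbT⟩
  simp at ha hb
  subst ha; subst hb; exact absurd haT hbT

theorem cc_union {V : Type*} {G : SimpleGraph V} {s t : Set V} (hs : CC G s) (ht : CC G t)
    {a b : V} (ha : a ∈ s) (hb : b ∈ t) (hab : G.Adj a b) : CC G (s ∪ t) := by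
  intro T hx hy
  have h1 := hs T
  have h2 := ht T
  have hba := hab.symm
  by_cases hsx : ∃ x ∈ s, x ∈ T
  · by_cases hsy : ∃ y ∈ s, y ∉ T
    · obtain ⟨x, hx, y, hy, h⟩ := h1 hsx hsy
      exact ⟨x, Or.inl hx, y, Or.inl hy, h⟩
    · push Not at hsy
      by_cases hbT : b ∈ T
      · obtain ⟨y, hy1, hy2⟩ := hy
        have hyt : y ∈ t := hy1.resolve_left (fun h => hy2 (hsy _ h))
        obtain ⟨x, hx, y, hy, h⟩ := h2 ⟨b, hb, hbT⟩ ⟨y, hyt, hy2⟩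
        exact ⟨x, Or.inr hx, y, Or.inr hy, h⟩
      · exact ⟨a, Or.inl ha, b, Or.inr hb, hsy a ha, hbT, hab⟩
  · push Not at hsx
    by_cases hbT : b ∈ T
    · exact ⟨b, Or.inr hb, a, Or.inl ha, hbT, hsx a ha, hba⟩
    · obtain ⟨x, hx1, hx2⟩ := hx
      have hxt : x ∈ t := hx1.resolve_left (fun h => hsx _ h hx2)
      obtain ⟨x, hx, y, hy, h⟩ := h2 ⟨x, hxt, hx2⟩ ⟨b, hb, hbT⟩
      exact ⟨x, Or.inr hx, y, Or.inr hy, h⟩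

theorem cc_mono {V : Type*} {G G' : SimpleGraph V} (hG : G ≤ G') {s : Set V} (hs : CC G s) :
    CC G' s := by
  intro T hx hy
  obtain ⟨x, hx, y, hy, h1, h2, h3⟩ := hs T hx hy
  exact ⟨x, hx, y, hy, h1, h2, hG h3⟩

theorem hasMinor_iff {V W : Type*} (G : SimpleGraph V) (H : SimpleGraph W) :
    HasMinor G H ↔ ∃ f : W → Set V,
    (∀ w, (f w).Nonempty) ∧ (∀ w, CC G (f w)) ∧
    (∀ w₁ w₂ x, x ∈ f w₁ → x ∈ f w₂ → w₁ = w₂) ∧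
    ∀ ⦃w₁ w₂⦄, H.Adj w₁ w₂ → ∃ a ∈ f w₁, ∃ b ∈ f w₂, G.Adj a b := by
  unfold HasMinor
  refine exists_congr fun f => ?_
  constructor
  · rintro ⟨h1, h2, h3, h4⟩
    refine ⟨h1, fun w => ((cc_iff _ _).1 (h2 w)).2, ?_, h4⟩
    intro a b x hx hy
    by_contra hne
    exact Set.disjoint_left.1 (h3 hne) hx hy
  · rintro ⟨h1, h2, h3, h4⟩
    refine ⟨h1, fun w => (cc_iff _ _).2 ⟨h1 w, h2 w⟩, ?_, h4⟩
    intro a b hne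
    exact Set.disjoint_left.2 fun x hx hy => hne (h3 _ _ _ hx hy)

theorem outerplanar_mono {V : Type*} {G G' : SimpleGraph V} (hG : G ≤ G') (h : Outerplanar G') :
    Outerplanar G := by
  have key : ∀ {W : Type} (H : SimpleGraph W), HasMinor G H → HasMinor G' H := by
    intro W H
    rw [hasMinor_iff, hasMinor_iff]
    rintro ⟨f, h1, h2, h3, h4⟩
    refine ⟨f, h1, fun w => cc_mono hG (h2 w), h3, fun a b hab => ?_⟩
    obtain ⟨x, hx, y, hy, hxy⟩ := h4 hab
    exact ⟨x, hx, y, hy, hG hxy⟩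
  exact ⟨fun hh => h.1 (key _ hh), fun hh => h.2 (key _ hh)⟩

/-- explicit K4 minor -/
theorem k4_minor {V : Type*} {G : SimpleGraph V} {A B C D : Set V}
    (hA : A.Nonempty) (hB : B.Nonempty) (hC : C.Nonempty) (hD : D.Nonempty)
    (cA : CC G A) (cB : CC G B) (cC : CC G C) (cD : CC G D)
    (dAB : ∀ x ∈ A, x ∉ B) (dAC : ∀ x ∈ A, x ∉ C) (dAD : ∀ x ∈ A, x ∉ D)
    (dBC : ∀ x ∈ B, x ∉ C) (dBD : ∀ x ∈ B, x ∉ D) (dCD : ∀ x ∈ C, x ∉ D)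
    (eAB : ∃ a ∈ A, ∃ b ∈ B, G.Adj a b) (eAC : ∃ a ∈ A, ∃ b ∈ C, G.Adj a b)
    (eAD : ∃ a ∈ A, ∃ b ∈ D, G.Adj a b) (eBC : ∃ a ∈ B, ∃ b ∈ C, G.Adj a b)
    (eBD : ∃ a ∈ B, ∃ b ∈ D, G.Adj a b) (eCD : ∃ a ∈ C, ∃ b ∈ D, G.Adj a b) :
    HasMinor G (⊤ : SimpleGraph (Fin 4)) := by
  have sw : ∀ {X Y : Set V}, (∃ a ∈ X, ∃ b ∈ Y, G.Adj a b) → ∃ a ∈ Y, ∃ b ∈ X, G.Adj a b := by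
    rintro X Y ⟨a, ha, b, hb, h⟩
    exact ⟨b, hb, a, ha, h.symm⟩
  rw [hasMinor_iff]
  refine ⟨![A, B, C, D], ?_, ?_, ?_, ?_⟩
  · intro w; fin_cases w <;> assumption
  · intro w; fin_cases w <;> assumption
  · intro w₁ w₂ x h1 h2
    fin_cases w₁ <;> fin_cases w₂ <;> simp at h1 h2 ⊢ <;> grind
  · intro w₁ w₂ h
    fin_cases w₁ <;> fin_cases w₂ <;> simp at h <;> first | assumption | (apply sw; assumption)

/-- explicit K23 minor -/
theorem k23_minor {V : Type*} {G : SimpleGraph V} {P Q A B C : Set V}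
    (hP : P.Nonempty) (hQ : Q.Nonempty) (hA : A.Nonempty) (hB : B.Nonempty) (hC : C.Nonempty)
    (cP : CC G P) (cQ : CC G Q) (cA : CC G A) (cB : CC G B) (cC : CC G C)
    (dPQ : ∀ x ∈ P, x ∉ Q) (dPA : ∀ x ∈ P, x ∉ A) (dPB : ∀ x ∈ P, x ∉ B) (dPC : ∀ x ∈ P, x ∉ C)
    (dQA : ∀ x ∈ Q, x ∉ A) (dQB : ∀ x ∈ Q, x ∉ B) (dQC : ∀ x ∈ Q, x ∉ C)
    (dAB : ∀ x ∈ A, x ∉ B) (dAC : ∀ x ∈ A, x ∉ C) (dBC : ∀ x ∈ B, x ∉ C)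
    (ePA : ∃ a ∈ P, ∃ b ∈ A, G.Adj a b) (ePB : ∃ a ∈ P, ∃ b ∈ B, G.Adj a b)
    (ePC : ∃ a ∈ P, ∃ b ∈ C, G.Adj a b)
    (eQA : ∃ a ∈ Q, ∃ b ∈ A, G.Adj a b) (eQB : ∃ a ∈ Q, ∃ b ∈ B, G.Adj a b)
    (eQC : ∃ a ∈ Q, ∃ b ∈ C, G.Adj a b) :
    HasMinor G (completeBipartiteGraph (Fin 2) (Fin 3)) := by
  have sw : ∀ {X Y : Set V}, (∃ a ∈ X, ∃ b ∈ Y, G.Adj a b) → ∃ a ∈ Y, ∃ b ∈ X, G.Adj a b := by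
    rintro X Y ⟨a, ha, b, hb, h⟩
    exact ⟨b, hb, a, ha, h.symm⟩
  rw [hasMinor_iff]
  refine ⟨Sum.elim ![P, Q] ![A, B, C], ?_, ?_, ?_, ?_⟩
  · rintro (w | w) <;> fin_cases w <;> assumption
  · rintro (w | w) <;> fin_cases w <;> assumption
  · rintro (w₁ | w₁) (w₂ | w₂) x h1 h2 <;>
    fin_cases w₁ <;> fin_cases w₂ <;> simp at h1 h2 ⊢ <;> grind
  · rintro (w₁ | w₁) (w₂ | w₂) h <;> 
    fin_cases w₁ <;> fin_cases w₂ <;> simp at h <;> first | assumption | (apply sw; assumption)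

/-! ### Noncrossing orders -/

/-- `f` is a noncrossing (one page) placement of `G`. -/
def NC {V : Type*} (G : SimpleGraph V) (f : V → ℚ) : Prop :=
  Function.Injective f ∧
  ∀ a b c d, G.Adj a c → G.Adj b d → f a < f b → f b < f c → f c < f d → False

theorem nc_sets {V : Type*} {G : SimpleGraph V} {f : V → ℚ} (h : NC G f) {A B : Set V}
    (cA : CC G A) (cB : CC G B) (dAB : ∀ x ∈ A, x ∉ B) {a b a' b' : V}
    (ha : a ∈ A) (ha' : a' ∈ A) (hb : b ∈ B) (hb' : b' ∈ B)
    (h1 : f a < f b) (h2 : f b < f a') (h3 : f a' < f b' ∨ f b' < f a) : False := by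
  obtain ⟨hf, hc⟩ := h
  obtain ⟨p, hp, q, hq, ⟨hpT1, hpT2⟩, hqT, hpq⟩ := cB {u | f a < f u ∧ f u < f a'} ⟨b, hb, h1, h2⟩
    ⟨b', hb', fun h => by simp at h; rcases h3 with h3 | h3 <;> linarith [h.1, h.2]⟩
  have hqa : f q ≠ f a := fun h => dAB a ha (hf h ▸ hq)
  have hqa' : f q ≠ f a' := fun h => dAB a' ha' (hf h ▸ hq)
  have hq3 : f q < f a ∨ f a' < f q := by
    by_contra hcon
    push Not at hcon
    exact hqT ⟨lt_of_le_of_ne hcon.1 (Ne.symm hqa), lt_of_le_of_ne hcon.2 hqa'⟩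
  rcases hq3 with hq3 | hq3
  · obtain ⟨r, hr, s, hs, ⟨hr1, hr2⟩, hsT, hrs⟩ := cA {u | f q < f u ∧ f u < f p}
      ⟨a, ha, hq3, hpT1⟩ ⟨a', ha', fun h => by linarith [h.2]⟩
    have hsq : f s ≠ f q := fun h => dAB s hs (hf h ▸ hq)
    have hsp : f s ≠ f p := fun h => dAB s hs (hf h ▸ hp)
    rcases lt_or_gt_of_ne hsq with h5 | h5
    · exact hc s q r p hrs.symm hpq.symm h5 hr1 hr2
    · rcases lt_or_gt_of_ne hsp with h6 | h6
      · exact hsT ⟨h5, h6⟩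
      · exact hc q r p s hpq.symm hrs hr1 hr2 h6
  · obtain ⟨r, hr, s, hs, ⟨hr1, hr2⟩, hsT, hrs⟩ := cA {u | f p < f u ∧ f u < f q}
      ⟨a', ha', hpT2, hq3⟩ ⟨a, ha, fun h => by linarith [h.1]⟩
    have hsq : f s ≠ f q := fun h => dAB s hs (hf h ▸ hq)
    have hsp : f s ≠ f p := fun h => dAB s hs (hf h ▸ hp)
    rcases lt_or_gt_of_ne hsp with h5 | h5
    · exact hc s p r q hrs.symm hpq h5 hr1 hr2
    · rcases lt_or_gt_of_ne hsq with h6 | h6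
      · exact hsT ⟨h5, h6⟩
      · exact hc p r q s hpq hrs hr1 hr2 h6

/-- Two disjoint connected pairs do not cross, in a symmetric form. -/
theorem nc_pairs {V : Type*} {G : SimpleGraph V} {f : V → ℚ} (h : NC G f) {A B C D : Set V}
    (cA : CC G A) (cB : CC G B) (cC : CC G C) (cD : CC G D)
    (eAC : ∃ a ∈ A, ∃ b ∈ C, G.Adj a b) (eBD : ∃ a ∈ B, ∃ b ∈ D, G.Adj a b)
    (dAB : ∀ x ∈ A, x ∉ B) (dAD : ∀ x ∈ A, x ∉ D) (dCB : ∀ x ∈ C, x ∉ B) (dCD : ∀ x ∈ C, x ∉ D)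
    {a b c d : V} (ha : a ∈ A) (hb : b ∈ B) (hc : c ∈ C) (hd : d ∈ D) :
    ¬ ((f a < f b ∧ f b < f c ∨ f c < f b ∧ f b < f a) ∧
      ¬ (f a < f d ∧ f d < f c ∨ f c < f d ∧ f d < f a)) := by
  obtain ⟨p, hp, q, hq, hpq⟩ := eAC
  obtain ⟨r, hr, s, hs, hrs⟩ := eBD
  have c1 := cc_union cA cC hp hq hpq
  have c2 := cc_union cB cD hr hs hrs
  have dis : ∀ x ∈ A ∪ C, x ∉ B ∪ D := by
    rintro x (hx | hx) (hy | hy)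
    exacts [dAB x hx hy, dAD x hx hy, dCB x hx hy, dCD x hx hy]
  have hda : f d ≠ f a := fun h' => dAD a ha (h.1 h' ▸ hd)
  have hdc : f d ≠ f c := fun h' => dCD c hc (h.1 h' ▸ hd)
  rintro ⟨h1 | h1, h2⟩
  · refine nc_sets h c1 c2 dis (Or.inl ha) (Or.inr hc) (Or.inl hb) (Or.inr hd) h1.1 h1.2 ?_
    grind
  · refine nc_sets h c1 c2 dis (Or.inr hc) (Or.inl ha) (Or.inl hb) (Or.inr hd) h1.1 h1.2 ?_
    grind

theorem three_props (P : Fin 3 → Prop) : ∃ i j : Fin 3, i ≠ j ∧ (P i ↔ P j) := by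
  by_cases h0 : P 0 <;> by_cases h1 : P 1 <;> by_cases h2 : P 2
  all_goals first
    | exact ⟨0, 1, by decide, iff_of_true h0 h1⟩
    | exact ⟨0, 1, by decide, iff_of_false h0 h1⟩
    | exact ⟨0, 2, by decide, iff_of_true h0 h2⟩
    | exact ⟨0, 2, by decide, iff_of_false h0 h2⟩
    | exact ⟨1, 2, by decide, iff_of_true h1 h2⟩
    | exact ⟨1, 2, by decide, iff_of_false h1 h2⟩

set_option maxHeartbeats 1000000 in
theorem nc_outerplanar {V : Type*} {G : SimpleGraph V} {f : V → ℚ} (h : NC G f) :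
    Outerplanar G := by
  constructor
  · rw [hasMinor_iff]
    rintro ⟨F, h1, h2, h3, h4⟩
    choose r hr using h1
    have key : ∀ i j k l : Fin 4, i ≠ k → j ≠ l → i ≠ j → i ≠ l → k ≠ j → k ≠ l → 
       ¬ ((f (r i) < f (r j) ∧ f (r j) < f (r k) ∨ f (r k) < f (r j) ∧ f (r j) < f (r i)) ∧
      ¬ (f (r i) < f (r l) ∧ f (r l) < f (r k) ∨ f (r k) < f (r l) ∧ f (r l) < f (r i))) := by
      intro i j k l a1 a2 a3 a4 a5 a6
      exact nc_pairs h (h2 i) (h2 j) (h2 k) (h2 l) (h4 (by simpa using a1)) (h4 (by simpa using a2))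
        (fun x hx hy => a3 (h3 _ _ x hx hy)) (fun x hx hy => a4 (h3 _ _ x hx hy))
        (fun x hx hy => a5 (h3 _ _ x hx hy)) (fun x hx hy => a6 (h3 _ _ x hx hy))
        (hr i) (hr j) (hr k) (hr l)
    have hne : ∀ i j : Fin 4, i ≠ j → f (r i) ≠ f (r j) := fun i j hij hh =>
      hij (h3 _ _ (r i) (hr i) (h.1 hh ▸ hr j))
    have k1 := key 0 1 2 3 (by decide) (by decide) (by decide) (by decide) (by decide) (by decide)
    have k2 := key 0 1 3 2 (by decide) (by decide) (by decide) (by decide) (by decide) (by decide)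
    have k3 := key 0 2 1 3 (by decide) (by decide) (by decide) (by decide) (by decide) (by decide)
    have k4 := key 0 2 3 1 (by decide) (by decide) (by decide) (by decide) (by decide) (by decide)
    have k5 := key 0 3 1 2 (by decide) (by decide) (by decide) (by decide) (by decide) (by decide)
    have k6 := key 0 3 2 1 (by decide) (by decide) (by decide) (by decide) (by decide) (by decide)
    have n1 := hne 0 1 (by decide)
    have n2 := hne 0 2 (by decide)
    have n3 := hne 0 3 (by decide)
    have n4 := hne 1 2 (by decide)
    have n5 := hne 1 3 (by decide)
    have n6 := hne 2 3 (by decide)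
    clear key hne
    generalize f (r 0) = x0 at *
    generalize f (r 1) = x1 at *
    generalize f (r 2) = x2 at *
    generalize f (r 3) = x3 at *
    clear h h2 h3 h4 hr
    rcases lt_or_gt_of_ne n1 with n1 | n1 <;> rcases lt_or_gt_of_ne n2 with n2 | n2 <;>
    rcases lt_or_gt_of_ne n3 with n3 | n3 <;> rcases lt_or_gt_of_ne n4 with n4 | n4 <;>
    rcases lt_or_gt_of_ne n5 with n5 | n5 <;> rcases lt_or_gt_of_ne n6 with n6 | n6 <;>
    first
    | (exfalso; linarith)
    | (simp [n1, n2, n3, n4, n5, n6, not_lt_of_gt] at k1 k2 k3 k4 k5 k6)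
  · rw [hasMinor_iff]
    rintro ⟨F, h1, h2, h3, h4⟩
    choose r hr using h1
    -- p,x versus q,y
    have key : ∀ i j : Fin 3, i ≠ j → 
       ¬ ((f (r (.inl 0)) < f (r (.inl 1)) ∧ f (r (.inl 1)) < f (r (.inr i)) ∨ 
           f (r (.inr i)) < f (r (.inl 1)) ∧ f (r (.inl 1)) < f (r (.inl 0))) ∧
      ¬ (f (r (.inl 0)) < f (r (.inr j)) ∧ f (r (.inr j)) < f (r (.inr i)) ∨ 
         f (r (.inr i)) < f (r (.inr j)) ∧ f (r (.inr j)) < f (r (.inl 0)))) ∧ 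
       ¬ ((f (r (.inl 0)) < f (r (.inr j)) ∧ f (r (.inr j)) < f (r (.inr i)) ∨ 
           f (r (.inr i)) < f (r (.inr j)) ∧ f (r (.inr j)) < f (r (.inl 0))) ∧
      ¬ (f (r (.inl 0)) < f (r (.inl 1)) ∧ f (r (.inl 1)) < f (r (.inr i)) ∨ 
         f (r (.inr i)) < f (r (.inl 1)) ∧ f (r (.inl 1)) < f (r (.inl 0)))) := by
      intro i j a1
      constructor
      · refine nc_pairs h (h2 _) (h2 _) (h2 _) (h2 _) (h4 (by simp)) (h4 (by simp))
          (fun x hx hy => ?_) (fun x hx hy => ?_)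
          (fun x hx hy => ?_) (fun x hx hy => ?_)
          (hr (.inl 0)) (hr (.inl 1)) (hr (.inr i)) (hr (.inr j)) <;> 
          (have := h3 _ _ x hx hy; simp at this; try exact a1 this)
      · refine nc_pairs h (h2 _) (h2 _) (h2 _) (h2 _) (h4 (by simp)) (h4 (by simp))
          (fun x hx hy => ?_) (fun x hx hy => ?_)
          (fun x hx hy => ?_) (fun x hx hy => ?_)
          (hr (.inl 0)) (hr (.inr j)) (hr (.inr i)) (hr (.inl 1)) <;> 
          (have := h3 _ _ x hx hy; simp at this; try exact a1 this)
    have hne : ∀ i j, i ≠ j → f (r i) ≠ f (r j) := fun i j hij hh =>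
      hij (h3 _ _ (r i) (hr i) (h.1 hh ▸ hr j))
    have np : f (r (.inl 0)) ≠ f (r (.inl 1)) := hne _ _ (by simp)
    have npx : ∀ i, f (r (.inl 0)) ≠ f (r (.inr i)) := fun i => hne _ _ (by simp)
    have nqx : ∀ i, f (r (.inl 1)) ≠ f (r (.inr i)) := fun i => hne _ _ (by simp)
    -- two on the same side
    have side := three_props (fun i : Fin 3 =>
       (f (r (.inl 0)) < f (r (.inr i)) ∧ f (r (.inr i)) < f (r (.inl 1)) ∨
           f (r (.inl 1)) < f (r (.inr i)) ∧ f (r (.inr i)) < f (r (.inl 0))))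
    obtain ⟨i, j, hij, hs⟩ := side
    have k1 := key i j hij
    have k2 := key j i hij.symm
    have n1 := npx i
    have n2 := npx j
    have n3 := nqx i
    have n4 := nqx j
    have n5 : f (r (.inr i)) ≠ f (r (.inr j)) := hne _ _ (by simpa using hij)
    clear key npx nqx hne
    generalize f (r (.inl 0)) = x0 at *
    generalize f (r (.inl 1)) = x1 at *
    generalize f (r (.inr i)) = x2 at *
    generalize f (r (.inr j)) = x3 at *
    clear h h2 h3 h4 hr
    rcases lt_or_gt_of_ne n1 with n1 | n1 <;> rcases lt_or_gt_of_ne n2 with n2 | n2 <;>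
    rcases lt_or_gt_of_ne n3 with n3 | n3 <;> rcases lt_or_gt_of_ne n4 with n4 | n4 <;>
    rcases lt_or_gt_of_ne n5 with n5 | n5 <;> rcases lt_or_gt_of_ne np with n6 | n6 <;>
    first
    | (exfalso; linarith)
    | (simp [n1, n2, n3, n4, n5, n6, not_lt_of_gt] at k1 k2 hs)

/-! ### A vertex of small degree -/

/-- `p 0, ..., p k` is a path of `G`. -/
def IsPth {V : Type*} (G : SimpleGraph V) (p : ℕ → V) (k : ℕ) : Prop :=
  (∀ i j, i ≤ k → j ≤ k → p i = p j → i = j) ∧ ∀ i, i < k → G.Adj (p i) (p (i + 1))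

theorem cc_segment {V : Type*} {G : SimpleGraph V} {p : ℕ → V} {k : ℕ} (hp : IsPth G p k) (a b : ℕ)
    (hab : a ≤ b) (hb : b ≤ k) : CC G {x | ∃ t, a ≤ t ∧ t ≤ b ∧ x = p t} := by
  induction b, hab using Nat.le_induction with
  | base =>
    convert cc_singleton G (p a) using 1
    ext x
    constructor
    · rintro ⟨t, h1, h2, rfl⟩
      have : t = a := by omega
      subst this; rfl
    · rintro rfl
      exact ⟨a, le_refl _, le_refl _, rfl⟩
  | succ b hab ih =>
    have := cc_union (ih (by omega)) (cc_singleton G (p (b + 1))) (a := p b) (b := p (b + 1))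
      ⟨b, hab, le_refl _, rfl⟩ rfl (hp.2 b (by omega))
    convert this using 1
    ext x
    constructor
    · rintro ⟨t, h1, h2, rfl⟩
      rcases Nat.lt_or_ge b t with h | h
      · have : t = b + 1 := by omega
        subst this; exact Or.inr rfl
      · exact Or.inl ⟨t, h1, h, rfl⟩
    · rintro (⟨t, h1, h2, rfl⟩ | h)
      · exact ⟨t, h1, by omega, rfl⟩
      · exact ⟨b + 1, by omega, le_refl _, h⟩

theorem longest_path {V : Type*} [Fintype V] (G : SimpleGraph V) (he : ∃ a b, G.Adj a b) :
    ∃ k, 1 ≤ k ∧ (∃ p, IsPth G p k) ∧ ∀ p, ¬ IsPth G p (k + 1) := by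
  classical
  have bound : ∀ k p, IsPth G p k → k + 1 ≤ Fintype.card V := by
    intro k p hp
    have := Finset.card_le_card_of_injOn (s := Finset.range (k + 1)) (t := (Finset.univ : Finset V)) p
      (fun _ _ => Finset.mem_coe.2 (Finset.mem_univ _)) (by
        intro i hi j hj h
        simp at hi hj
        exact hp.1 i j (by omega) (by omega) h)
    simpa using this
  obtain ⟨a, b, hab⟩ := he
  have h1 : ∃ p, IsPth G p 1 := by
    refine ⟨fun t => if t = 0 then a else b, ?_, ?_⟩
    · intro i j hi hj h
      have := hab.ne
      have := hab.ne.symm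
      rcases Nat.eq_zero_or_pos i with h0 | h0 <;> rcases Nat.eq_zero_or_pos j with h0' | h0' <;>
        grind
    · intro i hi
      have : i = 0 := by omega
      subst this
      simpa using hab
  have hb1 := bound 1 _ h1.choose_spec
  refine ⟨Nat.findGreatest (fun k => ∃ p, IsPth G p k) (Fintype.card V), ?_, ?_, ?_⟩
  · exact Nat.le_findGreatest (by omega) h1
  · exact Nat.findGreatest_spec (P := fun k => ∃ p, IsPth G p k) (m := 1) (by omega) h1
  · intro p hp
    have := bound _ p hp
    have := Nat.le_findGreatest (P := fun k => ∃ p, IsPth G p k) (n := Fintype.card V) (by omega) ⟨p, hp⟩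
    omega

theorem low_degree {V : Type*} [Fintype V] (G : SimpleGraph V)
    (hK : ¬ HasMinor G (⊤ : SimpleGraph (Fin 4))) (he : ∃ a b, G.Adj a b) :
    ∃ w, (∃ a, G.Adj w a) ∧ ∀ a b c, G.Adj w a → G.Adj w b → G.Adj w c → a = b ∨ a = c ∨ b = c := by
  classical
  obtain ⟨k, hk, ⟨p0, hp0⟩, hmax⟩ := longest_path G he
  have nbr : ∀ p, IsPth G p k → ∀ u, G.Adj (p 0) u → ∃ t, 1 ≤ t ∧ t ≤ k ∧ u = p t := by
    intro p hp u hu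
    by_contra hcon
    push Not at hcon
    refine hmax (fun t => if t = 0 then u else p (t - 1)) ⟨?_, ?_⟩
    · have h0 : ∀ t ≤ k, u ≠ p t := by
        intro t ht
        rcases Nat.eq_zero_or_pos t with h | h
        · subst h; exact hu.ne.symm
        · exact hcon t h ht
      intro i j hi hj h
      beta_reduce at h
      rcases Nat.eq_zero_or_pos i with hi0 | hi0 <;> rcases Nat.eq_zero_or_pos j with hj0 | hj0
      · omega
      · rw [if_pos hi0, if_neg (by omega)] at h
        exact absurd h (h0 _ (by omega))
      · rw [if_pos hj0, if_neg (by omega)] at h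
        exact absurd h.symm (h0 _ (by omega))
      · rw [if_neg (by omega), if_neg (by omega)] at h
        have := hp.1 _ _ (by omega) (by omega) h
        omega
    · intro i hi
      rcases Nat.eq_zero_or_pos i with hi0 | hi0
      · subst hi0; simpa using hu.symm
      · have := hp.2 (i - 1) (by omega)
        rw [show i - 1 + 1 = i by omega] at this
        simp only [show i ≠ 0 by omega, if_false, Nat.add_sub_cancel, show i + 1 ≠ 0 by omega]
        exact this
  by_cases hch : ∃ i, 2 ≤ i ∧ i ≤ k ∧ ∃ p, IsPth G p k ∧ G.Adj (p 0) (p i)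
  swap
  · refine ⟨p0 0, ⟨p0 1, hp0.2 0 (by omega)⟩, ?_⟩
    intro a b c ha hb _
    obtain ⟨t, ht1, ht2, rfl⟩ := nbr p0 hp0 a ha
    obtain ⟨s, hs1, hs2, rfl⟩ := nbr p0 hp0 b hb
    have h1 : t = 1 := by
      by_contra h
      exact hch ⟨t, by omega, ht2, p0, hp0, ha⟩
    have h2 : s = 1 := by
      by_contra h
      exact hch ⟨s, by omega, hs2, p0, hp0, hb⟩
    left; rw [h1, h2]
  · have hmin := @Nat.find_min _ _ hch
    obtain ⟨hi2, hik, p, hp, hpi⟩ := Nat.find_spec hch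
    set i := Nat.find hch
    have hmin' : ∀ q, IsPth G q k → ∀ t, 2 ≤ t → t ≤ k → G.Adj (q 0) (q t) → i ≤ t := by
      intro q hq t ht htk hadj
      by_contra hlt
      exact hmin (m := t) (by omega) ⟨ht, htk, q, hq, hadj⟩
    have far : ∀ q, IsPth G q k → (¬ ∀ a b c, G.Adj (q 0) a → G.Adj (q 0) b → G.Adj (q 0) c →
        a = b ∨ a = c ∨ b = c) → ∃ t, i < t ∧ t ≤ k ∧ G.Adj (q 0) (q t) := by
      intro q hq hn
      push Not at hn
      obtain ⟨a, b, c, ha, hb, hc, hab, hac, hbc⟩ := hn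
      obtain ⟨t, ht1, ht2, rfl⟩ := nbr q hq a ha
      obtain ⟨s, hs1, hs2, rfl⟩ := nbr q hq b hb
      obtain ⟨r, hr1, hr2, rfl⟩ := nbr q hq c hc
      have e1 : t ≠ s := fun h => hab (by rw [h])
      have e2 : t ≠ r := fun h => hac (by rw [h])
      have e3 : s ≠ r := fun h => hbc (by rw [h])
      by_contra hcon
      push Not at hcon
      have f1 : t = 1 ∨ t = i := by
        by_contra hh
        have := hmin' q hq t (by omega) ht2 ha
        exact hcon t (by omega) ht2 ha
      have f2 : s = 1 ∨ s = i := by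
        by_contra hh
        have := hmin' q hq s (by omega) hs2 hb
        exact hcon s (by omega) hs2 hb
      have f3 : r = 1 ∨ r = i := by
        by_contra hh
        have := hmin' q hq r (by omega) hr2 hc
        exact hcon r (by omega) hr2 hc
      omega
    set q : ℕ → V := fun t => if t < i then p (i - 1 - t) else p t with hqdef
    have hq : IsPth G q k := by
      constructor
      · intro a b ha hb h
        simp only [hqdef] at h
        split_ifs at h
        all_goals
          have := hp.1 _ _ (by omega) (by omega) h
          omega
      · intro a ha
        simp only [hqdef]
        split_ifs with h1 h2 h2
        · have := hp.2 (i - 1 - (a + 1)) (by omega)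
          rw [show i - 1 - (a + 1) + 1 = i - 1 - a by omega] at this
          exact this.symm
        · rw [show i - 1 - a = 0 by omega, show a + 1 = i by omega]
          exact hpi
        · omega
        · exact hp.2 a ha
    by_cases c1 : ∀ a b c, G.Adj (p 0) a → G.Adj (p 0) b → G.Adj (p 0) c → a = b ∨ a = c ∨ b = c
    · exact ⟨p 0, ⟨_, hpi⟩, c1⟩
    by_cases c2 : ∀ a b c, G.Adj (q 0) a → G.Adj (q 0) b → G.Adj (q 0) c → a = b ∨ a = c ∨ b = c
    · exact ⟨q 0, ⟨_, hq.2 0 (by omega)⟩, c2⟩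
    exfalso
    obtain ⟨j, hj1, hj2, hj3⟩ := far p hp c1
    obtain ⟨l, hl1, hl2, hl3⟩ := far q hq c2
    have hq0 : q 0 = p (i - 1) := by simp only [hqdef]; rw [if_pos (by omega)]; rfl
    have hql : q l = p l := by simp only [hqdef]; rw [if_neg (by omega)]
    rw [hq0, hql] at hl3
    have ne : ∀ s t, s ≤ k → t ≤ k → s ≠ t → p s ≠ p t := fun s t h1 h2 h3 h4 => h3 (hp.1 _ _ h1 h2 h4)
    refine hK (k4_minor (A := {p 0}) (B := {x | ∃ t, 1 ≤ t ∧ t ≤ i - 1 ∧ x = p t}) (C := {p i})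
      (D := {x | ∃ t, i + 1 ≤ t ∧ t ≤ k ∧ x = p t}) ⟨_, rfl⟩ ⟨p 1, 1, by omega, by omega, rfl⟩ ⟨_, rfl⟩
      ⟨p j, j, hj1, hj2, rfl⟩ (cc_singleton _ _) (cc_segment hp _ _ (by omega) (by omega))
      (cc_singleton _ _) (cc_segment hp _ _ (by omega) (by omega)) ?_ ?_ ?_ ?_ ?_ ?_
      ⟨p 0, rfl, p 1, ⟨1, by omega, by omega, rfl⟩, hp.2 0 (by omega)⟩
      ⟨p 0, rfl, p i, rfl, hpi⟩ ⟨p 0, rfl, p j, ⟨j, hj1, hj2, rfl⟩, hj3⟩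
      ⟨p (i - 1), ⟨i - 1, by omega, by omega, rfl⟩, p i, rfl, ?_⟩
      ⟨p (i - 1), ⟨i - 1, by omega, by omega, rfl⟩, p l, ⟨l, hl1, hl2, rfl⟩, hl3⟩
      ⟨p i, rfl, p (i + 1), ⟨i + 1, by omega, by omega, rfl⟩, hp.2 i (by omega)⟩)
    · rintro x rfl ⟨t, h1, h2, h3⟩
      exact ne 0 t (by omega) (by omega) (by omega) h3
    · rintro x rfl h3
      exact ne 0 i (by omega) (by omega) (by omega) h3
    · rintro x rfl ⟨t, h1, h2, h3⟩
      exact ne 0 t (by omega) (by omega) (by omega) h3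
    · rintro x ⟨t, h1, h2, rfl⟩ h3
      exact ne t i (by omega) (by omega) (by omega) h3
    · rintro x ⟨t, h1, h2, rfl⟩ ⟨s, h1', h2', h3⟩
      exact ne t s (by omega) (by omega) (by omega) h3
    · rintro x rfl ⟨t, h1, h2, h3⟩
      exact ne i t (by omega) (by omega) (by omega) h3
    · have := hp.2 (i - 1) (by omega)
      rwa [show i - 1 + 1 = i by omega] at this

/-! ### Every outerplanar graph has a noncrossing order -/

theorem nc_neg {V : Type*} {G : SimpleGraph V} {f : V → ℚ} (h : NC G f) : NC G (fun u => - f u) := by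
  refine ⟨fun x y hxy => h.1 (neg_injective hxy), ?_⟩
  intro a b c d h1 h2 h3 h4 h5
  exact h.2 d c b a h2.symm h1.symm (by linarith) (by linarith) (by linarith)

theorem nc_rotate {V : Type*} [Fintype V] {G : SimpleGraph V} {f : V → ℚ} (h : NC G f) (v : V) :
    ∃ f', NC G f' ∧ ∀ u, u ≠ v → f' v < f' u := by
  classical
  obtain ⟨M, hM⟩ : ∃ M : ℚ, ∀ u w, f u - f w < M := by
    obtain ⟨A, hA⟩ := (Set.finite_range f).bddAbove
    obtain ⟨B, hB⟩ := (Set.finite_range f).bddBelow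
    refine ⟨A - B + 1, fun u w => ?_⟩
    have h1 := hA ⟨u, rfl⟩
    have h2 := hB ⟨w, rfl⟩
    linarith
  refine ⟨fun u => if f v ≤ f u then f u else f u + M, ⟨?_, ?_⟩, ?_⟩
  · intro x y hxy
    have h1 := hM x y
    have h2 := hM y x
    beta_reduce at hxy
    split_ifs at hxy
    · exact h.1 hxy
    · linarith
    · linarith
    · exact h.1 (by linarith)
  · intro a b c d h1 h2 h3 h4 h5
    have e1 := h.2 a b c d h1 h2
    have e2 := h.2 b c d a h2 h1.symm
    have e3 := h.2 c d a b h1.symm h2.symm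
    have e4 := h.2 d a b c h2.symm h1
    have m1 := hM a b
    have m2 := hM b c
    have m3 := hM c d
    have m4 := hM b a
    have m5 := hM c b
    have m6 := hM d c
    beta_reduce at h3 h4 h5
    split_ifs at h3 h4 h5
    all_goals first
      | linarith
      | (exfalso; refine e1 ?_ ?_ ?_ <;> linarith)
      | (exfalso; refine e2 ?_ ?_ ?_ <;> linarith)
      | (exfalso; refine e3 ?_ ?_ ?_ <;> linarith)
      | (exfalso; refine e4 ?_ ?_ ?_ <;> linarith)
  · intro u hu
    have h1 := hM v u
    have h2 : f v ≠ f u := fun hh => hu (h.1 hh).symm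
    beta_reduce
    rw [if_pos (le_refl _)]
    split_ifs with h3
    · exact lt_of_le_of_ne h3 h2
    · linarith

/-- edges of `G` touching `X` -/
def touchG {V : Type*} (G : SimpleGraph V) (X : Set V) : SimpleGraph V where
  Adj u v := G.Adj u v ∧ (u ∈ X ∨ v ∈ X)
  symm := ⟨fun _ _ h => ⟨h.1.symm, h.2.symm⟩⟩
  loopless := ⟨fun _ h => h.1.ne rfl⟩

/-- edges of `G` avoiding `X` -/
def avoidG {V : Type*} (G : SimpleGraph V) (X : Set V) : SimpleGraph V where
  Adj u v := G.Adj u v ∧ u ∉ X ∧ v ∉ X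
  symm := ⟨fun _ _ h => ⟨h.1.symm, h.2.2, h.2.1⟩⟩
  loopless := ⟨fun _ h => h.1.ne rfl⟩

/-- remove `w` and join `a` and `b` -/
def contrG {V : Type*} (G : SimpleGraph V) (w a b : V) (hab : a ≠ b) : SimpleGraph V where
  Adj u v := (G.Adj u v ∧ u ≠ w ∧ v ≠ w) ∨ (u = a ∧ v = b) ∨ (u = b ∧ v = a)
  symm := ⟨fun _ _ h => by
    rcases h with h | h | h
    · exact Or.inl ⟨h.1.symm, h.2.2, h.2.1⟩
    · exact Or.inr (Or.inr ⟨h.2, h.1⟩)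
    · exact Or.inr (Or.inl ⟨h.2, h.1⟩)⟩
  loopless := ⟨fun _ h => by
    rcases h with h | h | h
    · exact h.1.ne rfl
    · exact hab (h.1 ▸ h.2)
    · exact hab (h.2 ▸ h.1)⟩

theorem nc_glue {V : Type*} [Fintype V] {G : SimpleGraph V} (X : Set V) (v : V) (hv : v ∉ X)
    (hX : ∀ x ∈ X, ∀ y, G.Adj x y → y ∈ X ∨ y = v)
    (h1 : ∃ f, NC (touchG G X) f) (h2 : ∃ f, NC (avoidG G X) f) : ∃ f, NC G f := by
  classical
  obtain ⟨f1, h1⟩ := h1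
  obtain ⟨f2, h2⟩ := h2
  obtain ⟨g1, h1, m1⟩ := nc_rotate h1 v
  obtain ⟨g2, h2, m2⟩ := nc_rotate h2 v
  set f : V → ℚ := fun u => if u ∈ X then g1 v - g1 u else g2 u - g2 v with hf
  have fX : ∀ u ∈ X, f u = g1 v - g1 u := fun u hu => by simp only [hf]; rw [if_pos hu]
  have fN : ∀ u, u ∉ X → f u = g2 u - g2 v := fun u hu => by simp only [hf]; rw [if_neg hu]
  have neg : ∀ u ∈ X, f u < 0 := fun u hu => by
    have := m1 u (fun h => hv (h ▸ hu))
    rw [fX u hu]; linarith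
  have pos : ∀ u, u ∉ X → 0 ≤ f u := fun u hu => by
    rw [fN u hu]
    by_cases h : u = v
    · subst h; linarith
    · linarith [m2 u h]
  have fv : f v = 0 := by rw [fN v hv]; ring
  refine ⟨f, ?_, ?_⟩
  · intro x y hxy
    by_cases hx : x ∈ X <;> by_cases hy : y ∈ X
    · rw [fX x hx, fX y hy] at hxy
      exact h1.1 (by linarith)
    · linarith [neg x hx, pos y hy]
    · linarith [neg y hy, pos x hx]
    · rw [fN x hx, fN y hy] at hxy
      exact h2.1 (by linarith)
  · intro a b c d hac hbd hab hbc hcd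
    by_cases ha : a ∈ X
    · by_cases hc : c ∈ X
      · have hb : b ∈ X := by
          by_contra hb
          linarith [pos b hb, neg c hc]
        rw [fX a ha, fX b hb] at hab
        rw [fX c hc, fX b hb] at hbc
        have hcd' : g1 d < g1 c := by
          by_cases hd : d ∈ X
          · rw [fX c hc, fX d hd] at hcd; linarith
          · have : d = v := (hX b hb d hbd).resolve_left hd
            subst this
            exact m1 c (fun h => hv (h ▸ hc))
        exact h1.2 d c b a ⟨hbd.symm, Or.inr hb⟩ ⟨hac.symm, Or.inl hc⟩ hcd' (by linarith) (by linarith)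
      · have : c = v := (hX a ha c hac).resolve_left hc
        subst this
        have hb : b ∈ X := by
          by_contra hb
          linarith [pos b hb]
        rcases hX b hb d hbd with hd | hd
        · linarith [neg d hd]
        · subst hd; linarith
    · have pa := pos a ha
      have hb : b ∉ X := fun h => by linarith [neg b h]
      have hc : c ∉ X := fun h => by linarith [neg c h]
      have hd : d ∉ X := fun h => by linarith [neg d h]
      rw [fN a ha, fN b hb] at hab
      rw [fN b hb, fN c hc] at hbc
      rw [fN c hc, fN d hd] at hcd
      exact h2.2 a b c d ⟨hac, ha, hc⟩ ⟨hbd, hb, hd⟩ (by linarith) (by linarith) (by linarith)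

theorem contr_minor {V W : Type*} {G : SimpleGraph V} {w a b : V} (hab : a ≠ b) (hwa : G.Adj w a)
    (hwb : G.Adj w b) (H : SimpleGraph W) (hH : ∀ i, ∃ j, H.Adj i j)
    (h : HasMinor (contrG G w a b hab) H) : HasMinor G H := by
  rw [hasMinor_iff] at h ⊢
  obtain ⟨F, h1, h2, h3, h4⟩ := h
  have iso : ∀ u, ¬ (contrG G w a b hab).Adj w u := by
    rintro u (h | h | h)
    · exact h.2.1 rfl
    · exact hwa.ne h.1
    · exact hwb.ne h.1
  have hw : ∀ i, w ∉ F i := by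
    intro i hi
    obtain ⟨j, hj⟩ := hH i
    obtain ⟨x, hx, y, hy, hxy⟩ := h4 hj
    by_cases hxw : x = w
    · subst hxw; exact iso _ hxy
    · obtain ⟨p, hp, q, hq, hpT, hqT, hpq⟩ := h2 i {w} ⟨w, hi, rfl⟩ ⟨x, hx, hxw⟩
      have : p = w := hpT
      subst this
      exact iso _ hpq
  refine ⟨fun i => F i ∪ {x | x = w ∧ a ∈ F i}, ?_, ?_, ?_, ?_⟩
  · intro i
    obtain ⟨x, hx⟩ := h1 i
    exact ⟨x, Or.inl hx⟩
  · rintro i T ⟨x, hx, hxT⟩ ⟨y, hy, hyT⟩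
    by_cases c1 : ∃ x ∈ F i, x ∈ T
    · by_cases c2 : ∃ y ∈ F i, y ∉ T
      · obtain ⟨p, hp, q, hq, hpT, hqT, hpq | hpq | hpq⟩ := h2 i T c1 c2
        · exact ⟨p, Or.inl hp, q, Or.inl hq, hpT, hqT, hpq.1⟩
        · obtain ⟨rfl, rfl⟩ := hpq
          by_cases hwT : w ∈ T
          · exact ⟨w, Or.inr ⟨rfl, hp⟩, q, Or.inl hq, hwT, hqT, hwb⟩
          · exact ⟨p, Or.inl hp, w, Or.inr ⟨rfl, hp⟩, hpT, hwT, hwa.symm⟩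
        · obtain ⟨rfl, rfl⟩ := hpq
          by_cases hwT : w ∈ T
          · exact ⟨w, Or.inr ⟨rfl, hq⟩, q, Or.inl hq, hwT, hqT, hwa⟩
          · exact ⟨p, Or.inl hp, w, Or.inr ⟨rfl, hq⟩, hpT, hwT, hwb.symm⟩
      · push Not at c2
        rcases hy with hy | ⟨rfl, hy⟩
        · exact absurd (c2 y hy) hyT
        · exact ⟨a, Or.inl hy, y, Or.inr ⟨rfl, hy⟩, c2 a hy, hyT, hwa.symm⟩
    · push Not at c1
      rcases hx with hx | ⟨rfl, hx⟩
      · exact absurd hxT (c1 x hx)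
      · exact ⟨x, Or.inr ⟨rfl, hx⟩, a, Or.inl hx, hxT, c1 a hx, hwa⟩
  · rintro i j x (hx | ⟨rfl, hx⟩) (hy | ⟨hy1, hy⟩)
    · exact h3 i j x hx hy
    · subst hy1; exact absurd hx (hw i)
    · exact absurd hy (hw j)
    · exact h3 i j a hx hy
  · intro i j hij
    obtain ⟨p, hp, q, hq, hpq | ⟨rfl, rfl⟩ | ⟨rfl, rfl⟩⟩ := h4 hij
    · exact ⟨p, Or.inl hp, q, Or.inl hq, hpq.1⟩
    · exact ⟨w, Or.inr ⟨rfl, hp⟩, q, Or.inl hq, hwb⟩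
    · exact ⟨p, Or.inl hp, w, Or.inr ⟨rfl, hq⟩, hwb.symm⟩

theorem contr_outerplanar {V : Type*} {G : SimpleGraph V} {w a b : V} (hab : a ≠ b) (hwa : G.Adj w a)
    (hwb : G.Adj w b) (h : Outerplanar G) : Outerplanar (contrG G w a b hab) := by
  refine ⟨fun hh => h.1 (contr_minor hab hwa hwb _ ?_ hh), fun hh => h.2 (contr_minor hab hwa hwb _ ?_ hh)⟩
  · intro i
    refine ⟨i + 1, ?_⟩
    simp
  · rintro (i | i)
    · exact ⟨.inr 0, by simp⟩
    · exact ⟨.inl 0, by simp⟩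

theorem exists_inj (V : Type*) [Fintype V] : ∃ f : V → ℚ, Function.Injective f := by
  refine ⟨fun v => ((Fintype.equivFin V v : ℕ) : ℚ), ?_⟩
  intro x y h
  beta_reduce at h
  have : (Fintype.equivFin V x : ℕ) = (Fintype.equivFin V y : ℕ) := by exact_mod_cast h
  exact (Fintype.equivFin V).injective (Fin.ext this)

/-- One side of a pair `a, b` with no connection from `a` to `b`. -/
theorem side_lemma {V : Type*} [Fintype V] {G : SimpleGraph V} {w a b : V} (hab : a ≠ b)
    (hwa : G.Adj w a) (hwb : G.Adj w b) (hG : Outerplanar G) (L : Set V)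
    (hwL : w ∉ L) (haL : a ∉ L) (hbL : b ∉ L)
    (hL : ∀ x ∈ L, ∀ y, G.Adj x y → y ∈ L ∨ y = a ∨ y = b)
    (ih : ∀ G' : SimpleGraph V, Outerplanar G' → (∀ u v, G'.Adj u v → G.Adj u v) →
      (∃ u v, G.Adj u v ∧ ∀ v', ¬ G'.Adj u v') → ∃ f, NC G' f)
    (hno : ¬ ∃ D ⊆ L, CC G D ∧ (∃ x ∈ D, G.Adj a x) ∧ (∃ x ∈ D, G.Adj b x)) :
    (∃ f, NC G f) ∨ ∀ x ∈ L, ∀ y, ¬ G.Adj x y := by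
  have le1 : ∀ X, touchG G X ≤ G := fun X u v h => h.1
  have le2 : ∀ X, avoidG G X ≤ G := fun X u v h => h.1
  -- general separation step
  have sep : ∀ X ⊆ L, ∀ v, v ∉ X → (∀ x ∈ X, ∀ y, G.Adj x y → y ∈ X ∨ y = v) → (v = a ∨ v = b) →
      (∃ x ∈ X, ∃ y, G.Adj x y) → ∃ f, NC G f := by
    rintro X hXL v hv hX hvab ⟨x, hx, y, hxy⟩
    refine nc_glue X v hv hX ?_ ?_
    · refine ih _ (outerplanar_mono (le1 X) hG) (fun u v h => h.1) ⟨w, a, hwa, ?_⟩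
      rintro v' ⟨h1, h2 | h2⟩
      · exact hwL (hXL h2)
      · rcases hX v' h2 w h1.symm with h3 | h3
        · exact hwL (hXL h3)
        · rcases hvab with h4 | h4
          · exact hwa.ne (h3.trans h4)
          · exact hwb.ne (h3.trans h4)
    · exact ih _ (outerplanar_mono (le2 X) hG) (fun u v h => h.1) ⟨x, y, hxy, fun v' h => h.2.1 hx⟩
  by_cases c : ∃ x ∈ L, G.Adj a x
  · left
    obtain ⟨x0, hx0, hax0⟩ := c
    -- union of connected subsets of L meeting N(a)
    set X : Set V := {u | ∃ D ⊆ L, CC G D ∧ (∃ x ∈ D, G.Adj a x) ∧ u ∈ D} with hXdef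
    have hXL : X ⊆ L := by rintro u ⟨D, h1, -, -, h2⟩; exact h1 h2
    refine sep X hXL a (fun h => haL (hXL h)) ?_ (Or.inl rfl)
      ⟨x0, ⟨{x0}, by simpa using hx0, cc_singleton _ _, ⟨x0, rfl, hax0⟩, rfl⟩, a, hax0.symm⟩
    rintro x ⟨D, h1, h2, h3, h4⟩ y hxy
    rcases hL x (h1 h4) y hxy with h | h | h
    · left
      obtain ⟨z, hz, hz'⟩ := h3
      exact ⟨D ∪ {y}, Set.union_subset h1 (by simpa using h), cc_union h2 (cc_singleton G y) h4 rfl hxy,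
        ⟨z, Or.inl hz, hz'⟩, Or.inr rfl⟩
    · exact Or.inr h
    · subst h
      exact absurd ⟨D, h1, h2, h3, x, h4, hxy.symm⟩ hno
  · by_cases c2 : ∃ x ∈ L, ∃ y, G.Adj x y
    · left
      refine sep L (le_refl _) b hbL ?_ (Or.inr rfl) c2
      intro x hx y hxy
      rcases hL x hx y hxy with h | h | h
      · exact Or.inl h
      · subst h; exact absurd ⟨x, hx, hxy.symm⟩ c
      · exact Or.inr h
    · right
      push Not at c2
      exact c2

theorem exists_nc {V : Type*} [Fintype V] : ∀ (m : ℕ) (G : SimpleGraph V), G.support.ncard ≤ m →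
    Outerplanar G → ∃ f, NC G f := by
  classical
  intro m
  induction m with
  | zero =>
    intro G hm _
    obtain ⟨f, hf⟩ := exists_inj V
    refine ⟨f, hf, fun a b c d h => ?_⟩
    have : G.support = ∅ := (Set.ncard_eq_zero (Set.toFinite _)).1 (by omega)
    have h' : a ∈ G.support := ⟨c, h⟩
    rw [this] at h'
    exact absurd h' (Set.notMem_empty _)
  | succ m ih0 =>
    intro G hm hG
    have ih' : ∀ G' : SimpleGraph V, Outerplanar G' → (∀ u ∈ G'.support, u ∈ G.support) →
      (∃ u v, G.Adj u v ∧ ∀ v', ¬ G'.Adj u v') → ∃ f, NC G' f := by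
      rintro G' hG' hle ⟨u, v, huv, hu⟩
      refine ih0 G' ?_ hG'
      have : G'.support ⊂ G.support := by
        refine ⟨hle, fun h => ?_⟩
        obtain ⟨y, hy⟩ := h (show u ∈ G.support from ⟨v, huv⟩)
        exact hu _ hy
      have := Set.ncard_lt_ncard this (Set.toFinite _)
      omega
    have ih : ∀ G' : SimpleGraph V, Outerplanar G' → (∀ u v, G'.Adj u v → G.Adj u v) →
      (∃ u v, G.Adj u v ∧ ∀ v', ¬ G'.Adj u v') → ∃ f, NC G' f := by
      intro G' h1 h2 h3
      refine ih' G' h1 ?_ h3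
      rintro u ⟨v, huv⟩
      exact ⟨v, h2 _ _ huv⟩
    by_cases he : ∃ a b, G.Adj a b
    swap
    · push Not at he
      obtain ⟨f, hf⟩ := exists_inj V
      exact ⟨f, hf, fun a b c d h => absurd h (he _ _)⟩
    obtain ⟨w, ⟨a, hwa⟩, hdeg⟩ := low_degree G hG.1 he
    by_cases hb : ∃ b, b ≠ a ∧ G.Adj w b
    swap
    · push Not at hb
      have only : ∀ y, G.Adj w y → y = a := fun y hy => by
        by_contra h; exact hb y h hy
      refine nc_glue {w} a (by simpa using hwa.ne.symm) ?_ ?_ ?_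
      · rintro x rfl y hxy
        exact Or.inr (only y hxy)
      · obtain ⟨f, hf⟩ := exists_inj V
        refine ⟨f, hf, ?_⟩
        rintro x1 x2 x3 x4 ⟨-, h1⟩ ⟨-, h2⟩ l1 l2 l3
        simp only [Set.mem_singleton_iff] at h1 h2
        rcases h1 with rfl | rfl <;> rcases h2 with rfl | rfl <;> linarith
      · exact ih _ (outerplanar_mono (fun u v h => h.1) hG) (fun u v h => h.1)
          ⟨w, a, hwa, fun v' h => h.2.1 rfl⟩
    obtain ⟨b, hba, hwb⟩ := hb
    have only : ∀ y, G.Adj w y → y = a ∨ y = b := fun y hy => by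
      have := hdeg a b y hwa hwb hy
      grind
    have hab : a ≠ b := hba.symm
    obtain ⟨f0, hf0⟩ := ih' (contrG G w a b hab) (contr_outerplanar hab hwa hwb hG) (by
      rintro u ⟨v, h | h | h⟩
      · exact ⟨v, h.1⟩
      · exact ⟨w, h.1 ▸ hwa.symm⟩
      · exact ⟨w, h.1 ▸ hwb.symm⟩) ⟨w, a, hwa, by
      rintro v (h | h | h)
      · exact h.2.1 rfl
      · exact hwa.ne h.1
      · exact hwb.ne h.1⟩
    obtain ⟨f, hf, hmin⟩ := nc_rotate hf0 a
    have wa : w ≠ a := hwa.ne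
    have wb : w ≠ b := hwb.ne
    have fab : f a < f b := hmin b hba
    have old : ∀ x1 x2 x3 x4, x1 ≠ w → x2 ≠ w → x3 ≠ w → x4 ≠ w → G.Adj x1 x3 → G.Adj x2 x4 →
        f x1 < f x2 → f x2 < f x3 → f x3 < f x4 → False :=
      fun x1 x2 x3 x4 h1 h2 h3 h4 h5 h6 => hf.2 x1 x2 x3 x4 (Or.inl ⟨h5, h1, h3⟩) (Or.inl ⟨h6, h2, h4⟩)
    have crossab : ∀ x y, x ≠ w → y ≠ w → G.Adj x y → f a < f x → f x < f b → f b < f y → False :=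
      fun x y hx hy hxy h1 h2 h3 => hf.2 a x b y (Or.inr (Or.inl ⟨rfl, rfl⟩)) (Or.inl ⟨hxy, hx, hy⟩) h1 h2 h3
    set L : Set V := {u | u ≠ w ∧ f a < f u ∧ f u < f b} with hLdef
    set R : Set V := {u | u ≠ w ∧ f b < f u} with hRdef
    have tri : ∀ u, u ≠ w → u = a ∨ u = b ∨ u ∈ L ∨ u ∈ R := by
      intro u hu
      by_cases h1 : u = a
      · exact Or.inl h1
      by_cases h2 : u = b
      · exact Or.inr (Or.inl h2)
      have h3 := hmin u h1
      have h4 : f u ≠ f b := fun h => h2 (hf.1 h)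
      rcases lt_or_gt_of_ne h4 with h5 | h5
      · exact Or.inr (Or.inr (Or.inl ⟨hu, h3, h5⟩))
      · exact Or.inr (Or.inr (Or.inr ⟨hu, h5⟩))
    have aL : a ∉ L := fun h => lt_irrefl _ h.2.1
    have bL : b ∉ L := fun h => lt_irrefl _ h.2.2
    have aR : a ∉ R := fun h => lt_asymm h.2 fab
    have bR : b ∉ R := fun h => lt_irrefl _ h.2
    have wL : w ∉ L := fun h => h.1 rfl
    have wR : w ∉ R := fun h => h.1 rfl
    have LR : ∀ x ∈ L, x ∉ R := fun x h1 h2 => lt_asymm h1.2.2 h2.2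
    have nLR : ∀ x ∈ L, ∀ y ∈ R, ¬ G.Adj x y := fun x hx y hy h =>
      crossab x y hx.1 hy.1 h hx.2.1 hx.2.2 hy.2
    have hL : ∀ x ∈ L, ∀ y, G.Adj x y → y ∈ L ∨ y = a ∨ y = b := by
      intro x hx y hxy
      have hyw : y ≠ w := by
        rintro rfl
        rcases only x hxy.symm with rfl | rfl
        · exact aL hx
        · exact bL hx
      rcases tri y hyw with h | h | h | h
      · exact Or.inr (Or.inl h)
      · exact Or.inr (Or.inr h)
      · exact Or.inl h
      · exact absurd hxy (nLR x hx y h)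
    have hR : ∀ x ∈ R, ∀ y, G.Adj x y → y ∈ R ∨ y = a ∨ y = b := by
      intro x hx y hxy
      have hyw : y ≠ w := by
        rintro rfl
        rcases only x hxy.symm with rfl | rfl
        · exact aR hx
        · exact bR hx
      rcases tri y hyw with h | h | h | h
      · exact Or.inr (Or.inl h)
      · exact Or.inr (Or.inr h)
      · exact absurd hxy.symm (nLR y h x hx)
      · exact Or.inl h
    have finish : ∀ q : ℚ, (∀ u, f u ≠ q) → (f a < q) →
        ((q < f b ∧ ∀ x ∈ L, ∀ y, ¬ G.Adj x y) ∨ ((∀ u, f u < q) ∧ ∀ x ∈ R, ∀ y, ¬ G.Adj x y)) →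
        ∃ f, NC G f := by
      intro q hq haq hcase
      refine ⟨Function.update f w q, ?_, ?_⟩
      · intro x y hxy
        by_cases hx : x = w <;> by_cases hy : y = w
        · rw [hx, hy]
        · subst hx
          rw [Function.update_self, Function.update_of_ne hy] at hxy
          exact absurd hxy.symm (hq y)
        · subst hy
          rw [Function.update_self, Function.update_of_ne hx] at hxy
          exact absurd hxy (hq x)
        · rw [Function.update_of_ne hx, Function.update_of_ne hy] at hxy
          exact hf.1 hxy
      · intro x1 x2 x3 x4 h13 h24 l1 l2 l3
        have gw : Function.update f w q w = q := Function.update_self ..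
        have gn : ∀ u, u ≠ w → Function.update f w q u = f u := fun u hu => Function.update_of_ne hu ..
        generalize Function.update f w q = g at *
        have ga := gn a wa.symm
        have gb := gn b wb.symm
        by_cases e1 : x1 = w
        · subst e1
          have n2 : x2 ≠ x1 := by rintro rfl; linarith
          have n3 : x3 ≠ x1 := by rintro rfl; linarith
          rw [gw] at l1
          rw [gn _ n2] at l1 l2
          rw [gn _ n3] at l2 l3
          rcases only x3 h13 with rfl | rfl
          · linarith
          · rcases hcase with ⟨hc1, hc2⟩ | ⟨hc1, hc2⟩
            · exact hc2 x2 ⟨n2, by linarith, l2⟩ _ h24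
            · linarith [hc1 x2]
        by_cases e2 : x2 = w
        · subst e2
          have n3 : x3 ≠ x2 := by rintro rfl; linarith
          have n4 : x4 ≠ x2 := by rintro rfl; linarith
          rw [gw] at l1 l2
          rw [gn _ n3] at l2 l3
          rw [gn _ n4] at l3
          rcases only x4 h24 with rfl | rfl
          · linarith
          · rcases hcase with ⟨hc1, hc2⟩ | ⟨hc1, hc2⟩
            · exact hc2 x3 ⟨n3, by linarith, l3⟩ _ h13.symm
            · linarith [hc1 x3]
        by_cases e3 : x3 = w
        · subst e3
          have n2 : x2 ≠ x3 := by rintro rfl; linarith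
          have n4 : x4 ≠ x3 := by rintro rfl; linarith
          rw [gw] at l2 l3
          rw [gn _ n2] at l1 l2
          rw [gn _ e1] at l1
          rw [gn _ n4] at l3
          rcases hcase with ⟨hc1, hc2⟩ | ⟨hc1, hc2⟩
          · rcases only x1 h13.symm with rfl | rfl
            · exact hc2 x2 ⟨n2, l1, by linarith⟩ _ h24
            · linarith
          · linarith [hc1 x4]
        by_cases e4 : x4 = w
        · subst e4
          rw [gw] at l3
          rw [gn _ e1] at l1
          rw [gn _ e2] at l1 l2
          rw [gn _ e3] at l2 l3
          have hx1 : f a ≤ f x1 := by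
            by_cases h : x1 = a
            · rw [h]
            · exact (hmin x1 h).le
          rcases only x2 h24.symm with rfl | rfl
          · linarith
          · rcases hcase with ⟨hc1, hc2⟩ | ⟨hc1, hc2⟩
            · linarith
            · exact hc2 x3 ⟨e3, l2⟩ _ h13.symm
        rw [gn _ e1, gn _ e2] at l1
        rw [gn _ e2, gn _ e3] at l2
        rw [gn _ e3, gn _ e4] at l3
        exact old x1 x2 x3 x4 e1 e2 e3 e4 h13 h24 l1 l2 l3
    by_cases pL : ∃ D ⊆ L, CC G D ∧ (∃ x ∈ D, G.Adj a x) ∧ (∃ x ∈ D, G.Adj b x)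
    · by_cases pR : ∃ D ⊆ R, CC G D ∧ (∃ x ∈ D, G.Adj a x) ∧ (∃ x ∈ D, G.Adj b x)
      · exfalso
        obtain ⟨D, hD, cD, ⟨x, hx, hax⟩, y, hy, hby⟩ := pL
        obtain ⟨E, hE, cE, ⟨x', hx', hax'⟩, y', hy', hby'⟩ := pR
        refine hG.2 (k23_minor (P := {a}) (Q := {b}) (A := {w}) (B := D) (C := E) ⟨_, rfl⟩ ⟨_, rfl⟩ ⟨_, rfl⟩
          ⟨x, hx⟩ ⟨x', hx'⟩ (cc_singleton _ _) (cc_singleton _ _) (cc_singleton _ _) cD cE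
          ?_ ?_ ?_ ?_ ?_ ?_ ?_ ?_ ?_ ?_
          ⟨a, rfl, w, rfl, hwa.symm⟩ ⟨a, rfl, x, hx, hax⟩ ⟨a, rfl, x', hx', hax'⟩
          ⟨b, rfl, w, rfl, hwb.symm⟩ ⟨b, rfl, y, hy, hby⟩ ⟨b, rfl, y', hy', hby'⟩)
        · rintro _ rfl h; exact hab h
        · rintro _ rfl h; exact wa.symm h
        · rintro _ rfl h; exact aL (hD h)
        · rintro _ rfl h; exact aR (hE h)
        · rintro _ rfl h; exact wb.symm h
        · rintro _ rfl h; exact bL (hD h)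
        · rintro _ rfl h; exact bR (hE h)
        · rintro _ rfl h; exact wL (hD h)
        · rintro _ rfl h; exact wR (hE h)
        · intro z h1 h2; exact LR z (hD h1) (hE h2)
      · rcases side_lemma hab hwa hwb hG R wR aR bR hR ih pR with h | h
        · exact h
        · obtain ⟨A, hA⟩ := (Set.finite_range f).bddAbove
          have hA' : ∀ u, f u < A + 1 := fun u => by
            have := hA ⟨u, rfl⟩
            linarith
          exact finish (A + 1) (fun u => (hA' u).ne) (hA' a) (Or.inr ⟨hA', h⟩)
    · rcases side_lemma hab hwa hwb hG L wL aL bL hL ih pL with h | h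
      · exact h
      · obtain ⟨q, hq1, hq2⟩ := ((Set.Ioo_infinite fab).sdiff (Set.finite_range f)).nonempty
        exact finish q (fun u hu => hq2 ⟨u, hu⟩) hq1.1 (Or.inl ⟨hq1.2, h⟩)


theorem mop_add {V : Type*} [Fintype V] {G : SimpleGraph V} {f : V → ℚ} (h : MaximalOuterplanar G)
    (hf : NC G f) {u v : V} (huv : f u < f v)
    (hno : ∀ a b, G.Adj a b → f u < f a → f a < f v → f u ≤ f b ∧ f b ≤ f v) : G.Adj u v := by
  by_contra hadj
  have hne : u ≠ v := by rintro rfl; exact lt_irrefl _ huv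
  refine h.2 u v hne hadj (nc_outerplanar (f := f) ⟨hf.1, ?_⟩)
  intro a b c d hac hbd h1 h2 h3
  simp only [SimpleGraph.sup_adj, SimpleGraph.fromEdgeSet_adj, Set.mem_singleton_iff, Sym2.eq_iff] at hac hbd
  rcases hac with hac | ⟨⟨rfl, rfl⟩ | ⟨rfl, rfl⟩, _⟩
  · rcases hbd with hbd | ⟨⟨rfl, rfl⟩ | ⟨rfl, rfl⟩, _⟩
    · exact hf.2 a b c d hac hbd h1 h2 h3
    · have := hno c a hac.symm h2 h3
      linarith [this.1]
    · linarith
  · rcases hbd with hbd | ⟨⟨rfl, rfl⟩ | ⟨rfl, rfl⟩, _⟩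
    · have := hno b d hbd h1 h2
      linarith [this.2]
    · linarith
    · linarith
  · linarith

structure GPoly {V : Type*} (G : SimpleGraph V) (n : ℕ) (g : ℕ → V) : Prop where
  inj : ∀ i j, i < n → j < n → g i = g j → i = j
  surj : ∀ v, ∃ i, i < n ∧ g i = v
  nc : ∀ i j k l, i < j → j < k → k < l → l < n → G.Adj (g i) (g k) → G.Adj (g j) (g l) → False
  add : ∀ i j, i < j → j < n → (∀ k l, i < k → k < j → l < n → G.Adj (g k) (g l) → i ≤ l ∧ l ≤ j) →
    G.Adj (g i) (g j)
  deg : ∀ a b c, G.Adj (g 0) a → G.Adj (g 0) b → G.Adj (g 0) c → a = b ∨ a = c ∨ b = c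

theorem exists_poly {V : Type*} [Fintype V] {G : SimpleGraph V} (h : MaximalOuterplanar G)
    (hn : 3 ≤ Fintype.card V) : ∃ g, GPoly G (Fintype.card V) g := by
  classical
  obtain ⟨f₀, hf₀⟩ := exists_nc _ G le_rfl h.1
  have he : ∃ a b, G.Adj a b := by
    by_contra hno
    push Not at hno
    obtain ⟨a, b, hab⟩ := Fintype.exists_pair_of_one_lt_card (α := V) (by omega)
    rcases lt_or_gt_of_ne (fun hh => hab (hf₀.1 hh)) with hl | hl
    · exact hno _ _ (mop_add h hf₀ hl fun x y hxy => absurd hxy (hno x y))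
    · exact hno _ _ (mop_add h hf₀ hl fun x y hxy => absurd hxy (hno x y))
  obtain ⟨w, _, hw⟩ := low_degree G h.1.1 he
  obtain ⟨f, hf, hmin⟩ := nc_rotate hf₀ w
  let _ : LinearOrder V := LinearOrder.lift' f hf.1
  have hlt : ∀ a b : V, a < b ↔ f a < f b := fun a b => Iff.rfl
  let e : Fin (Fintype.card V) ≃o V := Fintype.orderIsoFinOfCardEq V rfl
  have hpos : 0 < Fintype.card V := by omega
  let g : ℕ → V := fun i => if hi : i < Fintype.card V then e ⟨i, hi⟩ else w
  have hg : ∀ i (hi : i < Fintype.card V), g i = e ⟨i, hi⟩ := fun i hi => dif_pos hi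
  have hmono : ∀ i j, i < Fintype.card V → j < Fintype.card V → (f (g i) < f (g j) ↔ i < j) := by
    intro i j hi hj
    rw [hg i hi, hg j hj, ← hlt, OrderIso.lt_iff_lt]
    exact Iff.rfl
  have hmono' : ∀ i j, i < Fintype.card V → j < Fintype.card V → (f (g i) ≤ f (g j) ↔ i ≤ j) := by
    intro i j hi hj
    rw [← not_lt, hmono j i hj hi, not_lt]
  have hsurj : ∀ v, ∃ i, i < Fintype.card V ∧ g i = v := by
    intro v
    refine ⟨(e.symm v).1, (e.symm v).2, ?_⟩
    rw [hg _ (e.symm v).2]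
    simp
  have h0 : g 0 = w := by
    by_contra hne
    obtain ⟨i, hi, hiw⟩ := hsurj w
    have := hmin _ hne
    rw [← hiw, hmono i 0 hi hpos] at this
    omega
  refine ⟨g, ⟨?_, hsurj, ?_, ?_, ?_⟩⟩
  · intro i j hi hj hij
    have h1 := hmono i j hi hj
    have h2 := hmono j i hj hi
    rw [hij] at h1 h2
    simp at h1 h2
    omega
  · intro i j k l hij hjk hkl hl h1 h2
    exact hf.2 _ _ _ _ h1 h2 ((hmono _ _ (by omega) (by omega)).2 hij)
      ((hmono _ _ (by omega) (by omega)).2 hjk) ((hmono _ _ (by omega) (by omega)).2 hkl)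
  · intro i j hij hj H
    refine mop_add h hf ((hmono _ _ (by omega) hj).2 hij) ?_
    intro a b hab h1 h2
    obtain ⟨k, hk, rfl⟩ := hsurj a
    obtain ⟨l, hl, rfl⟩ := hsurj b
    rw [hmono _ _ (by omega) hk] at h1
    rw [hmono _ _ hk hj] at h2
    rw [hmono' _ _ (by omega) hl, hmono' _ _ hl hj]
    exact H k l h1 h2 hl hab
  · rw [h0]; exact hw

theorem GPoly.succ {V : Type*} {G : SimpleGraph V} {n : ℕ} {g : ℕ → V} (P : GPoly G n g) (i : ℕ)
    (hi : i + 1 < n) : G.Adj (g i) (g (i + 1)) :=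
  P.add i (i + 1) (by omega) hi (fun k l h1 h2 => by omega)

theorem GPoly.ends {V : Type*} {G : SimpleGraph V} {n : ℕ} {g : ℕ → V} (P : GPoly G n g)
    (hn : 3 ≤ n) : G.Adj (g 0) (g (n - 1)) :=
  P.add 0 (n - 1) (by omega) (by omega) (fun k l h1 h2 h3 _ => by omega)

theorem GPoly.third {V : Type*} {G : SimpleGraph V} {n : ℕ} {g : ℕ → V} (P : GPoly G n g) (i j : ℕ)
    (hij : i + 2 ≤ j) (hj : j < n) (hadj : G.Adj (g i) (g j)) :
    ∃ k, i < k ∧ k < j ∧ G.Adj (g i) (g k) ∧ G.Adj (g k) (g j) := by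
  classical
  let Q : ℕ → Prop := fun k => i < k ∧ k < j ∧ G.Adj (g i) (g k)
  have hQ1 : Q (i + 1) := ⟨by omega, by omega, P.succ i (by omega)⟩
  have hk := Nat.findGreatest_spec (P := Q) (n := j) (by omega) hQ1
  set k := Nat.findGreatest Q j with hkdef
  obtain ⟨h1, h2, h3⟩ := hk
  refine ⟨k, h1, h2, h3, P.add k j h2 hj ?_⟩
  intro m l hkm hmj hl hml
  constructor
  · by_contra hlk
    push Not at hlk
    rcases lt_trichotomy l i with hli | hli | hli
    · exact P.nc l i m j hli (by omega) hmj hj hml.symm hadj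
    · subst hli
      have := Nat.le_findGreatest (P := Q) (n := j) (m := m) (by omega) ⟨by omega, hmj, hml.symm⟩
      omega
    · exact P.nc i l k m hli hlk hkm (by omega) h3 hml.symm
  · by_contra hlj
    push Not at hlj
    exact P.nc i m j l (by omega) hmj hlj hl hadj hml

theorem ham_chord {V : Type*} [DecidableEq V] {G : SimpleGraph V} {v : V} (p : G.Walk v v)
    (hp : p.IsHamiltonianCycle) {a b : V} (hab : s(a, b) ∈ p.edges) (T : Set V)
    (haT : a ∉ T) (hbT : b ∉ T) {x y : V} (hx : x ∈ T) (hy : y ∉ T) (hya : y ≠ a) (hyb : y ≠ b)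
    (hT : ∀ u w, u ∈ T → G.Adj u w → w ∈ T ∨ w = a ∨ w = b) : False := by
  have ha := hp.mem_support a
  have hq := hp.rotate ha
  have hqe : s(a, b) ∈ (p.rotate a ha).edges := by
    rw [(p.rotate_edges a ha).mem_iff]; exact hab
  generalize p.rotate a ha = q at hq hqe
  have hlen := hq.isCycle.three_le_length
  have inj1 := hq.isCycle.getVert_injOn
  have inj2 := hq.isCycle.getVert_injOn'
  have hall : ∀ w, ∃ t, t ≤ q.length ∧ q.getVert t = w := by
    intro w
    obtain ⟨t, h1, h2⟩ := Walk.mem_support_iff_exists_getVert.1 (hq.mem_support w)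
    exact ⟨t, h2, h1⟩
  have hc0 : q.getVert 0 = a := q.getVert_zero
  have hcn : q.getVert q.length = a := q.getVert_length
  have key : ∃ lo hi, hi < q.length ∧ (∀ t, lo ≤ t → t ≤ hi → q.getVert t ≠ a ∧ q.getVert t ≠ b) ∧
      ∀ w, w ≠ a → w ≠ b → ∃ t, lo ≤ t ∧ t ≤ hi ∧ q.getVert t = w := by
    obtain ⟨i, hi, he⟩ := (Walk.mk_mem_edges_iff_exists q).1 hqe
    rw [Sym2.eq_iff] at he
    rcases he with ⟨h1, h2⟩ | ⟨h1, h2⟩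
    · have hi0 : i = 0 := inj2 (by simp; omega) (by simp) (h1.trans hc0.symm)
      subst hi0
      refine ⟨2, q.length - 1, by omega, ?_, ?_⟩
      · intro t ht1 ht2
        constructor
        · intro h
          have : t = 0 := inj2 (by simp; omega) (by simp) (h.trans hc0.symm)
          omega
        · intro h
          have : t = 1 := inj2 (by simp; omega) (by simp; omega) (h.trans h2.symm)
          omega
      · intro w hwa hwb
        obtain ⟨t, ht, rfl⟩ := hall w
        refine ⟨t, ?_, ?_, rfl⟩
        · by_contra hlt
          have : t = 0 ∨ t = 1 := by omega
          rcases this with rfl | rfl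
          · exact hwa hc0
          · exact hwb h2
        · by_contra hlt
          have : t = q.length := by omega
          subst this
          exact hwa hcn
    · have hi0 : i + 1 = q.length := inj1 (by simp; omega) (by simp; omega) (h2.trans hcn.symm)
      refine ⟨1, q.length - 2, by omega, ?_, ?_⟩
      · intro t ht1 ht2
        constructor
        · intro h
          have : t = q.length := inj1 (by simp; omega) (by simp; omega) (h.trans hcn.symm)
          omega
        · intro h
          have : t = i := inj1 (by simp; omega) (by simp; omega) (h.trans h1.symm)
          omega
      · intro w hwa hwb
        obtain ⟨t, ht, rfl⟩ := hall w
        refine ⟨t, ?_, ?_, rfl⟩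
        · by_contra hlt
          have : t = 0 := by omega
          subst this
          exact hwa hc0
        · by_contra hlt
          have : t = i ∨ t = q.length := by omega
          rcases this with rfl | rfl
          · exact hwb h1
          · exact hwa hcn
  obtain ⟨lo, hi, hhi, havoid, hfind⟩ := key
  have hstep : ∀ t, lo ≤ t → t + 1 ≤ hi → (q.getVert t ∈ T ↔ q.getVert (t + 1) ∈ T) := by
    intro t h1 h2
    have hadj := q.adj_getVert_succ (i := t) (by omega)
    have A := havoid t h1 (by omega)
    have B := havoid (t + 1) (by omega) h2
    constructor
    · intro h
      rcases hT _ _ h hadj with h | h | h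
      · exact h
      · exact absurd h B.1
      · exact absurd h B.2
    · intro h
      rcases hT _ _ h hadj.symm with h | h | h
      · exact h
      · exact absurd h A.1
      · exact absurd h A.2
  have hconst : ∀ d, lo + d ≤ hi → (q.getVert (lo + d) ∈ T ↔ q.getVert lo ∈ T) := by
    intro d
    induction d with
    | zero => intro _; rfl
    | succ d ih =>
      intro h
      rw [← ih (by omega), ← add_assoc, hstep (lo + d) (by omega) (by omega)]
  obtain ⟨t1, a1, b1, rfl⟩ := hfind x (fun h => haT (h ▸ hx)) (fun h => hbT (h ▸ hx))
  obtain ⟨t2, a2, b2, rfl⟩ := hfind y hya hyb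
  obtain ⟨d1, rfl⟩ := Nat.exists_eq_add_of_le a1
  obtain ⟨d2, rfl⟩ := Nat.exists_eq_add_of_le a2
  exact hy ((hconst d2 b2).2 ((hconst d1 b1).1 hx))

theorem GPoly.chord {V : Type*} [DecidableEq V] {G : SimpleGraph V} {n : ℕ} {g : ℕ → V}
    (P : GPoly G n g) (i j : ℕ) (hij : i + 2 ≤ j) (hj : j < n) (hne : ¬ (i = 0 ∧ j = n - 1))
    (hadj : G.Adj (g i) (g j)) {v : V} (p : G.Walk v v) (hp : p.IsHamiltonianCycle) :
    s(g i, g j) ∉ p.edges := by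
  intro hmem
  obtain ⟨y, hyn, hy⟩ : ∃ y, y < n ∧ (y < i ∨ j < y) := by
    by_cases h0 : i = 0
    · exact ⟨n - 1, by omega, by omega⟩
    · exact ⟨0, by omega, by omega⟩
  refine ham_chord p hp hmem {w | ∃ k, i < k ∧ k < j ∧ g k = w} ?_ ?_ (x := g (i + 1)) (y := g y)
    ⟨i + 1, by omega, by omega, rfl⟩ ?_ ?_ ?_ ?_
  · rintro ⟨k, h1, h2, h3⟩
    have := P.inj _ _ (by omega) (by omega) h3
    omega
  · rintro ⟨k, h1, h2, h3⟩
    have := P.inj _ _ (by omega) (by omega) h3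
    omega
  · rintro ⟨k, h1, h2, h3⟩
    have := P.inj _ _ (by omega) (by omega) h3
    omega
  · intro h3
    have := P.inj _ _ (by omega) (by omega) h3
    omega
  · intro h3
    have := P.inj _ _ (by omega) (by omega) h3
    omega
  · rintro u w ⟨k, h1, h2, rfl⟩ hkw
    obtain ⟨l, hl, rfl⟩ := P.surj w
    rcases lt_trichotomy l i with h | rfl | h
    · exact (P.nc l i k j h h1 h2 hj hkw.symm hadj).elim
    · right; left; rfl
    · rcases lt_trichotomy l j with h' | rfl | h'
      · left; exact ⟨l, h, h', rfl⟩
      · right; right; rfl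
      · exact (P.nc i k j l h1 h2 h' hl hadj hkw).elim

theorem GPoly.strip {V : Type*} [DecidableEq V] {G : SimpleGraph V} {n : ℕ} {g : ℕ → V}
    (P : GPoly G n g) (hstriped : ∀ T : Finset V, ¬ IsInternalTriangle G T)
    (i j : ℕ) (hij : i + 2 ≤ j) (hj : j < n) (hadj : G.Adj (g i) (g j)) :
    G.Adj (g (i + 1)) (g j) ∨ G.Adj (g i) (g (j - 1)) := by
  obtain ⟨k, h1, h2, h3, h4⟩ := P.third i j hij hj hadj
  by_cases hk1 : k = i + 1
  · subst hk1; exact Or.inl h4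
  by_cases hk2 : k = j - 1
  · subst hk2; exact Or.inr h3
  exfalso
  by_cases hend : i = 0 ∧ j = n - 1
  · obtain ⟨rfl, rfl⟩ := hend
    have hs := P.succ 0 (by omega)
    rcases P.deg _ _ _ hs h3 hadj with h | h | h
    · have := P.inj _ _ (by omega) (by omega) h
      omega
    · have := P.inj _ _ (by omega) (by omega) h
      omega
    · have := P.inj _ _ (by omega) (by omega) h
      omega
  · refine hstriped _ ⟨g i, g k, g j, rfl, h3.ne, hadj.ne, h4.ne, h3, hadj, h4, ?_⟩
    intro v p hp
    exact ⟨P.chord i k (by omega) (by omega) (by omega) h3 p hp,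
      P.chord i j hij hj hend hadj p hp,
      P.chord k j (by omega) hj (by omega) h4 p hp⟩

inductive Rest {V : Type*} [Fintype V] [DecidableEq V] (G : SimpleGraph V) :
    Finset V → V → V → Prop
  | done (x y : V) : Rest G Finset.univ x y
  | step {s : Finset V} {x y : V} (z e : V) : z ∉ s → G.Adj z x → G.Adj z y → (e = x ∨ e = y) →
      Rest G (insert z s) e z → Rest G s x y

theorem Rest.next {V : Type*} [Fintype V] [DecidableEq V] {G : SimpleGraph V} {s : Finset V}
    {x y : V} (h : Rest G s x y) (hs : s.card < Fintype.card V) :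
    ∃ z e, z ∉ s ∧ G.Adj z x ∧ G.Adj z y ∧ (e = x ∨ e = y) ∧ Rest G (insert z s) e z := by
  cases h with
  | done => simp at hs
  | step z e h1 h2 h3 h4 h5 => exact ⟨z, e, h1, h2, h3, h4, h5⟩

theorem Rest.swap {V : Type*} [Fintype V] [DecidableEq V] {G : SimpleGraph V} {s : Finset V}
    {x y : V} (h : Rest G s x y) : Rest G s y x := by
  cases h with
  | done => exact Rest.done _ _
  | step z e h1 h2 h3 h4 h5 => exact Rest.step z e h1 h3 h2 h4.symm h5

theorem GPoly.rest {V : Type*} [Fintype V] [DecidableEq V] {G : SimpleGraph V} {g : ℕ → V}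
    {n : ℕ} (P : GPoly G n g) (hstriped : ∀ T : Finset V, ¬ IsInternalTriangle G T) :
    ∀ d i j, j = i + 1 + d → j < n → G.Adj (g i) (g j) → ∀ s : Finset V,
      (∀ k, k < n → (g k ∈ s ↔ k ≤ i ∨ j ≤ k)) → Rest G s (g i) (g j) := by
  intro d
  induction d with
  | zero =>
    intro i j hij hj hadj s hs
    have : s = Finset.univ := by
      ext v
      obtain ⟨k, hk, rfl⟩ := P.surj v
      simp only [hs k hk, Finset.mem_univ, iff_true]
      omega
    subst this
    exact Rest.done _ _
  | succ d ih =>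
    intro i j hij hj hadj s hs
    rcases P.strip hstriped i j (by omega) hj hadj with h | h
    · refine Rest.step (g (i + 1)) (g j) ?_ (P.succ i (by omega)).symm h (Or.inr rfl) (Rest.swap ?_)
      · rw [hs _ (by omega)]; omega
      · refine ih (i + 1) j (by omega) hj h _ ?_
        intro k hk
        rw [Finset.mem_insert, hs k hk]
        constructor
        · rintro (h' | h')
          · have := P.inj _ _ hk (by omega) h'
            omega
          · omega
        · intro h'
          by_cases hki : k = i + 1
          · left; rw [hki]
          · right; omega
    · have hsj := P.succ (j - 1) (by omega)
      rw [Nat.sub_add_cancel (by omega)] at hsj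
      refine Rest.step (g (j - 1)) (g i) ?_ h.symm hsj (Or.inl rfl) ?_
      · rw [hs _ (by omega)]; omega
      · refine ih i (j - 1) (by omega) (by omega) h _ ?_
        intro k hk
        rw [Finset.mem_insert, hs k hk]
        constructor
        · rintro (h' | h')
          · have := P.inj _ _ hk (by omega) h'
            omega
          · omega
        · intro h'
          by_cases hki : k = j - 1
          · left; rw [hki]
          · right; omega

def Dom2 {V : Type*} (G : SimpleGraph V) (S : Finset V) (v : V) : Prop :=
  ∃ p ∈ S, ∃ q ∈ S, p ≠ q ∧ (p = v ∨ G.Adj v p) ∧ (q = v ∨ G.Adj v q)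

theorem Dom2.mono {V : Type*} {G : SimpleGraph V} {S S' : Finset V} {v : V} (h : Dom2 G S v)
    (hS : S ⊆ S') : Dom2 G S' v := by
  obtain ⟨p, hp, q, hq, h⟩ := h
  exact ⟨p, hS hp, q, hS hq, h⟩

theorem dp_bound {V : Type*} [Fintype V] [DecidableEq V] {G : SimpleGraph V} :
    ∀ (N : ℕ) (s : Finset V) (x y : V) (S : Finset V), Rest G s x y →
      s.card + 2 * N = Fintype.card V → x ≠ y → x ∈ s → y ∈ s → x ∈ S → y ∈ S →
      (∀ v ∈ s, Dom2 G S v) →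
      ∃ S' : Finset V, S'.card ≤ S.card + N ∧ ∀ v, Dom2 G S' v := by
  intro N
  induction N using Nat.strong_induction_on with
  | _ N IH =>
  intro s x y S hR hcard hxy hxs hys hx hy hdom
  rcases Nat.eq_zero_or_pos N with rfl | hN
  · have : s = Finset.univ := (Finset.card_eq_iff_eq_univ s).1 (by omega)
    subst this
    exact ⟨S, by omega, fun v => hdom v (Finset.mem_univ v)⟩
  have main : ∀ x y z : V, x ≠ y → x ∈ s → x ∈ S → y ∈ S → z ∉ s → G.Adj z x →
      G.Adj z y → Rest G (insert z s) x z →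
      ∃ S' : Finset V, S'.card ≤ S.card + N ∧ ∀ v, Dom2 G S' v := by
    intro x y z hxy hxs hx hy hz hzx hzy hR
    have c1 : (insert z s).card = s.card + 1 := Finset.card_insert_of_notMem hz
    have dz : Dom2 G S z := ⟨x, hx, y, hy, hxy, Or.inr hzx, Or.inr hzy⟩
    obtain ⟨w, e, hw, hwx, hwz, he, hR2⟩ := hR.next (by omega)
    have c2 : (insert w (insert z s)).card = s.card + 2 := by
      rw [Finset.card_insert_of_notMem hw, c1]
    have hSw : (insert w S).card ≤ S.card + 1 := Finset.card_insert_le _ _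
    have hwx' : w ≠ x := by rintro rfl; exact hw (Finset.mem_insert_of_mem hxs)
    have hdomw : ∀ v ∈ insert w (insert z s), Dom2 G (insert w S) v := by
      intro v hv
      rw [Finset.mem_insert, Finset.mem_insert] at hv
      rcases hv with rfl | rfl | hv
      · exact ⟨v, Finset.mem_insert_self _ _, x, Finset.mem_insert_of_mem hx, hwx', Or.inl rfl,
          Or.inr hwx⟩
      · exact dz.mono (Finset.subset_insert _ _)
      · exact (hdom v hv).mono (Finset.subset_insert _ _)
    rcases he with rfl | rfl
    · obtain ⟨S', h1, h2⟩ := IH (N - 1) (by omega) _ e w (insert w S) hR2 (by omega) hwx'.symm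
        (by simp [hxs]) (by simp) (by simp [hx]) (by simp) hdomw
      exact ⟨S', by omega, h2⟩
    · by_cases hN1 : N = 1
      · have : insert w (insert e s) = Finset.univ := (Finset.card_eq_iff_eq_univ _).1 (by omega)
        exact ⟨insert w S, by omega, fun v => hdomw v (this ▸ Finset.mem_univ v)⟩
      obtain ⟨u, f, hu, hue, huw, hf, hR3⟩ := hR2.next (by omega)
      have c3 : (insert u (insert w (insert e s))).card = s.card + 3 := by
        rw [Finset.card_insert_of_notMem hu, c2]
      obtain ⟨t, k, ht, htf, htu, hk, hR4⟩ := hR3.next (by omega)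
      have c4 : (insert t (insert u (insert w (insert e s)))).card = s.card + 4 := by
        rw [Finset.card_insert_of_notMem ht, c3]
      have hkt : G.Adj t k := by rcases hk with rfl | rfl <;> assumption
      have hku : k = u ∨ G.Adj u k := by
        rcases hk with rfl | rfl
        · right; rcases hf with rfl | rfl <;> assumption
        · exact Or.inl rfl
      have hkw : k = w ∨ G.Adj w k := by
        rcases hk with rfl | rfl
        · rcases hf with rfl | rfl
          · exact Or.inr hwz
          · exact Or.inl rfl
        · exact Or.inr huw.symm
      have hkmem : k ∈ insert u (insert w (insert e s)) := by
        rcases hk with rfl | rfl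
        · rcases hf with rfl | rfl <;> simp
        · simp
      have hks : k ∉ s := by
        rcases hk with rfl | rfl
        · rcases hf with rfl | rfl
          · exact hz
          · exact fun h => hw (Finset.mem_insert_of_mem h)
        · exact fun h => hu (Finset.mem_insert_of_mem (Finset.mem_insert_of_mem h))
      have hkx : k ≠ x := by rintro rfl; exact hks hxs
      have hsub : S ⊆ insert t (insert k S) :=
        (Finset.subset_insert _ _).trans (Finset.subset_insert _ _)
      have hcS : (insert t (insert k S)).card ≤ S.card + 2 := by
        have h1 := Finset.card_insert_le t (insert k S)
        have h2 := Finset.card_insert_le k S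
        omega
      obtain ⟨S', h1, h2⟩ := IH (N - 2) (by omega) _ k t (insert t (insert k S)) hR4 (by omega)
        hkt.ne' (Finset.mem_insert_of_mem hkmem) (by simp) (by simp) (by simp) (by
          intro v hv
          rw [Finset.mem_insert, Finset.mem_insert, Finset.mem_insert, Finset.mem_insert] at hv
          rcases hv with rfl | rfl | rfl | rfl | hv
          · exact ⟨v, by simp, k, by simp, hkt.ne, Or.inl rfl, Or.inr hkt⟩
          · exact ⟨t, by simp, k, by simp, hkt.ne, Or.inr htu.symm, hku⟩
          · exact ⟨k, by simp, x, by simp [hx], hkx, hkw, Or.inr hwx⟩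
          · exact dz.mono hsub
          · exact (hdom v hv).mono hsub)
      exact ⟨S', by omega, h2⟩
  obtain ⟨z, e, hz, hzx, hzy, he, hR1⟩ := hR.next (by omega)
  rcases he with rfl | rfl
  · exact main e y z hxy hxs hx hy hz hzx hzy hR1
  · exact main e x z hxy.symm hys hy hx hz hzy hzx hR1

theorem start_bound {V : Type*} [Fintype V] [DecidableEq V] {G : SimpleGraph V} {x y : V}
    (hadj : G.Adj x y) (hR : Rest G {x, y} x y) (hn : 3 ≤ Fintype.card V) :
    ∃ S : Finset V, S.card ≤ Fintype.card V / 2 + 1 ∧ ∀ v, Dom2 G S v := by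
  have c0 : ({x, y} : Finset V).card = 2 := Finset.card_pair hadj.ne
  rcases Nat.even_or_odd' (Fintype.card V) with ⟨m, hm | hm⟩
  · obtain ⟨S', h1, h2⟩ := dp_bound (m - 1) {x, y} x y {x, y} hR (by omega) hadj.ne (by simp)
      (by simp) (by simp) (by simp) (by
        intro v hv
        rw [Finset.mem_insert, Finset.mem_singleton] at hv
        rcases hv with rfl | rfl
        · exact ⟨v, by simp, y, by simp, hadj.ne, Or.inl rfl, Or.inr hadj⟩
        · exact ⟨v, by simp, x, by simp, hadj.ne', Or.inl rfl, Or.inr hadj.symm⟩)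
    exact ⟨S', by omega, h2⟩
  · obtain ⟨z, e, hz, hzx, hzy, he, hR⟩ := hR.next (by omega)
    have c1 : (insert z {x, y} : Finset V).card = 3 := by
      rw [Finset.card_insert_of_notMem hz, c0]
    have hze : G.Adj z e := by rcases he with rfl | rfl <;> assumption
    have hxe : e = x ∨ G.Adj x e := by
      rcases he with rfl | rfl
      · exact Or.inl rfl
      · exact Or.inr hadj
    have hye : e = y ∨ G.Adj y e := by
      rcases he with rfl | rfl
      · exact Or.inr hadj.symm
      · exact Or.inl rfl
    have c2 : ({e, z} : Finset V).card = 2 := Finset.card_pair hze.ne'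
    obtain ⟨S', h1, h2⟩ := dp_bound (m - 1) (insert z {x, y}) e z {e, z} hR (by omega) hze.ne'
      (by rcases he with rfl | rfl <;> simp) (by simp) (by simp) (by simp) (by
        intro v hv
        rw [Finset.mem_insert, Finset.mem_insert, Finset.mem_singleton] at hv
        rcases hv with rfl | rfl | rfl
        · exact ⟨v, by simp, e, by simp, hze.ne, Or.inl rfl, Or.inr hze⟩
        · exact ⟨z, by simp, e, by simp, hze.ne, Or.inr hzx.symm, hxe⟩
        · exact ⟨z, by simp, e, by simp, hze.ne, Or.inr hzy.symm, hye⟩)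
    exact ⟨S', by omega, h2⟩

/-- A striped maximal outerplanar graph (no internal triangles)
on `n ≥ 3` vertices satisfies `γ×2(G) ≤ ⌊n/2⌋ + 1`. -/
theorem doubleDomNum_le_of_striped {V : Type*} [Fintype V] [DecidableEq V]
    (G : SimpleGraph V) [DecidableRel G.Adj] (h : MaximalOuterplanar G)
    (hstriped : ∀ T : Finset V, ¬ IsInternalTriangle G T)
    (hn : 3 ≤ Fintype.card V) :
    doubleDomNum G ≤ Fintype.card V / 2 + 1 := by
  obtain ⟨g, P⟩ := exists_poly h hn
  have hends := P.ends hn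
  have hR : Rest G {g 0, g (Fintype.card V - 1)} (g 0) (g (Fintype.card V - 1)) := by
    refine P.rest hstriped (Fintype.card V - 2) 0 _ (by omega) (by omega) hends _ ?_
    intro k hk
    rw [Finset.mem_insert, Finset.mem_singleton]
    constructor
    · rintro (h' | h')
      · have := P.inj _ _ hk (by omega) h'
        omega
      · have := P.inj _ _ hk (by omega) h'
        omega
    · rintro (h' | h')
      · left; rw [Nat.le_zero.1 h']
      · right; rw [show k = Fintype.card V - 1 by omega]
  obtain ⟨S, hS, hdom⟩ := start_bound hends hR hn
  refine le_trans (Nat.sInf_le ⟨S, ?_, rfl⟩) hS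
  intro v
  obtain ⟨p, hp, q, hq, hpq, hpv, hqv⟩ := hdom v
  rw [← Finset.card_pair hpq]
  apply Finset.card_le_card
  intro u hu
  rw [Finset.mem_insert, Finset.mem_singleton] at hu
  rw [Finset.mem_inter, Finset.mem_insert, SimpleGraph.mem_neighborFinset]
  rcases hu with rfl | rfl
  · exact ⟨hp, hpv⟩
  · exact ⟨hq, hqv⟩
end

section
/- There exist striped maximal outerplanar graphs G of arbitrarily large order n (with n ≡ 2 mod 4) such that γ×2(G) = n/2 + 1; in particular the bound γ×2(G) ≤ ⌊n/2⌋ + 1 for striped maximal outerplanar graphs is tight. -/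
open SimpleGraph

/-! ### Non-crossing connected sets -/

/-- No two edges cross with respect to the natural order. -/
def NonCross {n : ℕ} (G : SimpleGraph (Fin n)) : Prop :=
  ∀ p q r s : Fin n, p < q → q < r → r < s → G.Adj p r → G.Adj q s → False

theorem exists_boundary_edge {V : Type*} {G : SimpleGraph V} {A : Set V}
    (hA : (G.induce A).Connected) (S : Set V) {a c : V} (ha : a ∈ A) (hc : c ∈ A)
    (haS : a ∈ S) (hcS : c ∉ S) :
    ∃ x ∈ A, ∃ y ∈ A, G.Adj x y ∧ x ∈ S ∧ y ∉ S := by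
  obtain ⟨w⟩ := hA.preconnected ⟨a, ha⟩ ⟨c, hc⟩
  obtain ⟨d, -, h1, h2⟩ := w.exists_boundary_dart (Subtype.val ⁻¹' S) haS hcS
  exact ⟨d.fst, d.fst.2, d.snd, d.snd.2, d.adj, h1, h2⟩

theorem noncross_sets {n : ℕ} {G : SimpleGraph (Fin n)} (hG : NonCross G)
    {A B : Set (Fin n)} (hA : (G.induce A).Connected) (hB : (G.induce B).Connected)
    (hAB : Disjoint A B) {a b c d : Fin n} (ha : a ∈ A) (hc : c ∈ A) (hb : b ∈ B) (hd : d ∈ B)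
    (hab : a < b) (hbc : b < c) (hcd : c < d) : False := by
  rw [Set.disjoint_left] at hAB
  obtain ⟨x, hx, y, hy, hxy, hxS, hyS⟩ := exists_boundary_edge hA {z | b < z ∧ z < d} hc ha
    ⟨hbc, hcd⟩ (by simp only [Set.mem_ofPred_eq]; omega)
  have hyb : y ≠ b := fun h => hAB hy (h ▸ hb)
  have hyd : y ≠ d := fun h => hAB hy (h ▸ hd)
  simp only [Set.mem_ofPred_eq] at hxS hyS
  rcases lt_or_ge y b with h | h
  · -- y < b < x < d
    obtain ⟨u, hu, v, hv, huv, huS, hvS⟩ := exists_boundary_edge hB {z | y < z ∧ z < x} hb hd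
      ⟨h, hxS.1⟩ (by simp only [Set.mem_ofPred_eq]; omega)
    have h1 : v ≠ y := fun h => hAB hy (h ▸ hv)
    have h2 : v ≠ x := fun h => hAB hx (h ▸ hv)
    simp only [Set.mem_ofPred_eq] at huS hvS
    rcases lt_or_ge v y with h' | h'
    · exact hG v y u x h' huS.1 huS.2 huv.symm hxy.symm
    · exact hG y u x v huS.1 huS.2 (by omega) hxy.symm huv
  · -- b < x < d < y
    obtain ⟨u, hu, v, hv, huv, huS, hvS⟩ := exists_boundary_edge hB {z | x < z ∧ z < y} hd hb
      ⟨hxS.2, by omega⟩ (by simp only [Set.mem_ofPred_eq]; omega)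
    have h1 : v ≠ y := fun h => hAB hy (h ▸ hv)
    have h2 : v ≠ x := fun h => hAB hx (h ▸ hv)
    simp only [Set.mem_ofPred_eq] at huS hvS
    rcases lt_or_ge v x with h' | h'
    · exact hG v x u y h' huS.1 huS.2 huv.symm hxy
    · exact hG x u y v huS.1 huS.2 (by omega) hxy huv

theorem outerplanar_of_nonCross {n : ℕ} {G : SimpleGraph (Fin n)} (hG : NonCross G) :
    Outerplanar G := by
  have key : ∀ {W : Type} (H : SimpleGraph W) (f : W → Set (Fin n)),
      (∀ w, (G.induce (f w)).Connected) →
      (Pairwise fun w₁ w₂ => Disjoint (f w₁) (f w₂)) →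
      (∀ ⦃w₁ w₂⦄, H.Adj w₁ w₂ → ∃ a ∈ f w₁, ∃ b ∈ f w₂, G.Adj a b) →
      ∀ r : W → Fin n, (∀ w, r w ∈ f w) → ∀ i j k l : W, H.Adj i k → H.Adj j l →
        i ≠ j → i ≠ l → k ≠ j → k ≠ l → ¬ (r i < r j ∧ r j < r k ∧ r k < r l) := by
    intro W H f hc hd ha r hr i j k l hik hjl h1 h2 h3 h4 ⟨h5, h6, h7⟩
    obtain ⟨a, ha1, b, hb1, hab⟩ := ha hik
    obtain ⟨a', ha1', b', hb1', hab'⟩ := ha hjl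
    refine noncross_sets hG
      (connected_induce_union (hc i).preconnected (hc k).preconnected ha1 hb1 hab)
      (connected_induce_union (hc j).preconnected (hc l).preconnected ha1' hb1' hab')
      ?_ (Or.inl (hr i)) (Or.inr (hr k)) (Or.inl (hr j)) (Or.inr (hr l)) h5 h6 h7
    rw [Set.disjoint_union_left, Set.disjoint_union_right, Set.disjoint_union_right]
    exact ⟨⟨hd h1, hd h2⟩, hd h3, hd h4⟩
  have inj : ∀ {W : Type} (f : W → Set (Fin n)),
      (Pairwise fun w₁ w₂ => Disjoint (f w₁) (f w₂)) →
      ∀ r : W → Fin n, (∀ w, r w ∈ f w) → ∀ i j, i ≠ j → r i ≠ r j := by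
    intro W f hd r hr i j hij h
    exact Set.disjoint_left.1 (hd hij) (hr i) (h ▸ hr j)
  constructor
  · rintro ⟨f, hn, hc, hd, ha⟩
    choose r hr using hn
    have K := key _ f hc hd ha r hr
    have I := inj f hd r hr
    have i01 := I 0 1 (by decide)
    have i02 := I 0 2 (by decide)
    have i03 := I 0 3 (by decide)
    have i12 := I 1 2 (by decide)
    have i13 := I 1 3 (by decide)
    have i23 := I 2 3 (by decide)
    have K' : ∀ i j k l : Fin 4, i ≠ k → j ≠ l → i ≠ j → i ≠ l → k ≠ j → k ≠ l →
      ¬ (r i < r j ∧ r j < r k ∧ r k < r l) := fun i j k l h1 h2 => K i j k l h1 h2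
    clear K I
    -- sort the four representatives
    obtain ⟨σ, hσ⟩ : ∃ σ : Equiv.Perm (Fin 4), Monotone (r ∘ σ) := ⟨Tuple.sort r, Tuple.monotone_sort r⟩
    have hinj := inj f hd r hr
    have s : ∀ i j : Fin 4, i < j → r (σ i) < r (σ j) := fun i j hij =>
      lt_of_le_of_ne (hσ hij.le) (hinj _ _ (fun h => hij.ne (σ.injective h)))
    have ne : ∀ i j : Fin 4, i ≠ j → σ i ≠ σ j := fun i j h h' => h (σ.injective h')
    exact K' (σ 0) (σ 1) (σ 2) (σ 3) (ne _ _ (by decide)) (ne _ _ (by decide)) (ne _ _ (by decide))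
      (ne _ _ (by decide)) (ne _ _ (by decide)) (ne _ _ (by decide))
      ⟨s _ _ (by decide), s _ _ (by decide), s _ _ (by decide)⟩
  · rintro ⟨f, hn, hc, hd, ha⟩
    choose r hr using hn
    have K := key _ f hc hd ha r hr
    have I := inj f hd r hr
    -- four consequences per pair of `Y` classes
    have L : ∀ x x' : Fin 2, ∀ y y' : Fin 3, x ≠ x' → y ≠ y' →
        ¬ (r (.inl x) < r (.inr y) ∧ r (.inr y) < r (.inr y') ∧ r (.inr y') < r (.inl x')) ∧
        ¬ (r (.inr y) < r (.inr y') ∧ r (.inr y') < r (.inl x) ∧ r (.inl x) < r (.inl x')) ∧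
        ¬ (r (.inr y) < r (.inl x) ∧ r (.inl x) < r (.inl x') ∧ r (.inl x') < r (.inr y')) ∧
        ¬ (r (.inl x) < r (.inl x') ∧ r (.inl x') < r (.inr y) ∧ r (.inr y) < r (.inr y')) := by
      intro x x' y y' hx hy
      refine ⟨K _ _ _ _ ?_ ?_ ?_ ?_ ?_ ?_, K _ _ _ _ ?_ ?_ ?_ ?_ ?_ ?_, K _ _ _ _ ?_ ?_ ?_ ?_ ?_ ?_,
        K _ _ _ _ ?_ ?_ ?_ ?_ ?_ ?_⟩ <;> simp [hx, hy, hx.symm, hy.symm]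
    have D : ∀ x : Fin 2, ∀ y : Fin 3, r (.inl x) ≠ r (.inr y) := fun x y => I _ _ (by simp)
    have D2 : r (.inl 0) ≠ r (.inl 1) := I _ _ (by simp)
    have D3 : ∀ y y' : Fin 3, y ≠ y' → r (.inr y) ≠ r (.inr y') := fun y y' h =>
      I _ _ (by simpa using h)
    obtain ⟨x, x', hx, hlt⟩ : ∃ x x' : Fin 2, x ≠ x' ∧ r (.inl x) < r (.inl x') := by
      rcases lt_or_gt_of_ne D2 with h | h
      · exact ⟨0, 1, by decide, h⟩
      · exact ⟨1, 0, by decide, h⟩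
    -- pigeonhole: two of the three lie on the same side
    obtain ⟨y, y', hy, hside⟩ : ∃ y y' : Fin 3, y ≠ y' ∧
        ((r (.inl x) < r (.inr y) ∧ r (.inr y) < r (.inl x')) ↔
          (r (.inl x) < r (.inr y') ∧ r (.inr y') < r (.inl x'))) := by
      have pig : ∀ P : Fin 3 → Prop, ∃ y y' : Fin 3, y ≠ y' ∧ (P y ↔ P y') := by
        intro P
        by_cases h01 : P 0 ↔ P 1
        · exact ⟨0, 1, by decide, h01⟩
        by_cases h02 : P 0 ↔ P 2
        · exact ⟨0, 2, by decide, h02⟩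
        refine ⟨1, 2, by decide, ?_⟩
        clear * - h01 h02
        tauto
      exact pig fun y => r (.inl x) < r (.inr y) ∧ r (.inr y) < r (.inl x')
    have l1 := L x x' y y' hx hy
    have l2 := L x x' y' y hx hy.symm
    have d1 := D x y
    have d2 := D x y'
    have d3 := D x' y
    have d4 := D x' y'
    have d5 := D3 y y' hy
    generalize r (.inl x) = p at *
    generalize r (.inl x') = p' at *
    generalize r (.inr y) = q at *
    generalize r (.inr y') = q' at *
    clear K I L D D2 D3 hc hd ha hr key inj
    omega

/-! ### Maximality -/

theorem interval_connected {n : ℕ} {G : SimpleGraph (Fin n)}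
    (hpath : ∀ i j : Fin n, i.val + 1 = j.val → G.Adj i j) (a b : ℕ) (hab : a < b) (hb : b ≤ n) :
    (G.induce {z : Fin n | a ≤ z.val ∧ z.val < b}).Connected := by
  have hn : Nonempty {z : Fin n | a ≤ z.val ∧ z.val < b} :=
    ⟨⟨⟨a, by omega⟩, by simp [hab]⟩⟩
  rw [connected_iff_exists_forall_reachable]
  refine ⟨⟨⟨a, by omega⟩, by simp [hab]⟩, ?_⟩
  have : ∀ k : ℕ, ∀ h : a + k < b, (G.induce {z : Fin n | a ≤ z.val ∧ z.val < b}).Reachable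
      ⟨⟨a, by omega⟩, by simp [hab]⟩ ⟨⟨a + k, by omega⟩, by simp [h]⟩ := by
    intro k
    induction k with
    | zero => intro h; exact Reachable.refl _
    | succ k ih =>
      intro h
      refine (ih (by omega)).trans (Adj.reachable ?_)
      exact hpath _ _ (by simp; omega)
  rintro ⟨⟨z, hz⟩, hz1, hz2⟩
  have := this (z - a) (by simp at hz1 hz2; omega)
  convert this using 3
  simp at hz1; omega

theorem k4_minor_of_cross {n : ℕ} {G : SimpleGraph (Fin n)}
    (hpath : ∀ i j : Fin n, i.val + 1 = j.val → G.Adj i j)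
    (hclose : ∀ i j : Fin n, i.val = 0 → j.val + 1 = n → G.Adj i j)
    {p q r s : Fin n} (hpq : p < q) (hqr : q < r) (hrs : r < s) (hpr : G.Adj p r)
    (hqs : G.Adj q s) : HasMinor G (⊤ : SimpleGraph (Fin 4)) := by
  have hn : 0 < n := by omega
  have last : (G.induce ({z : Fin n | s.val ≤ z.val ∧ z.val < n} ∪
      {z : Fin n | z.val < p.val})).Connected := by
    by_cases hp : p.val = 0
    · have : {z : Fin n | z.val < p.val} = ∅ := by ext z; simp [hp]
      rw [this, Set.union_empty]
      exact interval_connected hpath _ _ s.2 le_rfl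
    · have h2 := interval_connected hpath 0 p.val (by omega) (by omega)
      have e : {z : Fin n | z.val < p.val} = {z : Fin n | 0 ≤ z.val ∧ z.val < p.val} := by
        ext z; simp
      rw [e]
      refine connected_induce_union (v := ⟨n-1, by omega⟩) (w := ⟨0, hn⟩)
        (interval_connected hpath _ _ s.2 le_rfl).preconnected h2.preconnected ?_ ?_ ?_
      · simp only [Set.mem_ofPred_eq]; omega
      · simp only [Set.mem_ofPred_eq]; omega
      · exact (hclose _ _ rfl (by simp only; omega)).symm
  let f : Fin 4 → Set (Fin n) := ![{z | p.val ≤ z.val ∧ z.val < q.val},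
    {z | q.val ≤ z.val ∧ z.val < r.val}, {z | r.val ≤ z.val ∧ z.val < s.val},
    {z : Fin n | s.val ≤ z.val ∧ z.val < n} ∪ {z : Fin n | z.val < p.val}]
  have hcon : ∀ w, (G.induce (f w)).Connected := by
    intro w
    fin_cases w
    · exact interval_connected hpath _ _ hpq (by omega)
    · exact interval_connected hpath _ _ hqr (by omega)
    · exact interval_connected hpath _ _ hrs (by omega)
    · exact last
  have f0 : ∀ z, z ∈ f 0 ↔ p.val ≤ z.val ∧ z.val < q.val := fun z => Iff.rfl
  have f1 : ∀ z, z ∈ f 1 ↔ q.val ≤ z.val ∧ z.val < r.val := fun z => Iff.rfl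
  have f2 : ∀ z, z ∈ f 2 ↔ r.val ≤ z.val ∧ z.val < s.val := fun z => Iff.rfl
  have f3 : ∀ z, z ∈ f 3 ↔ (s.val ≤ z.val ∧ z.val < n) ∨ z.val < p.val := fun z => Iff.rfl
  have hadj : ∀ w₁ w₂ : Fin 4, w₁ < w₂ → ∃ a ∈ f w₁, ∃ b ∈ f w₂, G.Adj a b := by
    have e01 : ∃ a ∈ f 0, ∃ b ∈ f 1, G.Adj a b :=
      ⟨⟨q.val - 1, by omega⟩, (f0 _).2 (by dsimp only; omega), q, (f1 _).2 (by omega),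
        hpath _ _ (by simp only; omega)⟩
    have e12 : ∃ a ∈ f 1, ∃ b ∈ f 2, G.Adj a b :=
      ⟨⟨r.val - 1, by omega⟩, (f1 _).2 (by dsimp only; omega), r, (f2 _).2 (by omega),
        hpath _ _ (by simp only; omega)⟩
    have e23 : ∃ a ∈ f 2, ∃ b ∈ f 3, G.Adj a b :=
      ⟨⟨s.val - 1, by omega⟩, (f2 _).2 (by dsimp only; omega), s, (f3 _).2 (by omega),
        hpath _ _ (by simp only; omega)⟩
    have e02 : ∃ a ∈ f 0, ∃ b ∈ f 2, G.Adj a b :=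
      ⟨p, (f0 _).2 (by omega), r, (f2 _).2 (by omega), hpr⟩
    have e13 : ∃ a ∈ f 1, ∃ b ∈ f 3, G.Adj a b :=
      ⟨q, (f1 _).2 (by omega), s, (f3 _).2 (by omega), hqs⟩
    have e03 : ∃ a ∈ f 0, ∃ b ∈ f 3, G.Adj a b := by
      by_cases hp : p.val = 0
      · exact ⟨p, (f0 _).2 (by omega), ⟨n - 1, by omega⟩, (f3 _).2 (by dsimp only; omega),
          hclose _ _ hp (by simp only; omega)⟩
      · exact ⟨p, (f0 _).2 (by omega), ⟨p.val - 1, by omega⟩, (f3 _).2 (by dsimp only; omega),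
          (hpath _ _ (by simp only; omega)).symm⟩
    intro w₁ w₂ h
    fin_cases w₁ <;> fin_cases w₂ <;> first | (exfalso; revert h; decide) | assumption
  have hdis : ∀ w₁ w₂ : Fin 4, w₁ < w₂ → Disjoint (f w₁) (f w₂) := by
    intro w₁ w₂ h
    rw [Set.disjoint_left]
    intro z
    fin_cases w₁ <;> fin_cases w₂ <;> first
      | (exfalso; revert h; decide)
      | (simp [f]; omega)
  refine ⟨f, fun w => Set.nonempty_coe_sort.1 (hcon w).nonempty, hcon, ?_, ?_⟩
  · intro w₁ w₂ h
    rcases lt_or_gt_of_ne h with h | h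
    · exact hdis _ _ h
    · exact (hdis _ _ h).symm
  · intro w₁ w₂ h
    rcases lt_or_gt_of_ne h.ne with h | h
    · exact hadj _ _ h
    · obtain ⟨a, ha, b, hb, hab⟩ := hadj _ _ h
      exact ⟨b, hb, a, ha, hab.symm⟩

theorem maximalOuterplanar_of {n : ℕ} {G : SimpleGraph (Fin n)} (hG : NonCross G)
    (hpath : ∀ i j : Fin n, i.val + 1 = j.val → G.Adj i j)
    (hclose : ∀ i j : Fin n, i.val = 0 → j.val + 1 = n → G.Adj i j)
    (hmax : ∀ u v : Fin n, u < v → ¬ G.Adj u v →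
      ∃ x y : Fin n, G.Adj x y ∧ u < x ∧ x < v ∧ (y < u ∨ v < y)) : MaximalOuterplanar G := by
  refine ⟨outerplanar_of_nonCross hG, ?_⟩
  have main : ∀ u v : Fin n, u < v → ¬ G.Adj u v →
      ¬ Outerplanar (G ⊔ SimpleGraph.fromEdgeSet {s(u, v)}) := by
    intro u v huv hna ho
    obtain ⟨x, y, hxy, hux, hxv, hy⟩ := hmax u v huv hna
    have le : G ≤ G ⊔ SimpleGraph.fromEdgeSet {s(u, v)} := le_sup_left
    have huv' : (G ⊔ SimpleGraph.fromEdgeSet {s(u, v)}).Adj u v := by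
      simp [huv.ne]
    have hp := fun i j h => le (hpath i j h)
    have hc := fun i j h h' => le (hclose i j h h')
    rcases hy with hy | hy
    · exact ho.1 (k4_minor_of_cross hp hc hy hux hxv (le hxy.symm) huv')
    · exact ho.1 (k4_minor_of_cross hp hc hux hxv hy huv' (le hxy))
  intro u v huv hna
  rcases lt_or_gt_of_ne huv with h | h
  · exact main u v h hna
  · rw [Sym2.eq_swap]
    exact main v u h (fun h' => hna h'.symm)

/-! ### The Hamiltonian cycle -/

theorem exists_hamiltonian {k : ℕ} {G : SimpleGraph (Fin (k + 3))}
    (hpath : ∀ i j : Fin (k + 3), i.val + 1 = j.val → G.Adj i j)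
    (hclose : ∀ i j : Fin (k + 3), i.val = 0 → j.val + 1 = k + 3 → G.Adj i j) :
    ∃ p : G.Walk 0 0, p.IsHamiltonianCycle ∧
      ∀ i j : Fin (k + 3), (i.val + 1 = j.val ∨ (i.val = 0 ∧ j.val + 1 = k + 3)) →
        s(i, j) ∈ p.edges := by
  have le : cycleGraph (k + 3) ≤ G := by
    have : ∀ u v : Fin (k + 3), (u - v).val = 1 → G.Adj u v := by
      intro u v h
      rcases le_or_gt v u with h' | h'
      · rw [Fin.sub_val_of_le h'] at h
        exact (hpath _ _ (by omega)).symm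
      · rw [Fin.coe_sub_iff_lt.mpr h'] at h
        exact hclose _ _ (by omega) (by omega)
    intro u v h
    rcases cycleGraph_adj'.1 h with h | h
    · exact this _ _ h
    · exact (this _ _ h).symm
  refine ⟨(cycleGraph.cycle k).mapLe le, ?_, ?_⟩
  · rw [Walk.isHamiltonianCycle_iff_isCycle_and_length_eq]
    refine ⟨cycleGraph.isCycle_cycle.mapLe le, by simp⟩
  · intro i j h
    rw [Walk.edges_mapLe_eq_edges, Walk.mk_mem_edges_iff_exists]
    rcases h with h | ⟨h, h'⟩
    · refine ⟨k + 3 - j.val, by rw [cycleGraph.length_cycle]; omega, ?_⟩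
      rw [cycleGraph.getVert_cycle (by omega), cycleGraph.getVert_cycle (by omega), Sym2.eq_swap]
      congr 2
      · rw [Nat.mod_eq_of_lt (by omega)]; omega
      · rw [Nat.mod_eq_of_lt (by omega)]; omega
    · refine ⟨0, by simp, ?_⟩
      rw [cycleGraph.getVert_cycle (by omega), cycleGraph.getVert_cycle (by omega)]
      congr 2
      · simp [h]
      · rw [Nat.mod_eq_of_lt (by omega)]; omega

/-! ### The family -/

/-- The edges of the family, written with the smaller endpoint first.  The vertex `a_i` sits at
position `i` and `b_i` at position `8 m + 1 - i` of the outer cycle (`0 ≤ i ≤ 4 m`). -/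
def ladderRel (m x y : ℕ) : Prop :=
  x < y ∧ (y = x + 1 ∨ (x = 0 ∧ y = 8 * m + 1) ∨ x + y = 8 * m + 1 ∨
    (x + y = 8 * m ∧ x % 4 ≤ 1) ∨ (x + y = 8 * m + 2 ∧ (x % 4 = 3 ∨ x % 4 = 0)))

/-- The ladder-like triangulation on `8 m + 2` vertices. -/
def ladder (m : ℕ) : SimpleGraph (Fin (8 * m + 2)) where
  Adj u v := ladderRel m u v ∨ ladderRel m v u
  symm := ⟨fun _ _ h => h.symm⟩
  loopless := ⟨fun u h => by rcases h with h | h <;> exact lt_irrefl _ h.1⟩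

theorem ladder_adj_lt {m : ℕ} {u v : Fin (8 * m + 2)} (h : u < v) :
    (ladder m).Adj u v ↔ ladderRel m u v := by
  constructor
  · rintro (h' | h')
    · exact h'
    · exact absurd h'.1 (by simpa using h.le)
  · exact Or.inl

theorem ladder_nonCross (m : ℕ) : NonCross (ladder m) := by
  intro p q r s hpq hqr hrs h1 h2
  rw [ladder_adj_lt (hpq.trans hqr)] at h1
  rw [ladder_adj_lt (hqr.trans hrs)] at h2
  unfold ladderRel at h1 h2
  omega

theorem ladder_path (m : ℕ) (i j : Fin (8 * m + 2)) (h : i.val + 1 = j.val) :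
    (ladder m).Adj i j := by
  left; unfold ladderRel; omega

theorem ladder_close (m : ℕ) (i j : Fin (8 * m + 2)) (h : i.val = 0) (h' : j.val + 1 = 8 * m + 2) :
    (ladder m).Adj i j := by
  left; unfold ladderRel; omega

theorem ladder_max (m : ℕ) (u v : Fin (8 * m + 2)) (huv : u < v) (hna : ¬ (ladder m).Adj u v) :
    ∃ x y : Fin (8 * m + 2), (ladder m).Adj x y ∧ u < x ∧ x < v ∧ (y < u ∨ v < y) := by
  rw [ladder_adj_lt huv] at hna
  obtain ⟨u, hu⟩ := u
  obtain ⟨v, hv⟩ := v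
  simp only [Fin.mk_lt_mk] at huv
  simp only [ladderRel, huv, true_and] at hna
  push Not at hna
  have mk : ∀ x y : ℕ, x < 8 * m + 2 → y < 8 * m + 2 → (ladderRel m x y ∨ ladderRel m y x) →
      u < x → x < v → (y < u ∨ v < y) →
      ∃ x y : Fin (8 * m + 2), (ladder m).Adj x y ∧ (⟨u, hu⟩ : Fin (8 * m + 2)) < x ∧
        x < ⟨v, hv⟩ ∧ (y < ⟨u, hu⟩ ∨ ⟨v, hv⟩ < y) :=
    fun x y hx hy h1 h2 h3 h4 => ⟨⟨x, hx⟩, ⟨y, hy⟩, h1, h2, h3, h4⟩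
  rcases lt_trichotomy (u + v) (8 * m + 1) with h | h | h
  · by_cases h' : u + v = 8 * m
    · exact mk (u + 1) (v + 1) (by omega) (by omega) (by unfold ladderRel; omega)
        (by omega) (by omega) (by omega)
    · exact mk (u + 1) (8 * m - u) (by omega) (by omega) (by unfold ladderRel; omega)
        (by omega) (by omega) (by omega)
  · omega
  · by_cases h' : u + v = 8 * m + 2
    · exact mk (v - 1) (u - 1) (by omega) (by omega) (by unfold ladderRel; omega)
        (by omega) (by omega) (by omega)
    · exact mk (v - 1) (8 * m + 2 - v) (by omega) (by omega) (by unfold ladderRel; omega)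
        (by omega) (by omega) (by omega)

theorem ladder_maximalOuterplanar (m : ℕ) : MaximalOuterplanar (ladder m) :=
  maximalOuterplanar_of (ladder_nonCross m) (ladder_path m) (ladder_close m) (ladder_max m)

theorem ladder_striped (m : ℕ) (T : Finset (Fin (8 * (m + 1) + 2))) :
    ¬ IsInternalTriangle (ladder (m + 1)) T := by
  rintro ⟨a, b, c, -, hab, hac, hbc, h1, h2, h3, h4⟩
  obtain ⟨p, hp, hE⟩ := exists_hamiltonian (k := 8 * m + 7) (G := ladder (m + 1))
    (ladder_path (m + 1)) (ladder_close (m + 1))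
  obtain ⟨n1, n2, n3⟩ := h4 p hp
  have F : ∀ i j : Fin (8 * (m + 1) + 2), s(i, j) ∉ p.edges →
      ¬ (i.val + 1 = j.val) ∧ ¬ (i.val = 0 ∧ j.val = 8 * m + 9) ∧
      ¬ (j.val + 1 = i.val) ∧ ¬ (j.val = 0 ∧ i.val = 8 * m + 9) := by
    intro i j h
    refine ⟨fun h' => h (hE i j (Or.inl h')), fun h' => h (hE i j (Or.inr ⟨h'.1, by omega⟩)),
      fun h' => h (Sym2.eq_swap ▸ hE j i (Or.inl h')),
      fun h' => h (Sym2.eq_swap ▸ hE j i (Or.inr ⟨h'.1, by omega⟩))⟩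
  have g1 := F _ _ n1
  have g2 := F _ _ n2
  have g3 := F _ _ n3
  have S : ∀ i j : Fin (8 * (m + 1) + 2), (ladder (m + 1)).Adj i j →
      (¬ (i.val + 1 = j.val) ∧ ¬ (i.val = 0 ∧ j.val = 8 * m + 9) ∧
      ¬ (j.val + 1 = i.val) ∧ ¬ (j.val = 0 ∧ i.val = 8 * m + 9)) →
      8 * m + 8 ≤ i.val + j.val ∧ i.val + j.val ≤ 8 * m + 10 ∧
      (i.val + 2 ≤ j.val ∨ j.val + 2 ≤ i.val) := by
    intro i j h h'
    rcases h with h | h <;> unfold ladderRel at h <;> omega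
  have s1 := S _ _ h1 g1
  have s2 := S _ _ h2 g2
  have s3 := S _ _ h3 g3
  omega

theorem ladder_lower (m : ℕ) (hm : 1 ≤ m) [DecidableRel (ladder m).Adj]
    (S : Finset (Fin (8 * m + 2))) (hS : IsDoubleDomSet (ladder m) S) : 4 * m + 2 ≤ S.card := by
  let c : Fin (2 * m + 1) → Fin (8 * m + 2) := fun t =>
    ⟨if t.val < m then 4 * t.val + 2 else 4 * t.val + 1, by split_ifs <;> omega⟩
  let B : Fin (2 * m + 1) → Finset (Fin (8 * m + 2)) := fun t =>
    S ∩ insert (c t) ((ladder m).neighborFinset (c t))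
  -- coordinates of the members of a closed neighbourhood
  have hmem : ∀ t z, z ∈ B t →
      (t.val < m ∧ (z.val = 4 * t.val + 1 ∨ z.val = 4 * t.val + 2 ∨ z.val = 4 * t.val + 3 ∨
        z.val + (4 * t.val + 2) = 8 * m + 1)) ∨
      (m ≤ t.val ∧ (z.val = 4 * t.val ∧ t.val ≠ m ∨ z.val = 4 * t.val + 1 ∨
        z.val = 4 * t.val + 2 ∨ z.val + (4 * t.val + 1) = 8 * m + 1)) := by
    intro t z hz
    simp only [B, Finset.mem_inter, Finset.mem_insert, mem_neighborFinset] at hz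
    obtain ⟨-, hz⟩ := hz
    have hc : (c t).val = if t.val < m then 4 * t.val + 2 else 4 * t.val + 1 := rfl
    have ht := t.2
    have hz2 := z.2
    rcases hz with hz | hz | hz
    · rw [hz]; split_ifs at hc <;> omega
    · unfold ladderRel at hz; split_ifs at hc <;> omega
    · unfold ladderRel at hz; split_ifs at hc <;> omega
  have hdis : ∀ s ∈ (Finset.univ : Finset (Fin (2 * m + 1))), ∀ t ∈ (Finset.univ : Finset _),
      s ≠ t → Disjoint (B s) (B t) := by
    intro s _ t _ hst
    rw [Finset.disjoint_left]
    intro z h1 h2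
    have h1 := hmem _ _ h1
    have h2 := hmem _ _ h2
    have := s.2
    have := t.2
    have : s.val ≠ t.val := fun h => hst (Fin.ext h)
    omega
  calc 4 * m + 2 = ∑ t : Fin (2 * m + 1), 2 := by simp; ring
    _ ≤ ∑ t, (B t).card := Finset.sum_le_sum fun t _ => hS (c t)
    _ = (Finset.univ.biUnion B).card := (Finset.card_biUnion hdis).symm
    _ ≤ S.card := Finset.card_le_card (Finset.biUnion_subset.2 fun t _ => Finset.inter_subset_left)

theorem ladder_upper (m : ℕ) (hm : 1 ≤ m) [DecidableRel (ladder m).Adj] :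
    ∃ S : Finset (Fin (8 * m + 2)), IsDoubleDomSet (ladder m) S ∧ S.card ≤ 4 * m + 2 := by
  let f : Fin (4 * m + 2) → Fin (8 * m + 2) := fun i =>
    ⟨if i.val < 2 * m then 2 * i.val + 1 else if i.val < 4 * m then 2 * i.val + 2
      else if i.val = 4 * m then 4 * m + 1 else 8 * m + 1, by split_ifs <;> omega⟩
  refine ⟨Finset.univ.image f, ?_, Finset.card_image_le.trans (by simp)⟩
  have hmem : ∀ z : Fin (8 * m + 2), (z.val < 4 * m ∧ z.val % 2 = 1 ∨
      4 * m < z.val ∧ z.val % 2 = 0 ∨ z.val = 4 * m + 1 ∨ z.val = 8 * m + 1) →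
      z ∈ Finset.univ.image f := by
    intro z hz
    rw [Finset.mem_image]
    have hz2 := z.2
    rcases hz with hz | hz | hz | hz
    · refine ⟨⟨z.val / 2, by omega⟩, Finset.mem_univ _, Fin.ext ?_⟩
      simp only [f]; split_ifs <;> omega
    · refine ⟨⟨z.val / 2 - 1, by omega⟩, Finset.mem_univ _, Fin.ext ?_⟩
      simp only [f]; split_ifs <;> omega
    · refine ⟨⟨4 * m, by omega⟩, Finset.mem_univ _, Fin.ext ?_⟩
      simp only [f]; split_ifs <;> omega
    · refine ⟨⟨4 * m + 1, by omega⟩, Finset.mem_univ _, Fin.ext ?_⟩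
      simp only [f]; split_ifs <;> omega
  intro v
  obtain ⟨v, hv⟩ := v
  have mk : ∀ x y : ℕ, x < 8 * m + 2 → y < 8 * m + 2 → x ≠ y →
      (x < 4 * m ∧ x % 2 = 1 ∨ 4 * m < x ∧ x % 2 = 0 ∨ x = 4 * m + 1 ∨ x = 8 * m + 1) →
      (y < 4 * m ∧ y % 2 = 1 ∨ 4 * m < y ∧ y % 2 = 0 ∨ y = 4 * m + 1 ∨ y = 8 * m + 1) →
      (x = v ∨ ladderRel m v x ∨ ladderRel m x v) → (y = v ∨ ladderRel m v y ∨ ladderRel m y v) →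
      2 ≤ (Finset.univ.image f ∩ insert (⟨v, hv⟩ : Fin (8 * m + 2))
        ((ladder m).neighborFinset ⟨v, hv⟩)).card := by
    intro x y hx hy hxy h1 h2 h3 h4
    refine Finset.one_lt_card.2 ⟨⟨x, hx⟩, ?_, ⟨y, hy⟩, ?_, fun h => hxy (Fin.mk.inj h)⟩
    · rw [Finset.mem_inter, Finset.mem_insert, mem_neighborFinset]
      exact ⟨hmem _ h1, h3.imp (fun h => Fin.ext h) id⟩
    · rw [Finset.mem_inter, Finset.mem_insert, mem_neighborFinset]
      exact ⟨hmem _ h2, h4.imp (fun h => Fin.ext h) id⟩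
  unfold ladderRel at mk
  rcases lt_or_ge (4 * m) v with h | h
  · -- the `b` side
    by_cases c1 : v = 8 * m + 1
    · exact mk (8 * m + 1) (8 * m) (by omega) (by omega) (by omega) (by omega) (by omega)
        (by omega) (by omega)
    by_cases c2 : v = 4 * m + 1
    · exact mk (4 * m + 1) (4 * m + 2) (by omega) (by omega) (by omega) (by omega) (by omega)
        (by omega) (by omega)
    by_cases c3 : v % 2 = 0
    · exact mk v (8 * m + 1 - v) (by omega) (by omega) (by omega) (by omega) (by omega)
        (by omega) (by omega)
    · exact mk (v - 1) (v + 1) (by omega) (by omega) (by omega) (by omega) (by omega)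
        (by omega) (by omega)
  · -- the `a` side
    by_cases c1 : v = 0
    · exact mk 1 (8 * m) (by omega) (by omega) (by omega) (by omega) (by omega)
        (by omega) (by omega)
    by_cases c2 : v = 4 * m
    · exact mk (4 * m - 1) (4 * m + 2) (by omega) (by omega) (by omega) (by omega) (by omega)
        (by omega) (by omega)
    by_cases c3 : v % 2 = 1
    · exact mk v (8 * m + 1 - v) (by omega) (by omega) (by omega) (by omega) (by omega)
        (by omega) (by omega)
    · exact mk (v - 1) (v + 1) (by omega) (by omega) (by omega) (by omega) (by omega)
        (by omega) (by omega)

theorem ladder_doubleDomNum (m : ℕ) (hm : 1 ≤ m) [DecidableRel (ladder m).Adj] :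
    doubleDomNum (ladder m) = 4 * m + 2 := by
  obtain ⟨S, hS, hcard⟩ := ladder_upper m hm
  unfold doubleDomNum
  apply le_antisymm
  · exact le_trans (Nat.sInf_le (Set.mem_ofPred_eq ▸ ⟨S, hS, rfl⟩)) hcard
  · refine le_csInf ⟨_, S, hS, rfl⟩ ?_
    rintro k ⟨S', hS', rfl⟩
    exact ladder_lower m hm S' hS'

/-- There are striped maximal outerplanar graphs of arbitrarily
large order `n ≡ 2 (mod 4)` with `γ×2(G) = n/2 + 1`; so the bound
`γ×2 ≤ ⌊n/2⌋ + 1` is tight. -/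
theorem striped_bound_tight :
    ∀ N : ℕ, ∃ n : ℕ, N ≤ n ∧ n % 4 = 2 ∧
      ∃ G : SimpleGraph (Fin n), MaximalOuterplanar G ∧
        (∀ T : Finset (Fin n), ¬ IsInternalTriangle G T) ∧
        @doubleDomNum _ _ _ G (Classical.decRel _) = n / 2 + 1 := by
  intro N
  refine ⟨8 * (N + 1) + 2, by omega, by omega, ladder (N + 1), ladder_maximalOuterplanar _,
    ladder_striped N, ?_⟩
  rw [@ladder_doubleDomNum (N + 1) (by omega) (Classical.decRel _)]
  omega
end
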